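/- (Lemma 3.3, boundedness of the Green's function near the boundary.) Assume λ ≤ det D²u ≤ Λ in Ω and let V ⊂⊂ Ω be open. Then there exist constants r > 0 and C > 0 depending only on V, Ω, n, λ, Λ such that: for every x₀ ∈ V with dist(x₀, ∂V) ≥ dist(V, ∂Ω), one has S_u(x₀, 2r) ⊂⊂ V, and every Green's function g_V(·, x₀) of L_u in V with pole x₀ satisfies g_V(x, x₀) ≤ C for all x ∈ ∂S_u(x₀, r). -/

import Mathlib

open MeasureTheory

noncomputable section

/-- Euclidean space `ℝⁿ`. -/
abbrev E (n : ℕ) := EuclideanSpace ℝ (Fin n)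

/-- First partial derivative `∂_i f (x)`. -/
noncomputable def pd {n : ℕ} (f : E n → ℝ) (x : E n) (i : Fin n) : ℝ :=
  fderiv ℝ f x (EuclideanSpace.single i 1)

/-- Second partial derivative `∂_{ij} f (x)`. -/
noncomputable def pd2 {n : ℕ} (f : E n → ℝ) (x : E n) (i j : Fin n) : ℝ :=
  fderiv ℝ (fun y => fderiv ℝ f y (EuclideanSpace.single j 1)) x (EuclideanSpace.single i 1)

/-- Hessian matrix `D²f(x)`. -/
noncomputable def Hess {n : ℕ} (f : E n → ℝ) (x : E n) : Matrix (Fin n) (Fin n) ℝ :=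
  Matrix.of fun i j => pd2 f x i j

/-- The cofactor matrix `U = (det D²u)(D²u)⁻¹` of the Hessian of `u`,
realized as the adjugate. -/
noncomputable def cofU {n : ℕ} (u : E n → ℝ) (x : E n) : Matrix (Fin n) (Fin n) ℝ :=
  (Hess u x).adjugate

/-- Section of the convex function `u`:
`S_u(x₀,t) = {x ∈ cl Ω : u x < u x₀ + ∇u(x₀)·(x - x₀) + t}`. -/
def MASection {n : ℕ} (Ω : Set (E n)) (u : E n → ℝ) (x₀ : E n) (t : ℝ) : Set (E n) :=
  {x ∈ closure Ω | u x < u x₀ + fderiv ℝ u x₀ (x - x₀) + t}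

/-- `A ⊂⊂ B`: the closure of `A` is a compact subset of `B`. -/
def CptIn {n : ℕ} (A B : Set (E n)) : Prop :=
  IsCompact (closure A) ∧ closure A ⊆ B

/-- Uniform convexity of a domain: balls of radius proportional to `‖x - y‖²`
centered at midpoints of points of the closure stay in the closure. -/
def UnifConvex {n : ℕ} (Ω : Set (E n)) : Prop :=
  ∃ δ > 0, ∀ x ∈ closure Ω, ∀ y ∈ closure Ω,
    Metric.closedBall (midpoint ℝ x y) (δ * ‖x - y‖ ^ 2) ⊆ closure Ω

/-- Standing assumptions: `Ω` is a bounded, open, nonempty, uniformly convex domain and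
`u` is a smooth convex function on `cl Ω` vanishing on `∂Ω`. -/
def MASetup {n : ℕ} (Ω : Set (E n)) (u : E n → ℝ) : Prop :=
  IsOpen Ω ∧ Bornology.IsBounded Ω ∧ Ω.Nonempty ∧ UnifConvex Ω ∧
  ContDiffOn ℝ (⊤ : ℕ∞) u (closure Ω) ∧ ConvexOn ℝ (closure Ω) u ∧
  ∀ x ∈ frontier Ω, u x = 0

/-- `λ ≤ det D²u ≤ Λ` in `Ω`. -/
def DetBounds {n : ℕ} (Ω : Set (E n)) (u : E n → ℝ) (lam Lam : ℝ) : Prop :=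
  ∀ x ∈ Ω, lam ≤ (Hess u x).det ∧ (Hess u x).det ≤ Lam

/-- The Monge-Ampère measure of `u`: `μ(A) = ∫_A det D²u`. -/
noncomputable def maMeasure {n : ℕ} (u : E n → ℝ) (A : Set (E n)) : ℝ :=
  ∫ x in A, (Hess u x).det

/-- Center of mass of a set. -/
noncomputable def centerOfMass {n : ℕ} (S : Set (E n)) : E n :=
  (volume S).toReal⁻¹ • ∫ x in S, x

/-- The `α`-dilation of `S` with respect to its center of mass. -/
def dilateCM {n : ℕ} (α : ℝ) (S : Set (E n)) : Set (E n) :=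
  (fun x => centerOfMass S + α • (x - centerOfMass S)) '' S

/-- The Monge-Ampère measure of `u` is doubling with respect to the center of mass
on the sections of `u`, with constants `0 < α < 1 < β`. -/
def DoublingCM {n : ℕ} (Ω : Set (E n)) (u : E n → ℝ) (α β : ℝ) : Prop :=
  0 < α ∧ α < 1 ∧ 1 < β ∧
  ∀ x₀ ∈ Ω, ∀ t : ℝ, 0 < t → CptIn (MASection Ω u x₀ t) Ω →
    maMeasure u (MASection Ω u x₀ t) ≤ β * maMeasure u (dilateCM α (MASection Ω u x₀ (t / 2)))

/-- `g` is a Green's function of the linearized Monge-Ampère operator `L_u` in `V`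
with pole `y`: positive and smooth on `V \ {y}`, `L_u`-harmonic there, vanishing
continuously on `∂V`, and `∫_V g · (L_u φ) = φ(y)` (i.e. `∫_V g · U^{ij}∂_{ij}φ = -φ(y)`)
for all test functions `φ`. -/
def IsGreen {n : ℕ} (u : E n → ℝ) (V : Set (E n)) (y : E n) (g : E n → ℝ) : Prop :=
  (∀ x ∈ V \ {y}, 0 < g x) ∧
  ContDiffOn ℝ (⊤ : ℕ∞) g (V \ {y}) ∧
  (∀ x ∈ V \ {y}, ∑ i, ∑ j, cofU u x i j * pd2 g x i j = 0) ∧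
  ContinuousOn g (closure V \ {y}) ∧
  (∀ x ∈ frontier V, g x = 0) ∧
  ∀ φ : E n → ℝ, ContDiff ℝ (⊤ : ℕ∞) φ → HasCompactSupport φ → tsupport φ ⊆ V →
    (∫ x in V, g x * ∑ i, ∑ j, cofU u x i j * pd2 φ x i j) = -φ y

/-- Capacity of a compact set `K` relative to `V` for the operator `L_u`:
the infimum of `∫_V U^{ij} ∂_iΦ ∂_jΦ` over Lipschitz `Φ` compactly supported in `V`
with `Φ ≥ 1` on `K`. -/
noncomputable def capacity {n : ℕ} (u : E n → ℝ) (K V : Set (E n)) : ℝ :=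
  sInf { e : ℝ | ∃ Φ : E n → ℝ, (∃ L : NNReal, LipschitzWith L Φ) ∧
    HasCompactSupport Φ ∧ tsupport Φ ⊆ V ∧ (∀ x ∈ K, 1 ≤ Φ x) ∧
    e = ∫ x in V, ∑ i, ∑ j, cofU u x i j * pd Φ x i * pd Φ x j }

section MatrixInequalities

open Matrix

variable {n : ℕ}

lemma adjugate_sum_eq_trace {A B : Matrix (Fin n) (Fin n) ℝ} (hB : B.IsHermitian) :
    ∑ i, ∑ j, A.adjugate i j * B i j = (A.adjugate * B).trace := by
  simp only [trace, diag_apply, mul_apply]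
  refine Finset.sum_congr rfl fun i _ => Finset.sum_congr rfl fun j _ => ?_
  have := hB.apply i j
  simp only [star_trivial] at this
  rw [this]

lemma adjugate_eq_det_smul_inv {A : Matrix (Fin n) (Fin n) ℝ} (hA : A.PosDef) :
    A.adjugate = A.det • A⁻¹ := by
  have := hA.det_pos.ne'
  rw [Matrix.inv_def, Ring.inverse_eq_inv', smul_smul, mul_inv_cancel₀ this, one_smul]

lemma exists_eq_transpose_mul_self {B : Matrix (Fin n) (Fin n) ℝ} (hB : B.PosSemidef) :
    ∃ C : Matrix (Fin n) (Fin n) ℝ, B = Cᴴ * C := by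
  open scoped MatrixOrder in
  obtain ⟨C, hC⟩ := CStarAlgebra.nonneg_iff_eq_star_mul_self.1 hB.nonneg
  exact ⟨C, hC⟩

lemma adjugate_sum_nonneg {A B : Matrix (Fin n) (Fin n) ℝ} (hA : A.PosDef) (hB : B.PosSemidef) :
    0 ≤ ∑ i, ∑ j, A.adjugate i j * B i j := by
  rw [adjugate_sum_eq_trace hB.1, adjugate_eq_det_smul_inv hA]
  obtain ⟨C, rfl⟩ := exists_eq_transpose_mul_self hB
  rw [smul_mul, trace_smul, smul_eq_mul, trace_mul_comm, Matrix.mul_assoc, trace_mul_comm]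
  exact mul_nonneg hA.det_pos.le
    (Matrix.PosSemidef.mul_mul_conjTranspose_same hA.inv.posSemidef C).trace_nonneg

lemma prod_le_pow_of_sum_le {z : Fin n → ℝ} (hz : ∀ i, 0 ≤ z i) {τ : ℝ}
    (h : ∑ i, z i ≤ n * τ) : ∏ i, z i ≤ τ ^ n := by
  rcases Nat.eq_zero_or_pos n with rfl | hn
  · simp
  have hn' : (0 : ℝ) < n := by exact_mod_cast hn
  have h1 := Real.geom_mean_le_arith_mean Finset.univ (fun _ => (1 : ℝ)) z (by simp)
    (by simpa using hn) (fun i _ => hz i)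
  simp only [Real.rpow_one, Finset.sum_const, Finset.card_univ, Fintype.card_fin, nsmul_eq_mul,
    mul_one, one_mul] at h1
  have h0 : 0 ≤ ∏ i, z i := Finset.prod_nonneg fun i _ => hz i
  have h2 : (∏ i, z i) ^ ((n : ℝ)⁻¹) ≤ τ := h1.trans (by rwa [div_le_iff₀' hn'])
  calc ∏ i, z i = ((∏ i, z i) ^ ((n : ℝ)⁻¹)) ^ n := (Real.rpow_inv_natCast_pow h0 hn.ne').symm
    _ ≤ τ ^ n := by gcongr

lemma det_le_of_adjugate_sum_le {A B : Matrix (Fin n) (Fin n) ℝ} (hA : A.PosDef)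
    (hB : B.PosSemidef) {τ : ℝ} (h : ∑ i, ∑ j, A.adjugate i j * B i j ≤ n * τ * A.det) :
    B.det ≤ τ ^ n * A.det := by
  rw [adjugate_sum_eq_trace hB.1, adjugate_eq_det_smul_inv hA] at h
  obtain ⟨C, rfl⟩ := exists_eq_transpose_mul_self hB
  rw [smul_mul, trace_smul, smul_eq_mul, trace_mul_comm, Matrix.mul_assoc, trace_mul_comm] at h
  have hd := hA.det_pos
  have hM := Matrix.PosSemidef.mul_mul_conjTranspose_same hA.inv.posSemidef C
  have ht : (C * A⁻¹ * Cᴴ).trace ≤ n * τ := by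
    nlinarith
  have h2 : (C * A⁻¹ * Cᴴ).det ≤ τ ^ n := by
    rw [hM.1.det_eq_prod_eigenvalues]
    rw [hM.1.trace_eq_sum_eigenvalues] at ht
    exact prod_le_pow_of_sum_le (fun i => hM.eigenvalues_nonneg i) (by simpa using ht)
  have h3 : (C * A⁻¹ * Cᴴ).det * A.det = (Cᴴ * C).det := by
    rw [det_mul, det_mul, det_mul, mul_right_comm _ _ A.det, mul_assoc C.det, ← det_mul A⁻¹,
      nonsing_inv_mul _ hd.ne'.isUnit, det_one]
    ring
  rw [← h3]
  gcongr

lemma adjugate_sum_self {A : Matrix (Fin n) (Fin n) ℝ} (hA : A.IsHermitian) :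
    ∑ i, ∑ j, A.adjugate i j * A i j = n * A.det := by
  rw [adjugate_sum_eq_trace hA, adjugate_mul, trace_smul, trace_one]
  simp [mul_comm]

lemma det_le_det_of_sub_posSemidef {A B : Matrix (Fin n) (Fin n) ℝ} (hA : A.PosDef)
    (hAB : (B - A).PosSemidef) : A.det ≤ B.det := by
  have hB : B.PosDef := by simpa using hA.add_posSemidef hAB
  have h := adjugate_sum_nonneg hB hAB
  have h2 := det_le_of_adjugate_sum_le hB hA.posSemidef (τ := 1) (by
    have := adjugate_sum_self hB.1
    have h' : ∑ i, ∑ j, B.adjugate i j * (B - A) i j =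
        ∑ i, ∑ j, B.adjugate i j * B i j - ∑ i, ∑ j, B.adjugate i j * A i j := by
      simp only [Matrix.sub_apply, mul_sub, Finset.sum_sub_distrib]
    linarith)
  simpa using h2

lemma adjugate_sum_vec_nonneg {A : Matrix (Fin n) (Fin n) ℝ} (hA : A.PosDef) (ξ : Fin n → ℝ) :
    0 ≤ ∑ i, ∑ j, A.adjugate i j * (ξ i * ξ j) := by
  have := adjugate_sum_nonneg hA (Matrix.posSemidef_vecMulVec_self_star ξ)
  simpa [vecMulVec_apply] using this

end MatrixInequalities

section SecondDerivatives

open Matrix Filter Topology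

variable {n : ℕ} {f g : E n → ℝ} {x : E n}

lemma ContDiffAt.eventually_differentiableAt_of_two (hf : ContDiffAt ℝ 2 f x) :
    ∀ᶠ y in 𝓝 x, DifferentiableAt ℝ f y :=
  (hf.eventually (by simp)).mono fun _ h => h.differentiableAt (by simp)

lemma ContDiffAt.differentiableAt_fderiv (hf : ContDiffAt ℝ 2 f x) :
    DifferentiableAt ℝ (fderiv ℝ f) x :=
  (hf.fderiv_right (m := 1) (by norm_num)).differentiableAt (by simp)

lemma ContDiffAt.differentiableAt_fderiv_apply (hf : ContDiffAt ℝ 2 f x) (v : E n) :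
    DifferentiableAt ℝ (fun y => fderiv ℝ f y v) x :=
  hf.differentiableAt_fderiv.clm_apply (differentiableAt_const v)

lemma fderiv_fderiv_apply (hf : ContDiffAt ℝ 2 f x) (v w : E n) :
    fderiv ℝ (fun y => fderiv ℝ f y w) x v = fderiv ℝ (fderiv ℝ f) x v w := by
  rw [fderiv_clm_apply hf.differentiableAt_fderiv (differentiableAt_const w)]
  simp

lemma Hess_apply (hf : ContDiffAt ℝ 2 f x) (i j : Fin n) :
    Hess f x i j =
      fderiv ℝ (fderiv ℝ f) x (EuclideanSpace.single i 1) (EuclideanSpace.single j 1) :=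
  fderiv_fderiv_apply hf _ _

lemma fderiv_fderiv_symm (hf : ContDiffAt ℝ 2 f x) (v w : E n) :
    fderiv ℝ (fderiv ℝ f) x v w = fderiv ℝ (fderiv ℝ f) x w v :=
  (hf.isSymmSndFDerivAt (by simp)).eq v w

lemma Hess_isHermitian (hf : ContDiffAt ℝ 2 f x) : (Hess f x).IsHermitian := by
  ext i j
  simp only [conjTranspose_apply, star_trivial]
  rw [Hess_apply hf, Hess_apply hf, fderiv_fderiv_symm hf]

lemma euclidean_eq_sum_single (v : E n) : v = ∑ i, v i • EuclideanSpace.single i (1 : ℝ) := by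
  ext j
  simp [Pi.single_apply]

lemma dotProduct_Hess_mulVec (hf : ContDiffAt ℝ 2 f x) (v w : E n) :
    (v : Fin n → ℝ) ⬝ᵥ (Hess f x *ᵥ (w : Fin n → ℝ)) = fderiv ℝ (fderiv ℝ f) x v w := by
  conv_rhs => rw [euclidean_eq_sum_single v, euclidean_eq_sum_single w]
  simp only [map_sum, map_smul, _root_.sum_apply, _root_.smul_apply,
    dotProduct, mulVec, smul_eq_mul, ← Hess_apply hf]
  simp only [Finset.mul_sum]
  rw [Finset.sum_comm]
  refine Finset.sum_congr rfl fun i _ => Finset.sum_congr rfl fun j _ => by ring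

lemma Hess_posSemidef_iff (hf : ContDiffAt ℝ 2 f x) :
    (Hess f x).PosSemidef ↔ ∀ v, 0 ≤ fderiv ℝ (fderiv ℝ f) x v v := by
  constructor
  · intro h v
    have := h.dotProduct_mulVec_nonneg (v : Fin n → ℝ)
    rwa [star_trivial, dotProduct_Hess_mulVec hf] at this
  · intro h
    refine .of_dotProduct_mulVec_nonneg (Hess_isHermitian hf) fun v => ?_
    have := h (WithLp.toLp 2 v)
    rwa [← dotProduct_Hess_mulVec hf] at this

lemma IsLocalMin.fderiv_fderiv_nonneg (hf : ContDiffAt ℝ 2 f x) (hx : IsLocalMin f x) (v : E n) :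
    0 ≤ fderiv ℝ (fderiv ℝ f) x v v := by
  by_contra! hneg
  set φ : ℝ → ℝ := fun t => f (x + t • v) with hφ
  have hline : ∀ t : ℝ, HasDerivAt (fun t : ℝ => x + t • v) v t := fun t => by
    simpa using ((hasDerivAt_id t).smul_const v).const_add x
  have hcont : Tendsto (fun t : ℝ => x + t • v) (𝓝 0) (𝓝 x) := by
    have := (hline 0).continuousAt.tendsto
    simpa using this
  have hd : deriv φ =ᶠ[𝓝 (0 : ℝ)] fun t => fderiv ℝ f (x + t • v) v := by
    filter_upwards [hcont.eventually hf.eventually_differentiableAt_of_two] with t ht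
    exact (ht.hasFDerivAt.comp_hasDerivAt t (hline t)).deriv
  have hmin : IsLocalMin φ 0 := by
    have := hcont.eventually hx
    filter_upwards [this] with t ht
    simpa [hφ] using ht
  have hd2 : deriv (deriv φ) 0 = fderiv ℝ (fderiv ℝ f) x v v := by
    rw [hd.deriv_eq, ← fderiv_fderiv_apply hf]
    have h1 : HasFDerivAt (fun y => fderiv ℝ f y v) (fderiv ℝ (fun y => fderiv ℝ f y v) x)
        (x + (0 : ℝ) • v) := by
      simpa using (hf.differentiableAt_fderiv_apply v).hasFDerivAt
    exact (h1.comp_hasDerivAt (0 : ℝ) (hline 0)).deriv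
  have hcφ : ContinuousAt φ 0 := by
    have : ContinuousAt f (x + (0 : ℝ) • v) := by simpa using hf.continuousAt
    exact ContinuousAt.comp (f := fun t : ℝ => x + t • v) this (hline 0).continuousAt
  have hmax := isLocalMax_of_deriv_deriv_neg (by rw [hd2]; exact hneg) hmin.deriv_eq_zero hcφ
  have hconst : φ =ᶠ[𝓝 0] fun _ => φ 0 := by
    filter_upwards [hmin, hmax] with t h1 h2 using le_antisymm h2 h1
  have h0 : deriv (deriv φ) 0 = 0 := by
    have h1 : deriv φ =ᶠ[𝓝 0] deriv fun _ => φ 0 := hconst.deriv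
    rw [h1.deriv_eq]
    simp
  rw [hd2] at h0
  exact hneg.ne h0

lemma IsLocalMin.Hess_posSemidef (hf : ContDiffAt ℝ 2 f x) (hx : IsLocalMin f x) :
    (Hess f x).PosSemidef :=
  (Hess_posSemidef_iff hf).2 fun v => hx.fderiv_fderiv_nonneg hf v

lemma pd2_congr (h : f =ᶠ[𝓝 x] g) (i j : Fin n) : pd2 f x i j = pd2 g x i j := by
  have : (fun y => fderiv ℝ f y (EuclideanSpace.single j 1)) =ᶠ[𝓝 x]
      fun y => fderiv ℝ g y (EuclideanSpace.single j 1) := by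
    filter_upwards [h.fderiv (𝕜 := ℝ)] with y hy
    rw [hy]
  rw [pd2, this.fderiv_eq, pd2]

lemma pd2_add (hf : ContDiffAt ℝ 2 f x) (hg : ContDiffAt ℝ 2 g x) (i j : Fin n) :
    pd2 (fun y => f y + g y) x i j = pd2 f x i j + pd2 g x i j := by
  have : (fun y => fderiv ℝ (fun y => f y + g y) y (EuclideanSpace.single j 1)) =ᶠ[𝓝 x]
      fun y => fderiv ℝ f y (EuclideanSpace.single j 1) +
        fderiv ℝ g y (EuclideanSpace.single j 1) := by
    filter_upwards [hf.eventually_differentiableAt_of_two, hg.eventually_differentiableAt_of_two]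
      with y h1 h2
    rw [fderiv_fun_add h1 h2]
    rfl
  rw [pd2, this.fderiv_eq, fderiv_fun_add (hf.differentiableAt_fderiv_apply _)
    (hg.differentiableAt_fderiv_apply _)]
  rfl

lemma pd2_const_mul (hf : ContDiffAt ℝ 2 f x) (c : ℝ) (i j : Fin n) :
    pd2 (fun y => c * f y) x i j = c * pd2 f x i j := by
  have : (fun y => fderiv ℝ (fun y => c * f y) y (EuclideanSpace.single j 1)) =ᶠ[𝓝 x]
      fun y => c * fderiv ℝ f y (EuclideanSpace.single j 1) := by
    filter_upwards [hf.eventually_differentiableAt_of_two] with y h1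
    rw [fderiv_const_mul h1]
    rfl
  rw [pd2, this.fderiv_eq, fderiv_const_mul (hf.differentiableAt_fderiv_apply _)]
  rfl

lemma Hess_add (hf : ContDiffAt ℝ 2 f x) (hg : ContDiffAt ℝ 2 g x) :
    Hess (fun y => f y + g y) x = Hess f x + Hess g x := by
  ext i j
  exact pd2_add hf hg i j

lemma Hess_const_mul (hf : ContDiffAt ℝ 2 f x) (c : ℝ) :
    Hess (fun y => c * f y) x = c • Hess f x := by
  ext i j
  exact pd2_const_mul hf c i j

lemma Hess_sub (hf : ContDiffAt ℝ 2 f x) (hg : ContDiffAt ℝ 2 g x) :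
    Hess (fun y => f y - g y) x = Hess f x - Hess g x := by
  have h : (fun y => f y - g y) = fun y => f y + (-1) * g y := by ext y; ring
  rw [h, Hess_add hf (contDiffAt_const.mul hg), Hess_const_mul hg]
  ext i j
  simp [sub_eq_add_neg]

lemma Hess_affine (p : E n →L[ℝ] ℝ) (a : ℝ) : Hess (fun y => p y + a) x = 0 := by
  ext i j
  have : (fun y => fderiv ℝ (fun y => p y + a) y (EuclideanSpace.single j 1)) =
      fun _ => p (EuclideanSpace.single j 1) := by
    ext y
    rw [fderiv_add_const, p.fderiv]
  change pd2 _ x i j = 0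
  rw [pd2, this]
  simp

lemma contDiffAt_affine (p : E n →L[ℝ] ℝ) (a : ℝ) {m : WithTop ℕ∞} :
    ContDiffAt ℝ m (fun y => p y + a) x :=
  p.contDiff.contDiffAt.add contDiffAt_const

lemma Hess_sub_affine (hf : ContDiffAt ℝ 2 f x) (p : E n →L[ℝ] ℝ) (a : ℝ) :
    Hess (fun y => f y - (p y + a)) x = Hess f x := by
  rw [Hess_sub hf (contDiffAt_affine p a), Hess_affine, sub_zero]

lemma pd2_comp {F : ℝ → ℝ} (hf : ContDiffAt ℝ 2 f x) (hF : ContDiffAt ℝ 2 F (f x))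
    (i j : Fin n) :
    pd2 (fun y => F (f y)) x i j =
      deriv F (f x) * pd2 f x i j + deriv (deriv F) (f x) * (pd f x i * pd f x j) := by
  have hFd : DifferentiableAt ℝ (deriv F) (f x) := by
    have h1 := (hF.fderiv_right (m := 1) (by norm_num)).differentiableAt (by simp)
    exact h1.clm_apply (differentiableAt_const 1)
  have hFe : ∀ᶠ t in 𝓝 (f x), DifferentiableAt ℝ F t :=
    (hF.eventually (by simp)).mono fun _ h => h.differentiableAt (by simp)
  have : (fun y => fderiv ℝ (fun y => F (f y)) y (EuclideanSpace.single j 1)) =ᶠ[𝓝 x]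
      fun y => deriv F (f y) * fderiv ℝ f y (EuclideanSpace.single j 1) := by
    filter_upwards [hf.eventually_differentiableAt_of_two, hf.continuousAt.eventually hFe]
      with y h1 h2
    have h3 : HasFDerivAt (fun y => F (f y)) (deriv F (f y) • fderiv ℝ f y) y :=
      h2.hasDerivAt.comp_hasFDerivAt y h1.hasFDerivAt
    rw [h3.fderiv]
    rfl
  have h1 : HasFDerivAt (fun y => deriv F (f y)) (deriv (deriv F) (f x) • fderiv ℝ f x) x :=
    hFd.hasDerivAt.comp_hasFDerivAt x (hf.differentiableAt (by simp)).hasFDerivAt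
  rw [pd2, this.fderiv_eq, (h1.fun_mul (hf.differentiableAt_fderiv_apply _).hasFDerivAt).fderiv]
  simp only [_root_.add_apply, _root_.smul_apply, smul_eq_mul, pd2, pd]
  ring

/-- The Hessian of `b (‖T (y - z)‖² - 1)`. -/
lemma det_Hess_quadratic (T : E n →L[ℝ] E n) (z : E n) (b : ℝ) :
    (Hess (fun y => b * (‖T (y - z)‖ ^ 2 - 1)) x).det = (2 * b) ^ n * T.det ^ 2 := by
  set M : Matrix (Fin n) (Fin n) ℝ :=
    LinearMap.toMatrix (EuclideanSpace.basisFun (Fin n) ℝ).toBasis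
      (EuclideanSpace.basisFun (Fin n) ℝ).toBasis (T : E n →ₗ[ℝ] E n) with hM
  have hdet : M.det = T.det := by
    rw [hM, LinearMap.det_toMatrix]
  have hfd : ∀ y w : E n, fderiv ℝ (fun y => b * (‖T (y - z)‖ ^ 2 - 1)) y w =
      2 * b * inner ℝ (T (y - z)) (T w) := by
    intro y w
    have h1 : HasFDerivAt (fun y => T (y - z)) T y :=
      (T.hasFDerivAt (x := y - z)).comp y ((hasFDerivAt_id y).sub_const z)
    have h2 := ((h1.norm_sq.sub_const 1).const_mul b).fderiv
    rw [h2]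
    simp [-map_sub]
    ring
  have hH : Hess (fun y => b * (‖T (y - z)‖ ^ 2 - 1)) x = (2 * b) • (Mᵀ * M) := by
    ext i j
    change pd2 _ x i j = _
    rw [pd2]
    simp only [hfd]
    have h3 : HasFDerivAt (fun y => 2 * b * inner ℝ (T (y - z)) (T (EuclideanSpace.single j 1)))
        ((2 * b) • (innerSL ℝ (T (EuclideanSpace.single j 1))).comp T) x := by
      have h1 : HasFDerivAt (fun y => T (y - z)) T x :=
        (T.hasFDerivAt (x := x - z)).comp x ((hasFDerivAt_id x).sub_const z)
      have h2 := ((innerSL ℝ (T (EuclideanSpace.single j 1))).hasFDerivAt.comp x h1).const_mul (2 * b)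
      refine h2.congr_of_eventuallyEq (Eventually.of_forall fun y => ?_)
      simp [-map_sub, real_inner_comm]
    rw [h3.fderiv]
    simp only [_root_.smul_apply, ContinuousLinearMap.comp_apply, innerSL_apply_apply,
      smul_eq_mul, Matrix.smul_apply, mul_apply, transpose_apply]
    congr 1
  rw [hH, det_smul, det_mul, det_transpose, hdet, Fintype.card_fin, sq]

/-- The gradient of `f` as a map of `ℝⁿ`. -/
def gradMap (f : E n → ℝ) (y : E n) : E n :=
  ∑ i, pd f y i • EuclideanSpace.single i (1 : ℝ)

lemma inner_gradMap (f : E n → ℝ) (y v : E n) : inner ℝ (gradMap f y) v = fderiv ℝ f y v := by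
  conv_rhs => rw [euclidean_eq_sum_single v]
  simp [gradMap, sum_inner, inner_smul_left, EuclideanSpace.inner_single_left, pd, mul_comm]

/-- The derivative of the gradient map. -/
def gradMapDeriv (f : E n → ℝ) (y : E n) : E n →L[ℝ] E n :=
  ∑ i, (fderiv ℝ (fun y => pd f y i) y).smulRight (EuclideanSpace.single i (1 : ℝ))

lemma hasFDerivAt_gradMap (hf : ContDiffAt ℝ 2 f x) :
    HasFDerivAt (gradMap f) (gradMapDeriv f x) x :=
  HasFDerivAt.fun_sum fun i _ =>
    (hf.differentiableAt_fderiv_apply (EuclideanSpace.single i 1)).hasFDerivAt.smul_const _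

lemma det_gradMapDeriv (f : E n → ℝ) (x : E n) : (gradMapDeriv f x).det = (Hess f x).det := by
  have : LinearMap.toMatrix (EuclideanSpace.basisFun (Fin n) ℝ).toBasis
      (EuclideanSpace.basisFun (Fin n) ℝ).toBasis (gradMapDeriv f x : E n →ₗ[ℝ] E n) =
      (Hess f x)ᵀ := by
    ext i j
    rw [transpose_apply, LinearMap.toMatrix_apply]
    simp [gradMapDeriv, Hess, pd2, pd]
  rw [← det_transpose, ← this, LinearMap.det_toMatrix]

end SecondDerivatives

section ConvexTools

open Matrix Filter Topology Set

variable {n : ℕ}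

/-- The outer radius in the normalization of convex sets. -/
def johnRadius (n : ℕ) : ℝ := 2 * (n + 1) ^ 3

lemma johnRadius_pos (n : ℕ) : 0 < johnRadius n := by
  unfold johnRadius
  positivity

lemma det_toEuclideanCLM (B : Matrix (Fin n) (Fin n) ℝ) :
    (toEuclideanCLM (𝕜 := ℝ) B).det = B.det :=
  LinearMap.det_toLin (EuclideanSpace.basisFun (Fin n) ℝ).toBasis B

lemma det_adjoint (T : E n →L[ℝ] E n) : (ContinuousLinearMap.adjoint T).det = T.det := by
  obtain ⟨B, rfl⟩ : ∃ B, toEuclideanCLM (n := Fin n) (𝕜 := ℝ) B = T := EquivLike.surjective _ T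
  have : ContinuousLinearMap.adjoint (toEuclideanCLM (n := Fin n) (𝕜 := ℝ) B) =
      toEuclideanCLM (n := Fin n) (𝕜 := ℝ) (star B) := by
    rw [← ContinuousLinearMap.star_eq_adjoint, map_star]
  rw [this, det_toEuclideanCLM, det_toEuclideanCLM, star_eq_conjTranspose, det_conjTranspose,
    star_trivial]

lemma norm_le_of_abs_le {v : E n} {a : ℝ} (ha : ∀ i, |v i| ≤ a) (ha0 : 0 ≤ a) :
    ‖v‖ ≤ (n + 1) * a := by
  rw [euclidean_eq_sum_single v]
  refine (norm_sum_le _ _).trans ?_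
  have : ∑ i : Fin n, ‖v i • EuclideanSpace.single i (1 : ℝ)‖ ≤ ∑ _i : Fin n, a := by
    refine Finset.sum_le_sum fun i _ => ?_
    rw [norm_smul]
    simpa using ha i
  refine this.trans ?_
  simp
  nlinarith

/-- A bounded open convex set is comparable to an ellipsoid. -/
lemma exists_normalization {S : Set (E n)} (hSo : IsOpen S) (hSc : Convex ℝ S)
    (hSb : Bornology.IsBounded S) (hSn : S.Nonempty) :
    ∃ (T : E n →L[ℝ] E n) (z : E n), T.det ≠ 0 ∧ (∀ y, ‖T (y - z)‖ < 1 → y ∈ S) ∧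
      ∀ y ∈ closure S, ‖T (y - z)‖ ≤ johnRadius n := by
  obtain ⟨v₀, hv₀⟩ := hSn
  have hK : IsCompact (closure S) := hSb.isCompact_closure
  set A : (Fin n → E n) → Matrix (Fin n) (Fin n) ℝ := fun v => Matrix.of fun i j => v i j - v₀ j
    with hA
  have hAc : Continuous A := by
    refine continuous_matrix fun i j => ?_
    simp only [hA, of_apply]
    fun_prop
  obtain ⟨v, hvK, hvmax⟩ := (isCompact_univ_pi fun _ : Fin n => hK).exists_isMaxOn
    ⟨fun _ => v₀, fun _ _ => subset_closure hv₀⟩ (f := fun v => |(A v).det|)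
    (Continuous.continuousOn (hAc.matrix_det.abs))
  have hpos : 0 < |(A v).det| := by
    obtain ⟨ε, hε, hball⟩ := Metric.isOpen_iff.1 hSo v₀ hv₀
    set v' : Fin n → E n := fun i => v₀ + EuclideanSpace.single i (ε / 2)
    have h1 : v' ∈ univ.pi fun _ : Fin n => closure S := fun i _ => subset_closure <| hball <| by
      simp [v', abs_of_pos hε, hε]
    refine lt_of_lt_of_le ?_ (hvmax h1)
    have : A v' = (ε / 2) • (1 : Matrix (Fin n) (Fin n) ℝ) := by
      ext i j
      simp [hA, v', Matrix.one_apply, eq_comm]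
    simp only [this, det_smul, det_one]
    positivity
  have hdet : (A v).det ≠ 0 := abs_pos.1 hpos
  set B := ((A v)ᵀ)⁻¹ with hB
  have hdetT : IsUnit ((A v)ᵀ).det := by rw [det_transpose]; exact hdet.isUnit
  have hcoord : ∀ y ∈ closure S, ∀ i, |(B *ᵥ fun j => y j - v₀ j) i| ≤ 1 := by
    intro y hy i
    have h1 : B *ᵥ (fun j => y j - v₀ j) = (A v).det⁻¹ • cramer (A v)ᵀ (fun j => y j - v₀ j) := by
      have h2 := mulVec_cramer (A v)ᵀ (fun j => y j - v₀ j)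
      have h3 := congrArg (B *ᵥ ·) h2
      simp only [mulVec_mulVec, hB, nonsing_inv_mul _ hdetT, one_mulVec, mulVec_smul] at h3
      rw [h3, det_transpose, smul_smul, inv_mul_cancel₀ hdet, one_smul]
    rw [h1, Pi.smul_apply, cramer_transpose_apply, smul_eq_mul, abs_mul, abs_inv,
      inv_mul_le_iff₀ hpos, mul_one]
    have h4 : (A v).updateRow i (fun j => y j - v₀ j) = A (Function.update v i y) := by
      ext k j
      by_cases hk : k = i
      · subst hk; simp [hA]
      · simp [hA, hk]
    rw [h4]
    refine hvmax fun k _ => ?_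
    by_cases hk : k = i
    · subst hk; simpa using hy
    · simpa [hk] using hvK k (mem_univ k)
  set a : ℝ := 1 / (n + 1) with ha
  have hn1 : (0 : ℝ) < n + 1 := by positivity
  set z : E n := v₀ + ∑ i, a • (v i - v₀) with hz
  have hsub : ∀ y : E n, (∀ i, 0 ≤ (B *ᵥ fun j => y j - v₀ j) i) →
      ∑ i, (B *ᵥ fun j => y j - v₀ j) i ≤ 1 → y ∈ closure S := by
    intro y h0 h1
    set c := B *ᵥ fun j => y j - v₀ j with hc
    have hy : y = (1 - ∑ i, c i) • v₀ + ∑ i, c i • v i := by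
      have h2 : (A v)ᵀ *ᵥ c = fun j => y j - v₀ j := by
        rw [hc, mulVec_mulVec, hB, mul_nonsing_inv _ hdetT, one_mulVec]
      ext j
      have h3 := congrFun h2 j
      simp only [mulVec, dotProduct, transpose_apply, hA, of_apply, sub_mul,
        Finset.sum_sub_distrib] at h3
      simp only [PiLp.add_apply, PiLp.smul_apply, smul_eq_mul, WithLp.ofLp_sum, Finset.sum_apply,
        ← Finset.mul_sum] at h3 ⊢
      simp only [mul_comm (v _ j)] at h3
      linarith
    rw [hy]
    have hconv : Convex ℝ (closure S) := hSc.closure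
    have := hconv.sum_mem (t := Finset.univ) (w := fun o : Option (Fin n) => o.elim (1 - ∑ i, c i) c)
      (z := fun o => o.elim v₀ v) ?_ ?_ ?_
    · simpa [Fintype.sum_option] using this
    · rintro (_ | i) _
      · simpa using h1
      · exact h0 i
    · simp [Fintype.sum_option]
    · rintro (_ | i) _
      · exact subset_closure hv₀
      · exact hvK i (mem_univ i)
  have hBz : (B *ᵥ fun j => z j - v₀ j) = fun _ => a := by
    have : (fun j => z j - v₀ j) = (A v)ᵀ *ᵥ fun _ => a := by
      ext j
      simp [hz, mulVec, dotProduct, hA, mul_comm]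
    rw [this, mulVec_mulVec, hB, nonsing_inv_mul _ hdetT, one_mulVec]
  have hdiff : ∀ y : E n, ∀ i, (B *ᵥ fun j => y j - v₀ j) i = (B *ᵥ (y - z).ofLp) i + a := by
    intro y i
    rw [← congrFun hBz i, ← Pi.add_apply, ← mulVec_add]
    congr 2
    ext j
    simp
  refine ⟨toEuclideanCLM (𝕜 := ℝ) (((n : ℝ) + 1) ^ 2 • B), z, ?_, fun y hy => ?_, fun y hy => ?_⟩
  · rw [det_toEuclideanCLM, det_smul, hB, det_nonsing_inv, Ring.inverse_eq_inv', det_transpose]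
    positivity
  · have hinteg : interior (closure S) = S := by
      rw [hSc.interior_closure_eq_interior_of_nonempty_interior
        (by rw [hSo.interior_eq]; exact ⟨v₀, hv₀⟩), hSo.interior_eq]
    have hopen : IsOpen {y : E n | ‖toEuclideanCLM (𝕜 := ℝ) (((n : ℝ) + 1) ^ 2 • B) (y - z)‖ < 1} :=
      isOpen_lt (by fun_prop) continuous_const
    rw [← hinteg]
    refine interior_maximal (fun y hy => ?_) hopen hy
    have hy' : ∀ i, |(B *ᵥ (y - z).ofLp) i| ≤ a ^ 2 := by
      intro i
      have h1 := (PiLp.norm_apply_le (toEuclideanCLM (𝕜 := ℝ) (((n : ℝ) + 1) ^ 2 • B) (y - z)) i).trans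
        (le_of_lt hy)
      rw [ofLp_toEuclideanCLM, smul_mulVec, Pi.smul_apply, smul_eq_mul, norm_mul, norm_pow,
        Real.norm_of_nonneg hn1.le] at h1
      rw [ha, div_pow, one_pow, le_div_iff₀ (by positivity), mul_comm]
      exact h1
    have ha1 : a ≤ 1 := by
      rw [ha, div_le_one hn1]
      linarith [(Nat.cast_nonneg n : (0 : ℝ) ≤ n)]
    have ha0 : 0 < a := by positivity
    have hna : (n : ℝ) * (a ^ 2 + a) ≤ 1 := by
      rw [ha]
      field_simp
      nlinarith [(Nat.cast_nonneg n : (0 : ℝ) ≤ n)]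
    refine hsub y (fun i => ?_) ?_
    · rw [hdiff]
      nlinarith [(abs_le.1 (hy' i)).1]
    · refine le_trans (Finset.sum_le_sum (g := fun _ => a ^ 2 + a) fun i _ => ?_) (by simpa [mul_add] using hna)
      rw [hdiff]
      linarith [(abs_le.1 (hy' i)).2]
  · have ha1 : a ≤ 1 := by
      rw [ha, div_le_one hn1]
      linarith [(Nat.cast_nonneg n : (0 : ℝ) ≤ n)]
    have ha0 : 0 < a := by positivity
    refine (norm_le_of_abs_le (a := 2 * (n + 1) ^ 2) (fun i => ?_) (by positivity)).trans
      (le_of_eq (by rw [johnRadius]; ring))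
    rw [ofLp_toEuclideanCLM, smul_mulVec, Pi.smul_apply, smul_eq_mul, abs_mul, abs_pow,
      abs_of_pos hn1, mul_comm]
    gcongr
    have h1 := hcoord y hy i
    rw [hdiff, abs_le] at h1
    rw [abs_le]
    constructor <;> linarith

end ConvexTools

section ContactSets

open Matrix Filter Topology Set

variable {n : ℕ}

lemma continuousOn_fderiv_fderiv {S : Set (E n)} {w : E n → ℝ}
    (hw : ∀ z ∈ S, ContDiffAt ℝ 2 w z) : ContinuousOn (fderiv ℝ (fderiv ℝ w)) S := by
  intro z hz
  have h1 := ((hw z hz).fderiv_right (m := 1) (by norm_num)).fderiv_right (m := 0) (by norm_num)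
  exact h1.continuousAt.continuousWithinAt

/-- Alexandrov's estimate: slopes of planes lying below `w` on the boundary are attained as
gradients on the contact set. -/
lemma volume_slopes_le {S : Set (E n)} (hSo : IsOpen S) (hSb : Bornology.IsBounded S)
    {w : E n → ℝ} (hw : ∀ z ∈ S, ContDiffAt ℝ 2 w z) (hwc : ContinuousOn w (closure S)) {x : E n}
    (hx : x ∈ S) {m : ℝ} (hm : w x ≤ -m) (hbd : ∀ y ∈ frontier S, 0 ≤ w y) {B : ℝ}
    (hdet : ∀ z ∈ S, w z < 0 → (Hess w z).PosSemidef → (Hess w z).det ≤ B) :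
    volume {q : E n | ∀ y ∈ closure S, inner ℝ q (y - x) < m} ≤
      ENNReal.ofReal B * volume {z ∈ S | w z < 0} := by
  set S' := {z ∈ S | w z < 0} with hS'
  have hS'o : IsOpen S' := (hwc.mono subset_closure).isOpen_inter_preimage hSo isOpen_Iio
  set Tc : Set (E n) := fderiv ℝ (fderiv ℝ w) ⁻¹' {H | ∀ v, 0 ≤ H v v} ∩ S' with hTc
  have hTm : MeasurableSet Tc := by
    have hcl : IsClosed {H : E n →L[ℝ] E n →L[ℝ] ℝ | ∀ v, 0 ≤ H v v} := by
      simp only [ofPred_forall]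
      exact isClosed_iInter fun v => isClosed_le continuous_const (by fun_prop)
    obtain ⟨C, hC, hCe⟩ := continuousOn_iff_isClosed.1
      ((continuousOn_fderiv_fderiv hw).mono (fun z hz => hz.1 : S' ⊆ S)) _ hcl
    rw [hTc, hCe]
    exact hC.measurableSet.inter hS'o.measurableSet
  have hsub : {q : E n | ∀ y ∈ closure S, inner ℝ q (y - x) < m} ⊆ gradMap w '' Tc := by
    intro q hq
    have hcont : ContinuousOn (fun y => w y - (innerSL ℝ q y + -inner ℝ q x)) (closure S) := by
      fun_prop
    obtain ⟨z, hzS, hzmin⟩ := hSb.isCompact_closure.exists_isMinOn ⟨x, subset_closure hx⟩ hcont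
    have hzx := hzmin (subset_closure hx)
    simp only [mem_ofPred_eq, innerSL_apply_apply] at hzx
    have hqz := hq z hzS
    rw [inner_sub_right] at hqz
    have hwz : w z < 0 := by linarith
    have hzS' : z ∈ S := by
      by_contra hcon
      have : z ∈ frontier S := ⟨hzS, by rwa [hSo.interior_eq]⟩
      linarith [hbd z this]
    have hloc : IsLocalMin (fun y => w y - (innerSL ℝ q y + -inner ℝ q x)) z :=
      hzmin.isLocalMin (mem_of_superset (hSo.mem_nhds hzS') subset_closure)
    have hd : fderiv ℝ w z = innerSL ℝ q := by
      have h1 := (hw z hzS').differentiableAt (by simp) |>.hasFDerivAt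
      have h2 := h1.sub ((innerSL ℝ q).hasFDerivAt.add_const (-inner ℝ q x))
      exact sub_eq_zero.1 (hloc.hasFDerivAt_eq_zero h2)
    have hH : (Hess w z).PosSemidef := by
      rw [← Hess_sub_affine (hw z hzS') (innerSL ℝ q) (-inner ℝ q x)]
      exact hloc.Hess_posSemidef ((hw z hzS').sub (contDiffAt_affine _ _))
    refine ⟨z, ⟨(Hess_posSemidef_iff (hw z hzS')).1 hH, hzS', hwz⟩, ?_⟩
    refine ext_inner_right ℝ fun v => ?_
    rw [inner_gradMap, hd, innerSL_apply_apply]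
  calc volume {q : E n | ∀ y ∈ closure S, inner ℝ q (y - x) < m}
      ≤ volume (gradMap w '' Tc) := measure_mono hsub
    _ ≤ ∫⁻ z in Tc, ENNReal.ofReal |(gradMapDeriv w z).det| :=
        addHaar_image_le_lintegral_abs_det_fderiv _ hTm fun z hz =>
          (hasFDerivAt_gradMap (hw z hz.2.1)).hasFDerivWithinAt
    _ ≤ ∫⁻ z in Tc, ENNReal.ofReal B := by
        refine setLIntegral_mono measurable_const fun z hz => ENNReal.ofReal_le_ofReal ?_
        have hH := (Hess_posSemidef_iff (hw z hz.2.1)).2 hz.1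
        rw [det_gradMapDeriv, abs_of_nonneg hH.det_nonneg]
        exact hdet z hz.2.1 hz.2.2 hH
    _ = ENNReal.ofReal B * volume Tc := by simp
    _ ≤ ENNReal.ofReal B * volume S' := by
        gcongr
        exact inter_subset_right

/-- A convex function below zero on an ellipsoid is quantitatively negative at its center. -/
lemma det_lower_bound_ellipsoid {T : E n →L[ℝ] E n} {z : E n} {v : E n → ℝ} {lam M : ℝ}
    (hK : IsCompact {y | ‖T (y - z)‖ ≤ 1}) (hvc : ContinuousOn v {y | ‖T (y - z)‖ ≤ 1})
    (hv2 : ∀ y, ‖T (y - z)‖ < 1 → ContDiffAt ℝ 2 v y)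
    (hpd : ∀ y, ‖T (y - z)‖ < 1 → (Hess v y).PosDef)
    (hdet : ∀ y, ‖T (y - z)‖ < 1 → lam ≤ (Hess v y).det)
    (hle : ∀ y, ‖T (y - z)‖ ≤ 1 → v y ≤ 0) (hM : 0 < M) (hvz : -M ≤ v z) :
    lam ≤ (4 * M) ^ n * T.det ^ 2 := by
  set q : E n → ℝ := fun y => 2 * M * (‖T (y - z)‖ ^ 2 - 1) with hq
  have hq2 : ContDiff ℝ 2 q := by
    have : ContDiff ℝ 2 fun y => T (y - z) := by fun_prop
    exact contDiff_const.mul (this.norm_sq ℝ |>.sub contDiff_const)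
  obtain ⟨y, hy, hymin⟩ := hK.exists_isMinOn ⟨z, by simp⟩ (hq2.continuous.continuousOn.sub hvc)
  have hyz : q y - v y ≤ q z - v z := hymin (by simp : z ∈ {y | ‖T (y - z)‖ ≤ 1})
  have hqz : q z = -(2 * M) := by simp [hq]
  have hvy := hle y hy
  have hlt : ‖T (y - z)‖ < 1 := by
    refine lt_of_le_of_ne hy fun h => ?_
    have : q y = 0 := by simp only [hq, h]; norm_num
    linarith
  have hopen : IsOpen {y : E n | ‖T (y - z)‖ < 1} := isOpen_lt (by fun_prop) continuous_const
  have hloc : IsLocalMin (fun y => q y - v y) y :=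
    hymin.isLocalMin (mem_of_superset (hopen.mem_nhds hlt) fun w hw => by
      rw [mem_ofPred_eq] at hw ⊢
      exact hw.le)
  have hH := hloc.Hess_posSemidef (hq2.contDiffAt.sub (hv2 y hlt))
  rw [Hess_sub hq2.contDiffAt (hv2 y hlt)] at hH
  have h1 := det_le_det_of_sub_posSemidef (hpd y hlt) hH
  rw [hq, det_Hess_quadratic] at h1
  refine (hdet y hlt).trans (h1.trans (le_of_eq ?_))
  ring

lemma volume_le_of_normalization {S : Set (E n)} {T : E n →L[ℝ] E n} {z : E n} {R : ℝ}
    (hT : T.det ≠ 0) (h : ∀ y ∈ S, ‖T (y - z)‖ ≤ R) :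
    volume S ≤ ENNReal.ofReal |T.det|⁻¹ * volume (Metric.closedBall (0 : E n) R) := by
  rw [← abs_inv, ContinuousLinearMap.det, ← Measure.addHaar_preimage_continuousLinearMap _ hT]
  calc volume S ≤ volume ((fun y => y - z) ⁻¹' (T ⁻¹' Metric.closedBall 0 R)) :=
        measure_mono fun y hy => by simpa [-map_sub] using h y hy
    _ = _ := by
        simp only [sub_eq_add_neg]
        exact measure_preimage_add_right volume (-z) _

lemma isCompact_ellipsoid {S : Set (E n)} (hSb : Bornology.IsBounded S) {T : E n →L[ℝ] E n}
    {z : E n} (h : ∀ y, ‖T (y - z)‖ < 1 → y ∈ S) :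
    IsCompact {y | ‖T (y - z)‖ ≤ 1} ∧ {y | ‖T (y - z)‖ ≤ 1} ⊆ closure S := by
  have hcl : IsClosed {y : E n | ‖T (y - z)‖ ≤ 1} := isClosed_le (by fun_prop) continuous_const
  have hsub : {y | ‖T (y - z)‖ ≤ 1} ⊆ closure S := by
    intro y hy
    have h1 : Tendsto (fun s : ℝ => z + s • (y - z)) (𝓝[<] 1) (𝓝 y) := by
      have : Continuous fun s : ℝ => z + s • (y - z) := by fun_prop
      have h2 := this.tendsto 1
      simp only [one_smul, add_sub_cancel] at h2
      exact h2.mono_left nhdsWithin_le_nhds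
    refine mem_closure_of_tendsto h1 ?_
    filter_upwards [Ioo_mem_nhdsLT (show (0 : ℝ) < 1 by norm_num)] with s hs
    refine h _ ?_
    rw [add_sub_cancel_left, map_smul, norm_smul, Real.norm_of_nonneg hs.1.le]
    have : ‖T (y - z)‖ ≤ 1 := hy
    nlinarith [hs.1, hs.2, norm_nonneg (T (y - z))]
  exact ⟨hSb.isCompact_closure.of_isClosed_subset hcl hsub, hsub⟩

end ContactSets

section Solutions

open Matrix Filter Topology Set

variable {n : ℕ}

lemma det_mul_volume_le {S : Set (E n)} (hSo : IsOpen S) (hSb : Bornology.IsBounded S)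
    {w : E n → ℝ} (hw : ∀ z ∈ S, ContDiffAt ℝ 2 w z) (hwc : ContinuousOn w (closure S)) {x : E n}
    (hx : x ∈ S) {m : ℝ} (hm : w x ≤ -m) (hbd : ∀ y ∈ frontier S, 0 ≤ w y) {B : ℝ} (hB : 0 ≤ B)
    (hdet : ∀ z ∈ S, w z < 0 → (Hess w z).PosSemidef → (Hess w z).det ≤ B)
    (T : E n →L[ℝ] E n) (Q : Set (E n))
    (hQ : ∀ e ∈ Q, ∀ y ∈ closure S, inner ℝ e (T (y - x)) < m) :
    |T.det| * volume.real Q ≤ B * volume.real {z ∈ S | w z < 0} := by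
  have h1 := volume_slopes_le hSo hSb hw hwc hx hm hbd hdet
  have h2 : volume (ContinuousLinearMap.adjoint T '' Q) ≤
      volume {q : E n | ∀ y ∈ closure S, inner ℝ q (y - x) < m} := by
    refine measure_mono ?_
    rintro _ ⟨e, he, rfl⟩ y hy
    rw [ContinuousLinearMap.adjoint_inner_left]
    exact hQ e he y hy
  rw [Measure.addHaar_image_continuousLinearMap] at h2
  have h3 := h2.trans h1
  have hfin : volume {z ∈ S | w z < 0} ≠ ⊤ :=
    (hSb.subset (fun z hz => hz.1)).measure_lt_top.ne
  have h4 := ENNReal.toReal_mono (ENNReal.mul_ne_top ENNReal.ofReal_ne_top hfin) h3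
  rw [ENNReal.toReal_mul, ENNReal.toReal_mul, ENNReal.toReal_ofReal (abs_nonneg _),
    ENNReal.toReal_ofReal hB] at h4
  have h5 := det_adjoint T
  rw [ContinuousLinearMap.det] at h5
  rwa [h5] at h4

lemma volume_real_ball (x : E n) {r : ℝ} (hr : 0 < r) :
    volume.real (Metric.ball x r) = r ^ n * volume.real (Metric.ball (0 : E n) 1) := by
  rw [Measure.real, Measure.addHaar_ball_of_pos _ x hr, ENNReal.toReal_mul,
    ENNReal.toReal_ofReal (by positivity), finrank_euclideanSpace_fin, Measure.real]

lemma volume_real_unit_ball_pos : 0 < volume.real (Metric.ball (0 : E n) 1) :=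
  ENNReal.toReal_pos (Metric.measure_ball_pos _ _ one_pos).ne' measure_ball_lt_top.ne

lemma volume_real_le_of_normalization {S : Set (E n)} {T : E n →L[ℝ] E n} {z : E n} {R : ℝ}
    (hR : 0 ≤ R) (hT : T.det ≠ 0) (h : ∀ y ∈ S, ‖T (y - z)‖ ≤ R) :
    |T.det| * volume.real S ≤ R ^ n * volume.real (Metric.ball (0 : E n) 1) := by
  have h1 := volume_le_of_normalization hT h
  have hfin : volume (Metric.closedBall (0 : E n) R) ≠ ⊤ := measure_closedBall_lt_top.ne
  have h2 := ENNReal.toReal_mono (ENNReal.mul_ne_top ENNReal.ofReal_ne_top hfin) h1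
  rw [Measure.addHaar_closedBall _ _ hR, ENNReal.toReal_mul, ENNReal.toReal_mul,
    ENNReal.toReal_ofReal (by positivity), ENNReal.toReal_ofReal (by positivity),
    finrank_euclideanSpace_fin] at h2
  rw [mul_comm, ← le_div_iff₀ (abs_pos.2 hT)]
  refine h2.trans (le_of_eq ?_)
  rw [Measure.real]
  ring

/-- A convex solution of `lam ≤ det D²u ≤ Lam`, smooth in `Ω`, continuous up to the boundary,
with zero boundary values. -/
structure IsMASolution (Ω : Set (E n)) (u : E n → ℝ) (lam Lam : ℝ) : Prop where
  isOpen : IsOpen Ω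
  isBounded : Bornology.IsBounded Ω
  nonempty : Ω.Nonempty
  contDiffAt : ∀ x ∈ Ω, ContDiffAt ℝ (⊤ : ℕ∞) u x
  continuousOn : ContinuousOn u (closure Ω)
  convexOn : ConvexOn ℝ (closure Ω) u
  eq_zero : ∀ x ∈ frontier Ω, u x = 0
  le_det : ∀ x ∈ Ω, lam ≤ (Hess u x).det
  det_le : ∀ x ∈ Ω, (Hess u x).det ≤ Lam

lemma MASetup.isMASolution {Ω : Set (E n)} {u : E n → ℝ} {lam Lam : ℝ} (h : MASetup Ω u)
    (hd : DetBounds Ω u lam Lam) : IsMASolution Ω u lam Lam where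
  isOpen := h.1
  isBounded := h.2.1
  nonempty := h.2.2.1
  contDiffAt _ hx := h.2.2.2.2.1.contDiffAt (mem_of_superset (h.1.mem_nhds hx) subset_closure)
  continuousOn := h.2.2.2.2.1.continuousOn
  convexOn := h.2.2.2.2.2.1
  eq_zero := h.2.2.2.2.2.2
  le_det x hx := (hd x hx).1
  det_le x hx := (hd x hx).2

namespace IsMASolution

variable {Ω : Set (E n)} {u : E n → ℝ} {lam Lam : ℝ} {x y : E n}

lemma contDiffAt_two (h : IsMASolution Ω u lam Lam) (hx : x ∈ Ω) : ContDiffAt ℝ 2 u x :=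
  (h.contDiffAt x hx).of_le (WithTop.coe_le_coe.2 (le_top : (2 : ℕ∞) ≤ ⊤))

lemma tangent_le (h : IsMASolution Ω u lam Lam) (hx : x ∈ Ω) (hy : y ∈ closure Ω) :
    u x + fderiv ℝ u x (y - x) ≤ u y := by
  have h1 := ((h.contDiffAt_two hx).differentiableAt (by simp)).hasFDerivAt.hasLineDerivAt (y - x)
  have h2 := h1.tendsto_slope_zero_right
  suffices fderiv ℝ u x (y - x) ≤ u y - u x by linarith
  refine le_of_tendsto h2 ?_
  filter_upwards [Ioo_mem_nhdsGT (show (0 : ℝ) < 1 by norm_num)] with t ht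
  have h3 := h.convexOn.2 (subset_closure hx) hy (show 0 ≤ 1 - t by linarith [ht.2]) ht.1.le
    (by ring)
  have h4 : (1 - t) • x + t • y = x + t • (y - x) := by module
  rw [h4] at h3
  simp only [smul_eq_mul] at h3 ⊢
  rw [inv_mul_le_iff₀ ht.1]
  linarith

lemma posDef (h : IsMASolution Ω u lam Lam) (hlam : 0 < lam) (hx : x ∈ Ω) :
    (Hess u x).PosDef := by
  have hu := h.contDiffAt_two hx
  have hloc : IsLocalMin (fun y => u y - (fderiv ℝ u x y + 0)) x := by
    filter_upwards [h.isOpen.mem_nhds hx] with y hy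
    have := h.tangent_le hx (subset_closure hy)
    rw [map_sub] at this
    linarith
  have h1 := hloc.Hess_posSemidef (hu.sub (contDiffAt_affine _ _))
  rw [Hess_sub_affine hu] at h1
  exact h1.posDef_iff_det_ne_zero.2 (hlam.trans_le (h.le_det x hx)).ne'

lemma frontier_nonempty (h : IsMASolution Ω u lam Lam) (hn : n ≠ 0) : (frontier Ω).Nonempty := by
  have : Nonempty (Fin n) := ⟨⟨0, Nat.pos_of_ne_zero hn⟩⟩
  refine nonempty_frontier_iff.2 ⟨h.nonempty, ?_⟩
  rintro rfl
  exact NormedSpace.unbounded_univ ℝ (E n) h.isBounded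

lemma nonpos (h : IsMASolution Ω u lam Lam) (hn : n ≠ 0) (hx : x ∈ closure Ω) : u x ≤ 0 := by
  obtain ⟨y, hy, hmax⟩ := h.isBounded.isCompact_closure.exists_isMaxOn ⟨x, hx⟩ h.continuousOn
  refine (hmax hx).trans ?_
  by_cases hyΩ : y ∈ Ω
  · have hloc : IsLocalMax u y :=
      hmax.isLocalMax (mem_of_superset (h.isOpen.mem_nhds hyΩ) subset_closure)
    obtain ⟨b, hb⟩ := h.frontier_nonempty hn
    have h1 := h.tangent_le hyΩ hb.1
    rw [hloc.fderiv_eq_zero, h.eq_zero b hb] at h1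
    simpa using h1
  · exact (h.eq_zero y ⟨hy, by rwa [h.isOpen.interior_eq]⟩).le

/-- Sections cut by an affine function which is nonpositive on the boundary. -/
lemma sublevel (h : IsMASolution Ω u lam Lam) {p : E n →L[ℝ] ℝ} {a : ℝ}
    (hb : ∀ y ∈ frontier Ω, p y + a ≤ 0) {S : Set (E n)}
    (hS : S = {y ∈ closure Ω | u y < p y + a}) :
    S ⊆ Ω ∧ IsOpen S ∧ Convex ℝ S ∧ Bornology.IsBounded S ∧ (∀ y ∈ frontier S, u y = p y + a) ∧
      ∀ y ∈ closure S, u y ≤ p y + a := by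
  have hsub : S ⊆ Ω := by
    rw [hS]
    rintro y ⟨hy, hlt⟩
    by_contra hcon
    have hyf : y ∈ frontier Ω := ⟨hy, by rwa [h.isOpen.interior_eq]⟩
    have := hb y hyf
    rw [h.eq_zero y hyf] at hlt
    linarith
  have hcont : ContinuousOn (fun y => u y - (p y + a)) (closure Ω) :=
    h.continuousOn.sub (by fun_prop)
  have hopen : IsOpen S := by
    have : S = Ω ∩ (fun y => u y - (p y + a)) ⁻¹' Iio 0 := by
      ext y
      constructor
      · intro hy
        refine ⟨hsub hy, ?_⟩
        rw [hS] at hy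
        exact sub_neg.2 hy.2
      · rintro ⟨hy, hy'⟩
        rw [hS]
        exact ⟨subset_closure hy, sub_neg.1 hy'⟩
    rw [this]
    exact (hcont.mono subset_closure).isOpen_inter_preimage h.isOpen isOpen_Iio
  have hclos : ∀ y ∈ closure S, u y ≤ p y + a := by
    intro y hy
    have hyΩ : closure S ⊆ closure Ω := closure_mono hsub
    have := ContinuousWithinAt.closure_le (s := S) hy
      ((h.continuousOn y (hyΩ hy)).mono (hsub.trans subset_closure))
      ((p.continuous.add continuous_const).continuousWithinAt (x := y))
      (fun w hw => by rw [hS] at hw; exact hw.2.le)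
    exact this
  refine ⟨hsub, hopen, ?_, h.isBounded.subset hsub, fun y hy => ?_, hclos⟩
  · rw [hS]
    have : ConvexOn ℝ (closure Ω) (fun y => u y + -(p y + a)) := by
      refine h.convexOn.add ⟨h.convexOn.1, fun x _ y _ s t _ _ hst => le_of_eq ?_⟩
      simp only [map_add, map_smul, smul_eq_mul]
      linear_combination a * hst
    have h1 := this.convex_lt 0
    have h2 : {y ∈ closure Ω | u y < p y + a} = {y ∈ closure Ω | u y + -(p y + a) < 0} := by
      ext y
      simp only [mem_ofPred_eq]
      refine and_congr_right fun _ => ?_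
      constructor <;> intro <;> linarith
    rw [h2]
    exact h1
  · refine le_antisymm (hclos y hy.1) ?_
    by_contra! hcon
    have : y ∈ S := by
      rw [hS]
      exact ⟨closure_mono hsub hy.1, hcon⟩
    exact hy.2 (by rwa [hopen.interior_eq])

end IsMASolution

end Solutions

section Balance

open Matrix Filter Topology Set

variable {n : ℕ} {Ω : Set (E n)} {lam Lam : ℝ}

lemma real_inner_lt_of_norm_lt {e v : E n} {a b c : ℝ} (he : ‖e‖ < a) (hv : ‖v‖ ≤ b) (hb : 0 < b)
    (hab : a * b ≤ c) : inner ℝ e v < c :=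
  calc inner ℝ e v ≤ ‖e‖ * ‖v‖ := real_inner_le_norm e v
    _ ≤ ‖e‖ * b := by gcongr
    _ < a * b := by gcongr
    _ ≤ c := hab

lemma exists_lower_bound (hn : n ≠ 0) (hΩ : Bornology.IsBounded Ω) (hLam : 0 ≤ Lam) {D : ℝ}
    (hD0 : 0 < D) (hD : ∀ x ∈ closure Ω, ∀ y ∈ closure Ω, ‖y - x‖ ≤ D) :
    ∃ M : ℝ, 0 < M ∧ ∀ u, IsMASolution Ω u lam Lam → ∀ x ∈ closure Ω, -M ≤ u x := by
  set ω := volume.real (Metric.ball (0 : E n) 1)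
  have hω : 0 < ω := volume_real_unit_ball_pos
  set K := Lam * volume.real Ω / ω
  have hK : 0 ≤ K := by positivity
  refine ⟨D * (1 + K), by positivity, fun u h x hx => ?_⟩
  by_cases hxΩ : x ∈ Ω
  · by_contra! hcon
    set m := -u x with hm
    have hm1 : 1 + K < m / D := by
      rw [lt_div_iff₀ hD0]
      linarith
    have h1 := det_mul_volume_le h.isOpen hΩ (fun z hz => h.contDiffAt_two hz) h.continuousOn hxΩ
      (m := m) (by rw [hm]; linarith) (fun y hy => (h.eq_zero y hy).ge) hLam
      (fun z hz _ _ => h.det_le z hz) (ContinuousLinearMap.id ℝ (E n)) (Metric.ball 0 (m / D))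
      (fun e he y hy => real_inner_lt_of_norm_lt (by simpa using he) (hD x hx y hy) hD0
        (by rw [div_mul_cancel₀ _ hD0.ne']))
    rw [volume_real_ball _ (by linarith)] at h1
    have h2 : |(ContinuousLinearMap.id ℝ (E n)).det| = 1 := by simp [ContinuousLinearMap.det]
    have h3 : volume.real {z ∈ Ω | u z < 0} ≤ volume.real Ω :=
      measureReal_mono (fun z hz => hz.1) hΩ.measure_lt_top.ne
    rw [h2, one_mul] at h1
    have h4 : (m / D) ^ n ≤ K := by
      rw [le_div_iff₀ hω]
      exact h1.trans (by gcongr)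
    have h5 : m / D ≤ (m / D) ^ n := le_self_pow₀ (by linarith) hn
    linarith
  · have : u x = 0 := h.eq_zero x ⟨hx, by rwa [h.isOpen.interior_eq]⟩
    rw [this]
    have : 0 < D * (1 + K) := by positivity
    linarith

lemma IsMASolution.exists_normalization {u : E n → ℝ} (h : IsMASolution Ω u lam Lam)
    (hlam : 0 < lam) {p : E n →L[ℝ] ℝ} {a : ℝ} (hb : ∀ y ∈ frontier Ω, p y + a ≤ 0)
    {S : Set (E n)} (hS : S = {y ∈ closure Ω | u y < p y + a}) (hne : S.Nonempty) {M : ℝ}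
    (hM : 0 < M) (hlow : ∀ y ∈ S, -M ≤ u y - (p y + a)) :
    ∃ (T : E n →L[ℝ] E n) (z : E n), T.det ≠ 0 ∧ (∀ y ∈ closure S, ‖T (y - z)‖ ≤ johnRadius n) ∧
      lam ≤ (4 * M) ^ n * T.det ^ 2 := by
  obtain ⟨hsub, hopen, hconv, hbdd, -, hcl⟩ := h.sublevel hb hS
  obtain ⟨T, z, hT, hin, hout⟩ := _root_.exists_normalization hopen hconv hbdd hne
  refine ⟨T, z, hT, hout, ?_⟩
  obtain ⟨hK, hKS⟩ := isCompact_ellipsoid hbdd hin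
  have hHess : ∀ y, ‖T (y - z)‖ < 1 → Hess (fun y => u y - (p y + a)) y = Hess u y :=
    fun y hy => Hess_sub_affine (h.contDiffAt_two (hsub (hin y hy))) p a
  refine det_lower_bound_ellipsoid (v := fun y => u y - (p y + a)) hK ?_ ?_ ?_ ?_ ?_ hM
    (hlow z (hin z (by simp)))
  · exact (h.continuousOn.mono (hKS.trans (closure_mono hsub))).sub (by fun_prop)
  · exact fun y hy => (h.contDiffAt_two (hsub (hin y hy))).sub (contDiffAt_affine p a)
  · intro y hy
    rw [hHess y hy]
    exact h.posDef hlam (hsub (hin y hy))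
  · intro y hy
    rw [hHess y hy]
    exact h.le_det _ (hsub (hin y hy))
  · exact fun y hy => sub_nonpos.2 (hcl y (hKS hy))

lemma norm_sub_le_two_mul {T : E n →L[ℝ] E n} {z x y : E n} {R : ℝ} (hx : ‖T (x - z)‖ ≤ R)
    (hy : ‖T (y - z)‖ ≤ R) : ‖T (y - x)‖ ≤ 2 * R := by
  have : T (y - x) = T (y - z) - T (x - z) := by rw [← map_sub]; congr 1; abel
  rw [this]
  linarith [norm_sub_le (T (y - z)) (T (x - z))]

/-- Chords of a section through a point of comparable depth are balanced. -/
lemma exists_balance (n : ℕ) (hlam : 0 < lam) (hLam : 0 ≤ Lam) {κ : ℝ} (hκ : 0 < κ) :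
    ∃ c : ℝ, 0 < c ∧ ∀ (Ω : Set (E n)) (u : E n → ℝ), IsMASolution Ω u lam Lam →
      ∀ (p : E n →L[ℝ] ℝ) (a M : ℝ), (∀ y ∈ frontier Ω, p y + a ≤ 0) → 0 < M →
      (∀ y ∈ closure Ω, u y < p y + a → -M ≤ u y - (p y + a)) →
      ∀ x ∈ closure Ω, ∀ w ∈ closure Ω, u w < p w + a → u x - (p x + a) ≤ -(κ * M) →
      x + c • (x - w) ∈ closure Ω ∧ u (x + c • (x - w)) < p (x + c • (x - w)) + a := by
  set R := johnRadius n with hRdef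
  have hR : 0 < R := johnRadius_pos n
  obtain ⟨N, hN⟩ := exists_nat_gt (Lam * (4 * R) ^ n / (lam * (κ / (4 * R)) ^ n))
  have hN0 : 0 < (N : ℝ) := lt_of_le_of_lt (by positivity) hN
  set c : ℝ := 1 / (2 * N) with hc
  have hc0 : 0 < c := by positivity
  refine ⟨c, hc0, fun Ω u h p a M hb hM hlow x hx w hw hwS hxκ => ?_⟩
  set S := {y ∈ closure Ω | u y < p y + a} with hS
  obtain ⟨hsub, hopen, hconv, hbdd, hfr, hcl⟩ := h.sublevel hb hS
  set m := κ * M with hm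
  have hm0 : 0 < m := by positivity
  have hxS : x ∈ S := ⟨hx, by linarith⟩
  have hwS' : w ∈ S := ⟨hw, hwS⟩
  change x + c • (x - w) ∈ S
  by_contra hcon
  obtain ⟨T, z, hT, hout, hdet⟩ := h.exists_normalization hlam hb hS ⟨x, hxS⟩ hM
    (fun y hy => hlow y hy.1 hy.2)
  obtain ⟨f, hf⟩ := geometric_hahn_banach_open_point hconv hopen hcon
  set W := f (x - w) with hW
  have hW0 : 0 < W := by
    have := hf x hxS
    rw [map_add, map_smul, smul_eq_mul] at this
    exact pos_of_mul_pos_right (by linarith : 0 < c * W) hc0.le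
  have hfcl : ∀ y ∈ closure S, f (y - x) ≤ c * W := by
    intro y hy
    have h1 : f y ≤ f (x + c • (x - w)) :=
      ContinuousWithinAt.closure_le hy f.continuous.continuousWithinAt continuousWithinAt_const
        (fun v hv => (hf v hv).le)
    rw [map_add, map_smul, smul_eq_mul] at h1
    rw [map_sub]
    linarith
  -- the functional `f`, rescaled, is the pullback of a vector `e` under `T`
  obtain ⟨e, he⟩ : ∃ e : E n, ∀ v, inner ℝ e (T v) = m / (2 * c * W) * f v := by
    have hadj : Function.Surjective (ContinuousLinearMap.adjoint T) := by
      have h1 : (ContinuousLinearMap.adjoint T).det ≠ 0 := by rwa [det_adjoint]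
      have h2 := (LinearMap.isUnit_iff_isUnit_det
        (ContinuousLinearMap.adjoint T : E n →ₗ[ℝ] E n)).2 (isUnit_iff_ne_zero.2 h1)
      exact ((Module.End.isUnit_iff _).1 h2).2
    obtain ⟨e, he⟩ := hadj ((InnerProductSpace.toDual ℝ (E n)).symm ((m / (2 * c * W)) • f))
    refine ⟨e, fun v => ?_⟩
    rw [← ContinuousLinearMap.adjoint_inner_left, he, InnerProductSpace.toDual_symm_apply]
    rfl
  have hTx : ∀ y ∈ closure S, ‖T (y - x)‖ ≤ 2 * R := fun y hy =>
    norm_sub_le_two_mul (hout x (subset_closure hxS)) (hout y hy)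
  have henorm : N * m / (2 * R) ≤ ‖e‖ := by
    have h1 := he (x - w)
    have h2 := real_inner_le_norm e (T (x - w))
    have h3 : ‖T (x - w)‖ ≤ 2 * R :=
      norm_sub_le_two_mul (hout w (subset_closure hwS')) (hout x (subset_closure hxS))
    have h4 : m / (2 * c * W) * W = N * m := by
      rw [hc]
      field_simp
    rw [h1, ← hW, h4] at h2
    rw [div_le_iff₀ (by positivity)]
    exact h2.trans (by gcongr)
  set ρ := m / (4 * R) with hρ
  have hρ0 : 0 < ρ := by positivity
  set Q : Set (E n) := ⋃ k ∈ Finset.range N, Metric.ball ((k / N : ℝ) • e) ρ with hQ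
  have hQvol : volume.real Q = N * (ρ ^ n * volume.real (Metric.ball (0 : E n) 1)) := by
    rw [hQ, measureReal_biUnion_finset]
    · simp [volume_real_ball _ hρ0]
    · intro i _ j _ hij
      refine Metric.ball_disjoint_ball ?_
      rw [dist_eq_norm, ← sub_smul, norm_smul]
      have h1 : (1 : ℝ) / N ≤ ‖(i / N - j / N : ℝ)‖ := by
        rw [← sub_div, norm_div, Real.norm_of_nonneg hN0.le]
        gcongr
        have : (1 : ℤ) ≤ |(i : ℤ) - j| := Int.one_le_abs (sub_ne_zero.2 (by exact_mod_cast hij))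
        rw [Real.norm_eq_abs]
        exact_mod_cast this
      calc ρ + ρ = 1 / N * (N * m / (2 * R)) := by rw [hρ]; field_simp; norm_num
        _ ≤ _ := by gcongr
    · exact fun _ _ => Metric.isOpen_ball.measurableSet
  have hu2 : ∀ y ∈ S, ContDiffAt ℝ 2 u y := fun y hy => h.contDiffAt_two (hsub hy)
  have hABP := det_mul_volume_le hopen hbdd (w := fun y => u y - (p y + a))
    (fun y hy => (hu2 y hy).sub (contDiffAt_affine p a))
    ((h.continuousOn.mono (closure_mono hsub)).sub (by fun_prop)) hxS hxκ
    (fun y hy => (sub_eq_zero.2 (hfr y hy)).ge) hLam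
    (fun y hy _ _ => by
      rw [Hess_sub_affine (hu2 y hy)]
      exact h.det_le y (hsub hy)) T Q (by
    intro e' he' y hy
    simp only [hQ, mem_iUnion, Finset.mem_range] at he'
    obtain ⟨k, hk, hk'⟩ := he'
    have h1 : inner ℝ (e' - (k / N : ℝ) • e) (T (y - x)) < m / 2 := by
      refine real_inner_lt_of_norm_lt (by simpa [dist_eq_norm] using hk') (hTx y hy) (by positivity) ?_
      rw [hρ]
      field_simp
      norm_num
    have h2 : inner ℝ ((k / N : ℝ) • e) (T (y - x)) ≤ m / 2 := by
      rw [real_inner_smul_left, he]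
      have h3 : m / (2 * c * W) * f (y - x) ≤ m / 2 := by
        calc m / (2 * c * W) * f (y - x) ≤ m / (2 * c * W) * (c * W) := by
              gcongr
              exact hfcl y hy
          _ = m / 2 := by field_simp
      have h4 : (k / N : ℝ) ≤ 1 := by
        rw [div_le_one hN0]
        exact_mod_cast hk.le
      have h5 : (0 : ℝ) ≤ k / N := by positivity
      nlinarith
    rw [inner_sub_left] at h1
    linarith)
  set ω := volume.real (Metric.ball (0 : E n) 1) with hω
  have hω0 : 0 < ω := volume_real_unit_ball_pos
  have hvol := volume_real_le_of_normalization hR.le hT (fun y hy => hout y (subset_closure hy))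
  have hsubvol : volume.real {z ∈ S | u z - (p z + a) < 0} ≤ volume.real S :=
    measureReal_mono (fun z hz => hz.1) hbdd.measure_lt_top.ne
  rw [hQvol] at hABP
  have hT0 : 0 < |T.det| := abs_pos.2 hT
  have h1 : N * ρ ^ n * T.det ^ 2 ≤ Lam * R ^ n := by
    have h2 : |T.det| * (|T.det| * (N * (ρ ^ n * ω))) ≤ Lam * (R ^ n * ω) :=
      calc |T.det| * (|T.det| * (N * (ρ ^ n * ω))) ≤ |T.det| * (Lam * volume.real S) := by
            refine mul_le_mul_of_nonneg_left (hABP.trans ?_) hT0.le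
            gcongr
        _ = Lam * (|T.det| * volume.real S) := by ring
        _ ≤ _ := by gcongr
    have h3 : |T.det| * (|T.det| * (N * (ρ ^ n * ω))) = N * ρ ^ n * T.det ^ 2 * ω := by
      rw [← sq_abs T.det]; ring
    rw [h3, ← mul_assoc] at h2
    exact le_of_mul_le_mul_right h2 hω0
  have h2 : N * (κ / (4 * R)) ^ n * lam ≤ Lam * (4 * R) ^ n := by
    have h3 : ρ = κ / (4 * R) * M := by rw [hρ, hm]; ring
    have h4 : N * ρ ^ n * lam ≤ Lam * R ^ n * (4 * M) ^ n :=
      calc N * ρ ^ n * lam ≤ N * ρ ^ n * ((4 * M) ^ n * T.det ^ 2) := by gcongr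
        _ = N * ρ ^ n * T.det ^ 2 * (4 * M) ^ n := by ring
        _ ≤ _ := by gcongr
    rw [h3, mul_pow] at h4
    have h5 : 0 < M ^ n := by positivity
    refine le_of_mul_le_mul_right ?_ h5
    calc N * (κ / (4 * R)) ^ n * lam * M ^ n = N * ((κ / (4 * R)) ^ n * M ^ n) * lam := by ring
      _ ≤ _ := h4
      _ = _ := by rw [mul_pow, mul_pow]; ring
  rw [div_lt_iff₀ (by positivity)] at hN
  nlinarith

end Balance

section Localization

open Matrix Filter Topology Set

variable {n : ℕ} {Ω : Set (E n)} {lam Lam : ℝ}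

/-- The gap between a function and its tangent plane at `x`. -/
def excess (u : E n → ℝ) (x y : E n) : ℝ := u y - (u x + fderiv ℝ u x (y - x))

lemma excess_eq (u : E n → ℝ) (x y : E n) :
    excess u x y = u y - (fderiv ℝ u x y + (u x - fderiv ℝ u x x)) := by
  rw [excess, map_sub]
  ring

@[simp] lemma excess_self (u : E n → ℝ) (x : E n) : excess u x x = 0 := by simp [excess]

lemma IsMASolution.excess_nonneg {u : E n → ℝ} {x y : E n} (h : IsMASolution Ω u lam Lam)
    (hx : x ∈ Ω) (hy : y ∈ closure Ω) : 0 ≤ excess u x y :=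
  sub_nonneg.2 (h.tangent_le hx hy)

lemma exists_depth (hn : n ≠ 0) (hlam : 0 < lam) {d : ℝ} (hd : 0 < d) :
    ∃ c : ℝ, 0 < c ∧ ∀ (Ω : Set (E n)) (u : E n → ℝ), IsMASolution Ω u lam Lam →
      ∀ x, Metric.ball x d ⊆ Ω → u x ≤ -c := by
  set s := min 1 (lam / 2) with hs
  have hs0 : 0 < s := lt_min one_pos (by linarith)
  refine ⟨s * d ^ 2 / 16, by positivity, fun Ω u h x hx => ?_⟩
  by_contra! hcon
  set T : E n →L[ℝ] E n := (2 / d) • ContinuousLinearMap.id ℝ (E n) with hT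
  have hTapp : ∀ y, ‖T (y - x)‖ = 2 / d * ‖y - x‖ := by
    intro y
    rw [hT, _root_.smul_apply, norm_smul, Real.norm_of_nonneg (by positivity)]
    rfl
  have hmem : ∀ y, ‖T (y - x)‖ ≤ 1 → y ∈ Ω := by
    intro y hy
    refine hx ?_
    rw [hTapp, div_mul_eq_mul_div, div_le_one hd] at hy
    rw [mem_ball_iff_norm]
    linarith [norm_nonneg (y - x)]
  have hTdet : T.det = (2 / d) ^ n := by
    rw [hT, ContinuousLinearMap.det]
    simp
  have hcl : IsClosed {y : E n | ‖T (y - x)‖ ≤ 1} := isClosed_le (by fun_prop) continuous_const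
  have h1 := det_lower_bound_ellipsoid (T := T) (z := x) (v := u) (lam := lam)
    (M := s * d ^ 2 / 16)
    (h.isBounded.isCompact_closure.of_isClosed_subset hcl fun y hy => subset_closure (hmem y hy))
    (h.continuousOn.mono fun y hy => subset_closure (hmem y hy))
    (fun y hy => h.contDiffAt_two (hmem y hy.le)) (fun y hy => h.posDef hlam (hmem y hy.le))
    (fun y hy => h.le_det y (hmem y hy.le))
    (fun y hy => h.nonpos hn (subset_closure (hmem y hy))) (by positivity) hcon.le
  have h2 : (4 * (s * d ^ 2 / 16)) ^ n * T.det ^ 2 = s ^ n := by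
    rw [hTdet, ← pow_mul, mul_comm n 2, pow_mul, ← mul_pow]
    congr 1
    field_simp
    norm_num
  rw [h2] at h1
  have h3 : s ^ n ≤ s := pow_le_of_le_one hs0.le (min_le_left _ _) hn
  linarith [min_le_right 1 (lam / 2)]

lemma IsMASolution.norm_fderiv_le {u : E n → ℝ} (h : IsMASolution Ω u lam Lam) (hn : n ≠ 0)
    {M d : ℝ} (hM : ∀ x ∈ closure Ω, -M ≤ u x) (hM0 : 0 < M) (hd : 0 < d) {x : E n}
    (hx : Metric.ball x d ⊆ Ω) : ‖fderiv ℝ u x‖ ≤ 2 * M / d := by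
  have hxΩ : x ∈ Ω := hx (Metric.mem_ball_self hd)
  have key : ∀ v : E n, ‖v‖ = d / 2 → fderiv ℝ u x v ≤ M := by
    intro v hv
    have hy : x + v ∈ Ω := hx (by simp [hv, hd])
    have h1 := h.tangent_le hxΩ (subset_closure hy)
    rw [add_sub_cancel_left] at h1
    linarith [hM x (subset_closure hxΩ), h.nonpos hn (subset_closure hy)]
  refine ContinuousLinearMap.opNorm_le_bound _ (by positivity) fun v => ?_
  rcases eq_or_ne v 0 with rfl | hv
  · simp
  have hv0 : 0 < ‖v‖ := norm_pos_iff.2 hv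
  have hnorm : ‖(d / 2 / ‖v‖) • v‖ = d / 2 := by
    rw [norm_smul, Real.norm_of_nonneg (by positivity)]
    field_simp
  have h1 := key _ hnorm
  have h2 := key (-((d / 2 / ‖v‖) • v)) (by rw [norm_neg, hnorm])
  rw [map_neg, map_smul, smul_eq_mul] at h2
  rw [map_smul, smul_eq_mul] at h1
  have h3 : d / 2 / ‖v‖ * |fderiv ℝ u x v| ≤ M := by
    rcases abs_choice (fderiv ℝ u x v) with h | h <;> rw [h] <;> linarith
  rw [Real.norm_eq_abs]
  calc |fderiv ℝ u x v| = (d / 2 / ‖v‖ * |fderiv ℝ u x v|) * (2 * ‖v‖ / d) := by field_simp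
    _ ≤ M * (2 * ‖v‖ / d) := by gcongr
    _ = _ := by ring

/-- Tangent planes at interior points stay away from the boundary values. -/
lemma exists_boundary_excess (hn : n ≠ 0) (hΩ : Bornology.IsBounded Ω) (hlam : 0 < lam)
    (hLam : 0 ≤ Lam) {D : ℝ} (hD0 : 0 < D)
    (hD : ∀ x ∈ closure Ω, ∀ y ∈ closure Ω, ‖y - x‖ ≤ D) {d : ℝ} (hd : 0 < d) :
    ∃ t : ℝ, 0 < t ∧ ∀ u, IsMASolution Ω u lam Lam → ∀ x, Metric.ball x d ⊆ Ω →
      ∀ z ∈ frontier Ω, t ≤ excess u x z := by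
  obtain ⟨M, hM0, hM⟩ := exists_lower_bound (lam := lam) hn hΩ hLam hD0 hD
  obtain ⟨c₀, hc₀, hdepth⟩ := exists_depth (n := n) (Lam := Lam) hn hlam hd
  set C := M + 2 * M / d * D with hC
  have hC0 : 0 < C := by positivity
  obtain ⟨c, hc, hbal⟩ := exists_balance n hlam hLam (κ := c₀ / (2 * C)) (by positivity)
  set A := 4 * C / c₀ + 1 with hA
  have hA1 : 1 ≤ A := by
    have : 0 < 4 * C / c₀ := by positivity
    linarith
  obtain ⟨N, hN⟩ := exists_nat_gt (C / (c * c₀ / 4))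
  rw [div_lt_iff₀ (by positivity)] at hN
  set t₀ := c₀ / (4 * A ^ N) with ht₀
  have hA0 : 0 < A := by linarith
  have ht₀0 : 0 < t₀ := by positivity
  refine ⟨t₀, ht₀0, fun u h x hx z hz => ?_⟩
  by_contra! hcon
  have hxΩ : x ∈ Ω := hx (Metric.mem_ball_self hd)
  set p := fderiv ℝ u x with hp
  set a := u x - p x with ha
  have hex : ∀ y, excess u x y = u y - (p y + a) := excess_eq u x
  have hgrad := h.norm_fderiv_le hn (hM u h) hM0 hd hx
  have hlb : ∀ y ∈ closure Ω, -C ≤ p y + a := by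
    intro y hy
    have h1 : ‖p (y - x)‖ ≤ 2 * M / d * D :=
      (p.le_opNorm _).trans (by gcongr; exact hD x (subset_closure hxΩ) y hy)
    rw [map_sub, Real.norm_eq_abs] at h1
    linarith [(abs_le.1 h1).1, hM u h x (subset_closure hxΩ)]
  have hub : ∀ y ∈ frontier Ω, p y + a ≤ 0 := by
    intro y hy
    have h1 := h.excess_nonneg hxΩ hy.1
    rw [hex, h.eq_zero y hy] at h1
    linarith
  have hzl : -t₀ < p z + a := by
    rw [hex, h.eq_zero z hz] at hcon
    linarith
  have ht₀c : A ^ N * t₀ = c₀ / 4 := by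
    rw [ht₀]
    field_simp
  have ht₀le : ∀ k ≤ N, A ^ k * t₀ ≤ c₀ / 4 := by
    intro k hk
    rw [← ht₀c]
    gcongr
  have key : ∀ k ≤ N, ∃ y ∈ closure Ω, excess u x y ≤ A ^ k * t₀ ∧
      p y + a ≤ -c₀ - k * (c * c₀ / 4) := by
    intro k
    induction k with
    | zero =>
      intro _
      refine ⟨x, subset_closure hxΩ, by simpa using ht₀0.le, ?_⟩
      have := hdepth Ω u h x hx
      simp only [ha, Nat.cast_zero]
      linarith
    | succ k ih =>
      intro hk
      obtain ⟨y, hy, hyex, hyl⟩ := ih (by omega)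
      set η := A ^ k * t₀ with hη
      have hη0 : 0 < η := by positivity
      have hηc : η ≤ c₀ / 4 := ht₀le k (by omega)
      have htη : t₀ ≤ η := le_mul_of_one_le_left ht₀0.le (one_le_pow₀ hA1)
      set s := 4 * η / c₀ with hs
      have hs0 : 0 < s := by positivity
      have hs1 : s ≤ 1 := by rw [hs, div_le_one hc₀]; linarith
      have hsc : s * c₀ = 4 * η := by rw [hs]; field_simp
      have hkk : (0 : ℝ) ≤ k * (c * c₀ / 4) := by positivity
      set w : E n := (1 / 2 : ℝ) • y + (1 / 2 : ℝ) • z with hw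
      have hwcl : w ∈ closure Ω :=
        h.convexOn.1 hy hz.1 (by norm_num) (by norm_num) (by norm_num)
      have huw : u w ≤ (u y + u z) / 2 := by
        have := h.convexOn.2 hy hz.1 (show (0 : ℝ) ≤ 1 / 2 by norm_num)
          (show (0 : ℝ) ≤ 1 / 2 by norm_num) (by norm_num)
        simp only [smul_eq_mul] at this
        linarith
      have hpw : p w = (p y + p z) / 2 := by
        rw [hw, map_add, map_smul, map_smul]
        simp only [smul_eq_mul]
        ring
      have hzub := hub z hz
      have hval : ∀ v, u v - (((1 - s) • p) v + (1 - s) * a) = excess u x v + s * (p v + a) := by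
        intro v
        rw [hex, _root_.smul_apply, smul_eq_mul]
        ring
      have hexz : excess u x z < t₀ := hcon
      have hexw : excess u x w ≤ η := by
        rw [hex] at hyex hexz ⊢
        rw [hpw]
        linarith
      have hb := hbal Ω u h ((1 - s) • p) ((1 - s) * a) (s * C) (fun v hv => by
          have h1 := hub v hv
          rw [_root_.smul_apply, smul_eq_mul]
          linarith [mul_nonneg (sub_nonneg.2 hs1) (neg_nonneg.2 h1)]) (by positivity)
          (fun v hv _ => by
          rw [hval]
          linarith [h.excess_nonneg hxΩ hv, mul_le_mul_of_nonneg_left (hlb v hv) hs0.le]) y hy w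
          hwcl (by
          rw [← sub_neg, hval, hpw]
          linarith [mul_le_mul_of_nonneg_left hyl hs0.le, mul_nonneg hs0.le (neg_nonneg.2 hzub),
            mul_nonneg hs0.le hkk]) (by
          have : c₀ / (2 * C) * (s * C) = 2 * η := by
            rw [hs]; field_simp; norm_num
          rw [hval, this]
          linarith [mul_le_mul_of_nonneg_left hyl hs0.le, mul_nonneg hs0.le hkk])
      obtain ⟨hy', hy'lt⟩ := hb
      rw [← sub_neg, hval] at hy'lt
      refine ⟨y + c • (y - w), hy', ?_, ?_⟩
      · have h1 := hlb _ hy'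
        have h2 : A ^ (k + 1) * t₀ = s * C + η := by
          rw [pow_succ, hs, hη, hA]; ring
        rw [h2]
        linarith [mul_le_mul_of_nonneg_left h1 hs0.le]
      · have h1 : p (y + c • (y - w)) + a = p y + a + c * ((p y - p z) / 2) := by
          rw [map_add, map_smul, map_sub, hpw, smul_eq_mul]; ring
        have h2 : t₀ ≤ c₀ / 4 := htη.trans hηc
        rw [h1]
        push_cast
        have h3 : (p y - p z) / 2 ≤ -(c₀ / 4) := by linarith
        linarith [mul_le_mul_of_nonneg_left h3 hc.le]
  obtain ⟨y, hy, -, hyl⟩ := key N le_rfl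
  linarith [hlb y hy]

/-- Sections shrink to points at a polynomial rate. -/
lemma exists_section_subset_ball (hn : n ≠ 0) (hΩ : Bornology.IsBounded Ω) (hlam : 0 < lam)
    (hLam : 0 ≤ Lam) {D : ℝ} (hD0 : 0 < D)
    (hD : ∀ x ∈ closure Ω, ∀ y ∈ closure Ω, ‖y - x‖ ≤ D) {d : ℝ} (hd : 0 < d) :
    ∃ c : ℝ, 0 < c ∧ ∃ β : ℕ, ∀ u, IsMASolution Ω u lam Lam → ∀ x, Metric.ball x d ⊆ Ω →
      ∀ s, 0 < s → s ≤ D → (∀ y ∈ closure Ω, excess u x y < c * s ^ β → ‖y - x‖ ≤ s) ∧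
        ∀ z ∈ frontier Ω, c * s ^ β ≤ excess u x z := by
  obtain ⟨t₀, ht₀, hbd⟩ := exists_boundary_excess hn hΩ hlam hLam hD0 hD hd
  obtain ⟨c, hc, hbal⟩ := exists_balance n hlam hLam (κ := 1 / 2) (by norm_num)
  obtain ⟨β, hβ⟩ := pow_unbounded_of_one_lt 2 (show 1 < 1 + c by linarith)
  refine ⟨t₀ / (2 * D ^ β), by positivity, β, fun u h x hx s hs hsD => ?_⟩
  have hxΩ : x ∈ Ω := hx (Metric.mem_ball_self hd)
  have hcs : t₀ / (2 * D ^ β) * s ^ β = t₀ / 2 * (s / D) ^ β := by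
    rw [div_pow]; field_simp
  have hsD1 : (s / D) ^ β ≤ 1 := pow_le_one₀ (by positivity) ((div_le_one hD0).2 hsD)
  have key : ∀ k : ℕ, ∀ y ∈ closure Ω, excess u x y < t₀ / 2 ^ k → (1 + c) ^ k * ‖y - x‖ ≤ D := by
    intro k
    induction k with
    | zero =>
      intro y hy _
      simpa using hD x (subset_closure hxΩ) y hy
    | succ k ih =>
      intro y hy hlt
      set t := t₀ / 2 ^ k with ht
      have ht0 : 0 < t := by positivity
      have htle : t ≤ t₀ := div_le_self ht₀.le (one_le_pow₀ (by norm_num))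
      have ht2 : t₀ / 2 ^ (k + 1) = t / 2 := by rw [ht, pow_succ]; field_simp
      rw [ht2] at hlt
      have hval : ∀ v, u v - (fderiv ℝ u x v + (u x - fderiv ℝ u x x + t)) = excess u x v - t := by
        intro v
        rw [excess_eq]
        ring
      obtain ⟨h1, h2⟩ := hbal Ω u h (fderiv ℝ u x) (u x - fderiv ℝ u x x + t) t (fun v hv => by
          have h1 := hbd u h x hx v hv
          have h2 := hval v
          rw [h.eq_zero v hv] at h2
          linarith) ht0 (fun v hv _ => by
          rw [hval]
          linarith [h.excess_nonneg hxΩ hv]) y hy x (subset_closure hxΩ) (by linarith) (by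
          rw [hval]
          linarith)
      rw [← sub_neg, hval] at h2
      have h3 := ih _ h1 (by linarith)
      have h4 : y + c • (y - x) - x = (1 + c) • (y - x) := by module
      rw [h4, norm_smul, Real.norm_of_nonneg (by linarith)] at h3
      rw [pow_succ]
      linarith
  constructor
  · intro y hy hlt
    obtain ⟨k, hk1, hk2⟩ := exists_nat_pow_near (x := D / s) ((one_le_div hs).2 hsD)
      (show 1 < 1 + c by linarith)
    have h1 : (2 : ℝ) ^ k * (s / D) ^ β ≤ 1 := by
      have h2 : (2 : ℝ) ^ k ≤ (D / s) ^ β :=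
        calc (2 : ℝ) ^ k ≤ ((1 + c) ^ β) ^ k := by gcongr
          _ = ((1 + c) ^ k) ^ β := by rw [← pow_mul, ← pow_mul, mul_comm]
          _ ≤ _ := by gcongr
      calc (2 : ℝ) ^ k * (s / D) ^ β ≤ (D / s) ^ β * (s / D) ^ β := by gcongr
        _ = 1 := by rw [← mul_pow]; field_simp; simp
    have h3 := key (k + 1) y hy (hlt.trans_le (by
      rw [hcs, le_div_iff₀ (by positivity), pow_succ]
      nlinarith))
    have h4 : D < (1 + c) ^ (k + 1) * s := (div_lt_iff₀ hs).1 hk2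
    have h5 : 0 < (1 + c) ^ (k + 1) := by positivity
    exact le_of_mul_le_mul_left (h3.trans h4.le) h5
  · intro z hz
    rw [hcs]
    have := hbd u h x hx z hz
    nlinarith

end Localization

section CriticalDensity

open Matrix Filter Topology Set

variable {n : ℕ} {Ω : Set (E n)} {lam Lam : ℝ}

/-- The linearized Monge-Ampère operator, with the sign for which it is elliptic. -/
def linMA (u f : E n → ℝ) (x : E n) : ℝ := ∑ i, ∑ j, cofU u x i j * pd2 f x i j

lemma linMA_eq_sum_Hess (u f : E n → ℝ) (x : E n) :
    linMA u f x = ∑ i, ∑ j, (Hess u x).adjugate i j * Hess f x i j := rfl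

lemma linMA_add {u f g : E n → ℝ} {x : E n} (hf : ContDiffAt ℝ 2 f x) (hg : ContDiffAt ℝ 2 g x) :
    linMA u (fun y => f y + g y) x = linMA u f x + linMA u g x := by
  simp only [linMA, pd2_add hf hg, mul_add, Finset.sum_add_distrib]

lemma linMA_const_mul {u f : E n → ℝ} {x : E n} (hf : ContDiffAt ℝ 2 f x) (c : ℝ) :
    linMA u (fun y => c * f y) x = c * linMA u f x := by
  simp only [linMA, pd2_const_mul hf, Finset.mul_sum]
  exact Finset.sum_congr rfl fun i _ => Finset.sum_congr rfl fun j _ => by ring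

lemma linMA_congr {u f g : E n → ℝ} {x : E n} (h : f =ᶠ[𝓝 x] g) : linMA u f x = linMA u g x := by
  simp only [linMA, pd2_congr h]

lemma linMA_const (u : E n → ℝ) (c : ℝ) (x : E n) : linMA u (fun _ => c) x = 0 := by
  have h := Hess_affine (x := x) (0 : E n →L[ℝ] ℝ) c
  simp only [_root_.zero_apply, zero_add] at h
  rw [linMA_eq_sum_Hess, h]
  simp

lemma linMA_self {u : E n → ℝ} {x : E n} (hu : ContDiffAt ℝ 2 u x) :
    linMA u u x = n * (Hess u x).det := adjugate_sum_self (Hess_isHermitian hu)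

lemma linMA_comp {u f : E n → ℝ} {x : E n} {F : ℝ → ℝ} (hf : ContDiffAt ℝ 2 f x)
    (hF : ContDiffAt ℝ 2 F (f x)) :
    linMA u (fun y => F (f y)) x = deriv F (f x) * linMA u f x +
      deriv (deriv F) (f x) * ∑ i, ∑ j, cofU u x i j * (pd f x i * pd f x j) := by
  simp only [linMA, pd2_comp hf hF, mul_add, Finset.sum_add_distrib, Finset.mul_sum]
  congr 1 <;> exact Finset.sum_congr rfl fun i _ => Finset.sum_congr rfl fun j _ => by ring

/-- Supersolutions that are at most one at the center of a section stay below two on a set of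
positive proportion. -/
lemma exists_pow_le_volume_sq (hlam : 0 < lam) (hLam : 0 < Lam) :
    ∃ c : ℝ, 0 < c ∧ ∀ (Ω : Set (E n)) (u : E n → ℝ), IsMASolution Ω u lam Lam → ∀ x ∈ Ω,
      ∀ t : ℝ, 0 < t → (∀ z ∈ frontier Ω, t ≤ excess u x z) → ∀ v : E n → ℝ,
      (∀ y ∈ MASection Ω u x t, ContDiffAt ℝ 2 v y) →
      ContinuousOn v (closure (MASection Ω u x t)) →
      (∀ y ∈ closure (MASection Ω u x t), 0 ≤ v y) → v x ≤ 1 →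
      (∀ y ∈ MASection Ω u x t, linMA u v y ≤ 0) →
      c * t ^ n ≤ volume.real {y ∈ MASection Ω u x t | v y < 2} ^ 2 := by
  set R := johnRadius n with hR
  have hR0 : 0 < R := johnRadius_pos n
  set q := (1 / (2 * R)) ^ n * volume.real (Metric.ball (0 : E n) 1) with hq
  have hq0 : 0 < q := mul_pos (by positivity) volume_real_unit_ball_pos
  refine ⟨lam * q ^ 2 / (16 ^ n * Lam ^ 2), by positivity, ?_⟩
  intro Ω u h x hx t ht hbd v hv hvc hv0 hvx hLv
  set p := fderiv ℝ u x with hp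
  set a := u x - p x + t with ha
  have hex : ∀ y, u y - (p y + a) = excess u x y - t := by
    intro y
    rw [excess_eq]
    ring
  set S := MASection Ω u x t with hS
  have hSdef : S = {y ∈ closure Ω | u y < p y + a} := by
    ext y
    simp only [hS, MASection, mem_ofPred_eq, ha, map_sub, hp]
    refine and_congr_right fun _ => ?_
    constructor <;> intro <;> linarith
  have hb : ∀ y ∈ frontier Ω, p y + a ≤ 0 := by
    intro y hy
    have h1 := hbd y hy
    have h2 := hex y
    rw [h.eq_zero y hy] at h2
    linarith
  have hxS : x ∈ S := by
    rw [hSdef]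
    refine ⟨subset_closure hx, ?_⟩
    rw [ha]
    linarith
  obtain ⟨hsub, hopen, hconv, hbdd, hfr, hcl⟩ := h.sublevel hb hSdef
  obtain ⟨T, z, hT, hout, hdet⟩ := h.exists_normalization hlam hb hSdef ⟨x, hxS⟩ ht (fun y hy => by
    rw [hex]
    linarith [h.excess_nonneg hx (subset_closure (hsub hy))])
  set w : E n → ℝ := fun y => v y + 2 / t * (u y - (p y + a)) with hw
  have hu2 : ∀ y ∈ S, ContDiffAt ℝ 2 u y := fun y hy => h.contDiffAt_two (hsub hy)
  have hsub2 : ∀ y ∈ S, ContDiffAt ℝ 2 (fun y => u y - (p y + a)) y :=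
    fun y hy => (hu2 y hy).sub (contDiffAt_affine p a)
  have h2t : 0 < 2 / t := by positivity
  set W := volume.real {y ∈ S | v y < 2} with hW
  have hWw : volume.real {y ∈ S | w y < 0} ≤ W := by
    refine measureReal_mono (fun y hy => ⟨hy.1, ?_⟩)
      (hbdd.subset fun y hy => hy.1).measure_lt_top.ne
    have h1 : w y < 0 := hy.2
    have h2 := h.excess_nonneg hx (subset_closure (hsub hy.1))
    have h3 : 2 / t * (excess u x y - t) = 2 / t * excess u x y - 2 := by field_simp
    simp only [hw, hex, h3] at h1
    have h4 : 0 ≤ 2 / t * excess u x y := by positivity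
    change v y < 2
    linarith
  have habp := det_mul_volume_le hopen hbdd (w := w) (x := x) (m := 1) (B := (2 / t) ^ n * Lam)
    (fun y hy => (hv y hy).add (contDiffAt_const.mul (hsub2 y hy)))
    (hvc.add (continuousOn_const.mul
      ((h.continuousOn.mono (closure_mono hsub)).sub (by fun_prop)))) hxS
    (by
      have : 2 / t * (0 - t) = -2 := by field_simp; ring
      simp only [hw, hex, excess_self, this]
      linarith)
    (fun y hy => by
      simp only [hw, hfr y hy, sub_self, mul_zero, add_zero]
      exact hv0 y hy.1)
    (by positivity)
    (fun y hy _ hpsd => by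
      have hyΩ := hsub hy
      have hpd := h.posDef hlam hyΩ
      have h1 : ∑ i, ∑ j, (Hess u y).adjugate i j * Hess w y i j ≤
          n * (2 / t) * (Hess u y).det := by
        rw [← linMA_eq_sum_Hess, hw, linMA_add (hv y hy) (contDiffAt_const.mul (hsub2 y hy)),
          linMA_const_mul (hsub2 y hy), linMA_eq_sum_Hess u (fun y => u y - (p y + a)),
          Hess_sub_affine (hu2 y hy), ← linMA_eq_sum_Hess, linMA_self (hu2 y hy)]
        linarith [hLv y hy]
      refine (det_le_of_adjugate_sum_le hpd hpsd h1).trans ?_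
      gcongr
      exact h.det_le y hyΩ)
    T (Metric.ball 0 (1 / (2 * R)))
    (fun e he y hy => by
      refine real_inner_lt_of_norm_lt (b := 2 * R) (mem_ball_zero_iff.1 he) ?_ (by positivity)
        (by rw [one_div, inv_mul_cancel₀ (by positivity)])
      exact norm_sub_le_two_mul (hout x (subset_closure hxS)) (hout y hy))
  rw [volume_real_ball _ (by positivity), ← hq] at habp
  have h1 : |T.det| * q ≤ (2 / t) ^ n * Lam * W := habp.trans (by gcongr)
  have h2 : T.det ^ 2 * q ^ 2 ≤ ((2 / t) ^ n * Lam * W) ^ 2 := by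
    rw [← sq_abs T.det, ← mul_pow]
    gcongr
  have h3 : lam * q ^ 2 ≤ (4 * t) ^ n * ((2 / t) ^ n * Lam * W) ^ 2 :=
    calc lam * q ^ 2 ≤ (4 * t) ^ n * T.det ^ 2 * q ^ 2 := by gcongr
      _ = (4 * t) ^ n * (T.det ^ 2 * q ^ 2) := by ring
      _ ≤ _ := by gcongr
  have h4 : t ^ n * ((4 * t) ^ n * ((2 / t) ^ n * Lam * W) ^ 2) = 16 ^ n * Lam ^ 2 * W ^ 2 := by
    rw [div_pow, mul_pow, show (16 : ℝ) ^ n = 4 ^ n * (2 ^ n * 2 ^ n) by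
      rw [← mul_pow, ← mul_pow]; norm_num]
    field_simp
  rw [div_mul_eq_mul_div, div_le_iff₀ (by positivity)]
  calc lam * q ^ 2 * t ^ n = t ^ n * (lam * q ^ 2) := by ring
    _ ≤ t ^ n * ((4 * t) ^ n * ((2 / t) ^ n * Lam * W) ^ 2) := by gcongr
    _ = _ := by rw [h4]; ring

end CriticalDensity

section Piola

open Matrix Filter Topology Set

variable {n : ℕ}

/-- The determinant as a continuous multilinear map of the rows. -/
def detRowContinuousMultilinear (n : ℕ) :
    ContinuousMultilinearMap ℝ (fun _ : Fin n => Fin n → ℝ) ℝ where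
  toMultilinearMap := (Matrix.detRowAlternating (n := Fin n) (R := ℝ)).toMultilinearMap
  cont := continuous_id.matrix_det

lemma hasFDerivAt_det_rows {A : E n → Matrix (Fin n) (Fin n) ℝ}
    {A' : Fin n → E n →L[ℝ] (Fin n → ℝ)} {x : E n}
    (hA : ∀ k, HasFDerivAt (fun y => A y k) (A' k) x) :
    ∃ L : E n →L[ℝ] ℝ, HasFDerivAt (fun y => (A y).det) L x ∧
      ∀ v, L v = ∑ k, ((A x).updateRow k (A' k v)).det := by
  have h := HasFDerivAt.multilinear_comp (f := detRowContinuousMultilinear n) hA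
  refine ⟨_, h, fun v => ?_⟩
  simp only [_root_.sum_apply, ContinuousLinearMap.comp_apply,
    ContinuousMultilinearMap.toContinuousLinearMap_apply]
  rfl

lemma det_updateRow_updateRow_antisymm (A : Matrix (Fin n) (Fin n) ℝ) {j k : Fin n} (hjk : j ≠ k)
    (v w : Fin n → ℝ) :
    ((A.updateRow j v).updateRow k w).det = -((A.updateRow j w).updateRow k v).det := by
  have h := (Matrix.detRowAlternating (n := Fin n) (R := ℝ)).map_swap
    ((A.updateRow j w).updateRow k v) hjk
  have h2 : ((A.updateRow j w).updateRow k v : Fin n → Fin n → ℝ) ∘ Equiv.swap j k =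
      (A.updateRow j v).updateRow k w := by
    funext i
    change ((A.updateRow j w).updateRow k v) (Equiv.swap j k i) =
      ((A.updateRow j v).updateRow k w) i
    rcases eq_or_ne i j with rfl | hij
    · rw [Equiv.swap_apply_left, updateRow_self, updateRow_ne hjk, updateRow_self]
    rcases eq_or_ne i k with rfl | hik
    · rw [Equiv.swap_apply_right, updateRow_self, updateRow_ne hjk, updateRow_self]
    · rw [Equiv.swap_apply_of_ne_of_ne hij hik, updateRow_ne hik, updateRow_ne hij,
        updateRow_ne hik, updateRow_ne hij]
  rw [h2] at h
  exact h

lemma det_updateRow_eq_sum (A : Matrix (Fin n) (Fin n) ℝ) (k : Fin n) (w : Fin n → ℝ) :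
    (A.updateRow k w).det = ∑ l, w l * (A.updateRow k (Pi.single l 1)).det := by
  have h : w = ∑ l, w l • (Pi.single l 1 : Fin n → ℝ) := by
    ext i
    simp [Pi.single_apply]
  conv_lhs => rw [h]
  have h2 := map_sum ((Matrix.detRowAlternating (n := Fin n) (R := ℝ)).toMultilinearMap.toLinearMap
    A k) (fun l => w l • (Pi.single l 1 : Fin n → ℝ)) Finset.univ
  simp only [map_smul, smul_eq_mul] at h2
  exact h2

variable {u : E n → ℝ} {x : E n}

lemma ContDiffAt.fderiv_apply_two (hu : ContDiffAt ℝ 3 u x) (v : E n) :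
    ContDiffAt ℝ 2 (fun y => fderiv ℝ u y v) x :=
  (hu.fderiv_right (m := 2) (by norm_num)).clm_apply contDiffAt_const

lemma ContDiffAt.contDiffAt_pd2 (hu : ContDiffAt ℝ 3 u x) (k l : Fin n) :
    ContDiffAt ℝ 1 (fun y => pd2 u y k l) x :=
  ((hu.fderiv_apply_two _).fderiv_right (m := 1) (by norm_num)).clm_apply contDiffAt_const

lemma fderiv_pd2_symm (hu : ContDiffAt ℝ 3 u x) (i k l : Fin n) :
    fderiv ℝ (fun y => pd2 u y k l) x (EuclideanSpace.single i 1) =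
      fderiv ℝ (fun y => pd2 u y k i) x (EuclideanSpace.single l 1) := by
  have h1 : ∀ l, (fun y => pd2 u y k l) =ᶠ[𝓝 x] fun y => fderiv ℝ (fun y => fderiv ℝ u y
      (EuclideanSpace.single k 1)) y (EuclideanSpace.single l 1) := by
    intro l
    filter_upwards [(hu.of_le (by norm_num) : ContDiffAt ℝ 2 u x).eventually (by simp)] with y hy
    have h := (Hess_isHermitian hy).apply l k
    rw [star_trivial] at h
    exact h
  rw [(h1 l).fderiv_eq, (h1 i).fderiv_eq]
  have h2 := (Hess_isHermitian (hu.fderiv_apply_two (EuclideanSpace.single k 1))).apply l i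
  simpa [Hess, pd2] using h2

lemma ContDiffAt.contDiffAt_cofU (hu : ContDiffAt ℝ 3 u x) (i j : Fin n) :
    ContDiffAt ℝ 1 (fun y => cofU u y i j) x := by
  simp only [cofU, adjugate_apply, det_apply]
  refine ContDiffAt.sum fun σ _ => ContDiffAt.const_smul _ (contDiffAt_prod fun k _ => ?_)
  rcases eq_or_ne (σ k) j with h | h
  · simp only [h, updateRow_self]
    exact contDiffAt_const
  · simp only [updateRow_ne h]
    exact hu.contDiffAt_pd2 _ _

/-- Piola's identity: the cofactor matrix of a Hessian is divergence free. -/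
lemma sum_fderiv_cofU (hu : ContDiffAt ℝ 3 u x) (j : Fin n) :
    ∑ i, fderiv ℝ (fun y => cofU u y i j) x (EuclideanSpace.single i 1) = 0 := by
  set P : Fin n → Fin n → Fin n → ℝ := fun k i l =>
    (((Hess u x).updateRow j (Pi.single i 1)).updateRow k (Pi.single l 1)).det with hP
  set Dv : Fin n → Fin n → Fin n → ℝ := fun k i l =>
    fderiv ℝ (fun y => pd2 u y k l) x (EuclideanSpace.single i 1) with hDv
  have hterm : ∀ i, fderiv ℝ (fun y => cofU u y i j) x (EuclideanSpace.single i 1) =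
      ∑ k, if k = j then 0 else ∑ l, Dv k i l * P k i l := by
    intro i
    set A' : Fin n → E n →L[ℝ] (Fin n → ℝ) := fun k => if k = j then 0 else
      ContinuousLinearMap.pi fun l => fderiv ℝ (fun y => pd2 u y k l) x with hA'
    obtain ⟨L, hL, hLv⟩ := hasFDerivAt_det_rows (x := x) (A' := A')
      (A := fun y => (Hess u y).updateRow j (Pi.single i 1)) (fun k => by
        rcases eq_or_ne k j with h | h
        · simp only [hA', h, updateRow_self, if_true]
          exact hasFDerivAt_const _ _
        · simp only [hA', updateRow_ne h, if_neg h]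
          exact hasFDerivAt_pi.2 fun l =>
            ((hu.contDiffAt_pd2 k l).differentiableAt (by simp)).hasFDerivAt)
    have h1 : (fun y => cofU u y i j) = fun y =>
        ((Hess u y).updateRow j (Pi.single i 1)).det := by
      ext y
      rw [cofU, adjugate_apply]
    rw [h1, hL.fderiv, hLv]
    refine Finset.sum_congr rfl fun k _ => ?_
    rcases eq_or_ne k j with h | h
    · simp only [hA', h, if_true, _root_.zero_apply]
      exact det_eq_zero_of_row_eq_zero j fun l => by simp
    · simp only [hA', if_neg h]
      rw [det_updateRow_eq_sum]
      rfl
  simp only [hterm]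
  rw [Finset.sum_comm]
  refine Finset.sum_eq_zero fun k _ => ?_
  rcases eq_or_ne k j with h | h
  · simp [h]
  simp only [if_neg h]
  have h1 : ∑ i, ∑ l, Dv k i l * P k i l = -∑ i, ∑ l, Dv k i l * P k i l := by
    conv_lhs => rw [Finset.sum_comm]
    rw [← Finset.sum_neg_distrib]
    refine Finset.sum_congr rfl fun i _ => ?_
    rw [← Finset.sum_neg_distrib]
    refine Finset.sum_congr rfl fun l _ => ?_
    have h2 : P k l i = -P k i l := det_updateRow_updateRow_antisymm _ h.symm _ _
    have h3 : Dv k l i = Dv k i l := fderiv_pd2_symm hu _ _ _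
    rw [h2, h3, mul_neg]
  linarith

lemma integral_fderiv_apply_eq_zero {F : E n → ℝ} (hF : ContDiff ℝ 1 F)
    (hc : HasCompactSupport F) (v : E n) : ∫ y, fderiv ℝ F y v = 0 := by
  have hc' : HasCompactSupport fun y => fderiv ℝ F y v := hc.fderiv_apply (𝕜 := ℝ) v
  have h1 : Integrable (fun y => fderiv ℝ F y v) :=
    ((hF.continuous_fderiv (by simp)).clm_apply continuous_const).integrable_of_hasCompactSupport
      hc'
  have h2 := integral_mul_fderiv_eq_neg_fderiv_mul_of_integrable (μ := volume)
    (f := fun _ : E n => (1 : ℝ)) (g := F) (v := v) (by simp) (by simpa using h1)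
    (by simpa using hF.continuous.integrable_of_hasCompactSupport hc)
    (fun _ _ => differentiableAt_const _) (fun y _ => hF.differentiable (by simp) y)
  simpa using h2

/-- The linearized operator annihilates constants in the weak sense. -/
lemma integral_linMA_eq_zero {Ω V : Set (E n)} (hu : ∀ x ∈ Ω, ContDiffAt ℝ 3 u x) (hVΩ : V ⊆ Ω)
    {φ : E n → ℝ} (hφ : ContDiff ℝ 2 φ) (hc : HasCompactSupport φ) (hφV : tsupport φ ⊆ V) :
    ∫ y in V, linMA u φ y = 0 := by
  have hout : ∀ y ∉ tsupport φ, φ =ᶠ[𝓝 y] fun _ => 0 := fun y hy =>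
    notMem_tsupport_iff_eventuallyEq.1 hy
  set G : Fin n → Fin n → E n → ℝ := fun i j y => cofU u y i j * pd φ y j with hG
  have hpd : ∀ j, ContDiff ℝ 1 fun y => pd φ y j := fun j =>
    (hφ.fderiv_right (m := 1) (by norm_num)).clm_apply contDiff_const
  have hsupp : ∀ i j, ∀ y ∉ tsupport φ, G i j =ᶠ[𝓝 y] fun _ => 0 := by
    intro i j y hy
    filter_upwards [(hout y hy).fderiv (𝕜 := ℝ)] with z hz
    simp [hG, pd, hz]
  have hGc : ∀ i j, HasCompactSupport (G i j) := fun i j =>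
    hc.mono' fun y hy => by
      by_contra hy'
      exact hy (hsupp i j y hy').self_of_nhds
  have hG1 : ∀ i j, ContDiff ℝ 1 (G i j) := by
    intro i j
    refine contDiff_iff_contDiffAt.2 fun y => ?_
    by_cases hy : y ∈ tsupport φ
    · exact ((hu y (hVΩ (hφV hy))).contDiffAt_cofU i j).mul (hpd j).contDiffAt
    · exact (contDiffAt_const (c := (0 : ℝ))).congr_of_eventuallyEq (hsupp i j y hy)
  have hsum : ∀ y, ∑ i, ∑ j, fderiv ℝ (G i j) y (EuclideanSpace.single i 1) =
      linMA u φ y := by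
    intro y
    by_cases hy : y ∈ tsupport φ
    · have huy := hu y (hVΩ (hφV hy))
      have h1 : ∀ i j, fderiv ℝ (G i j) y (EuclideanSpace.single i 1) =
          cofU u y i j * pd2 φ y i j +
            pd φ y j * fderiv ℝ (fun y => cofU u y i j) y (EuclideanSpace.single i 1) := by
        intro i j
        rw [hG, fderiv_fun_mul ((huy.contDiffAt_cofU i j).differentiableAt (by simp))
          ((hpd j).differentiable (by simp) y)]
        rfl
      simp only [h1, Finset.sum_add_distrib]
      rw [Finset.sum_comm (f := fun i j => pd φ y j * _)]
      simp only [← Finset.mul_sum, sum_fderiv_cofU huy, mul_zero, Finset.sum_const_zero, add_zero]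
      rfl
    · rw [linMA_congr (hout y hy), linMA_const]
      refine Finset.sum_eq_zero fun i _ => Finset.sum_eq_zero fun j _ => ?_
      rw [(hsupp i j y hy).fderiv_eq]
      simp
  have hV : ∫ y in V, linMA u φ y = ∫ y, linMA u φ y := by
    refine setIntegral_eq_integral_of_forall_compl_eq_zero fun y hy => ?_
    rw [linMA_congr (hout y fun h => hy (hφV h)), linMA_const]
  rw [hV]
  simp only [← hsum]
  have hinteg : ∀ i j, Integrable fun y => fderiv ℝ (G i j) y (EuclideanSpace.single i 1) :=
    fun i j => (((hG1 i j).continuous_fderiv (by simp)).clm_apply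
      continuous_const).integrable_of_hasCompactSupport ((hGc i j).fderiv_apply (𝕜 := ℝ) _)
  rw [integral_finsetSum _ fun i _ => integrable_finsetSum _ fun j _ => hinteg i j]
  refine Finset.sum_eq_zero fun i _ => ?_
  rw [integral_finsetSum _ fun j _ => hinteg i j]
  exact Finset.sum_eq_zero fun j _ => integral_fderiv_apply_eq_zero (hG1 i j) (hGc i j) _

end Piola

section Barrier

open Matrix Filter Topology Set

variable {n : ℕ} {u : E n → ℝ} {x : E n}

lemma exists_taylor_bounds (hu : ContDiffAt ℝ 3 u x) :
    ∃ C : ℝ, 0 ≤ C ∧ ∀ᶠ y in 𝓝 x,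
      ‖fderiv ℝ u y - fderiv ℝ u x - fderiv ℝ (fderiv ℝ u) y (y - x)‖ ≤ C * ‖y - x‖ ^ 2 ∧
      |excess u x y - fderiv ℝ (fderiv ℝ u) y (y - x) (y - x) / 2| ≤ C * ‖y - x‖ ^ 3 := by
  set B := fderiv ℝ (fderiv ℝ u) with hB
  have hB1 : ContDiffAt ℝ 1 B x :=
    (hu.fderiv_right (m := 2) (by norm_num)).fderiv_right (m := 1) (by norm_num)
  obtain ⟨K, s, hs, hK⟩ := hB1.exists_lipschitzOnWith
  have h2 : ∀ᶠ y in 𝓝 x, ContDiffAt ℝ 2 u y :=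
    (hu.of_le (by norm_num) : ContDiffAt ℝ 2 u x).eventually (by simp)
  obtain ⟨ρ, hρ, hball⟩ := Metric.eventually_nhds_iff_ball.1 (h2.and hs)
  have hLip : ∀ y ∈ Metric.ball x ρ, ∀ z ∈ Metric.ball x ρ, ‖B y - B z‖ ≤ K * ‖y - z‖ :=
    fun y hy z hz => hK.norm_sub_le (hball y hy).2 (hball z hz).2
  have hgrad : ∀ y ∈ Metric.ball x ρ,
      ‖fderiv ℝ u y - fderiv ℝ u x - B y (y - x)‖ ≤ K * ‖y - x‖ ^ 2 := by
    intro y hy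
    have hseg : ∀ z ∈ segment ℝ x y, z ∈ Metric.ball x ρ :=
      (convex_ball x ρ).segment_subset (Metric.mem_ball_self hρ) hy
    have h := (convex_segment x y).norm_image_sub_le_of_norm_hasFDerivWithin_le'
      (f := fderiv ℝ u) (f' := B) (φ := B y) (C := K * ‖y - x‖) (fun z hz =>
        (hball z (hseg z hz)).1.differentiableAt_fderiv.hasFDerivAt.hasFDerivWithinAt)
      (fun z hz => (hLip z (hseg z hz) y hy).trans (by
        gcongr
        have := segment_subset_closedBall_right x y hz
        rwa [mem_closedBall_iff_norm, dist_comm, dist_eq_norm] at this))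
      (left_mem_segment ℝ x y) (right_mem_segment ℝ x y)
    calc _ ≤ _ := h
      _ = _ := by ring
  refine ⟨3 * K, by positivity, ?_⟩
  filter_upwards [Metric.ball_mem_nhds x hρ] with y hy
  refine ⟨(hgrad y hy).trans (by
    have : 0 ≤ (K : ℝ) * ‖y - x‖ ^ 2 := by positivity
    linarith), ?_⟩
  have hseg : ∀ z ∈ segment ℝ x y, z ∈ Metric.ball x ρ :=
    (convex_ball x ρ).segment_subset (Metric.mem_ball_self hρ) hy
  have hsymm := fderiv_fderiv_symm (hball y hy).1
  set f : E n → ℝ := fun z => u z - fderiv ℝ u x (z - x) - B y (z - x) (z - x) / 2 with hf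
  have hf' : ∀ z ∈ segment ℝ x y,
      HasFDerivAt f (fderiv ℝ u z - fderiv ℝ u x - B y (z - x)) z := by
    intro z hz
    have h1 := ((hball z (hseg z hz)).1.differentiableAt (by simp)).hasFDerivAt
    have hid : HasFDerivAt (fun z : E n => z - x) (ContinuousLinearMap.id ℝ (E n)) z :=
      (hasFDerivAt_id z).sub_const x
    have h2 := (fderiv ℝ u x).hasFDerivAt.comp z hid
    have h3 := (((B y).hasFDerivAt.comp z hid).clm_apply hid).const_mul (1 / 2)
    have h4 := (h1.sub h2).sub h3
    have e1 : f = fun z => u z - fderiv ℝ u x (z - x) - 1 / 2 * B y (z - x) (z - x) := by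
      ext z; simp only [hf]; ring
    rw [e1]
    refine h4.congr_fderiv (ContinuousLinearMap.ext fun v => ?_)
    simp only [_root_.sub_apply, _root_.smul_apply, _root_.add_apply,
      ContinuousLinearMap.comp_apply, ContinuousLinearMap.flip_apply, Function.comp_apply,
      ContinuousLinearMap.id_apply, smul_eq_mul, hB, hsymm v (z - x)]
    ring
  have h := (convex_segment x y).norm_image_sub_le_of_norm_hasFDerivWithin_le
    (f := f) (C := 2 * K * ‖y - x‖ ^ 2) (fun z hz => (hf' z hz).hasFDerivWithinAt)
    (fun z hz => by
      have hzx : ‖z - x‖ ≤ ‖y - x‖ := by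
        have := segment_subset_closedBall_left x y hz
        rwa [mem_closedBall_iff_norm, dist_comm, dist_eq_norm] at this
      have hzy : ‖z - y‖ ≤ ‖y - x‖ := by
        have := segment_subset_closedBall_right x y hz
        rwa [mem_closedBall_iff_norm, dist_comm, dist_eq_norm] at this
      have e1 : fderiv ℝ u z - fderiv ℝ u x - B y (z - x) =
          (fderiv ℝ u z - fderiv ℝ u x - B z (z - x)) + (B z - B y) (z - x) := by
        rw [_root_.sub_apply]; abel
      rw [e1]
      calc _ ≤ _ := norm_add_le _ _
        _ ≤ K * ‖z - x‖ ^ 2 + ‖B z - B y‖ * ‖z - x‖ :=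
          add_le_add (hgrad z (hseg z hz)) ((B z - B y).le_opNorm _)
        _ ≤ K * ‖y - x‖ ^ 2 + K * ‖y - x‖ * ‖y - x‖ := by
          gcongr
          exact (hLip z (hseg z hz) y hy).trans (by gcongr)
        _ = _ := by ring)
    (left_mem_segment ℝ x y) (right_mem_segment ℝ x y)
  have e2 : f y - f x = excess u x y - B y (y - x) (y - x) / 2 := by
    simp only [hf, excess, sub_self, map_zero, zero_div, sub_zero]
    ring
  rw [e2, Real.norm_eq_abs] at h
  refine h.trans ?_
  have : 0 ≤ (K : ℝ) * ‖y - x‖ ^ 3 := by positivity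
  calc _ = 2 * (K * ‖y - x‖ ^ 3) := by ring
    _ ≤ _ := by linarith

lemma exists_coercive {B : E n →L[ℝ] E n →L[ℝ] ℝ} (hB : ∀ v, v ≠ 0 → 0 < B v v) :
    ∃ μ : ℝ, 0 < μ ∧ ∀ v, μ * ‖v‖ ^ 2 ≤ B v v := by
  rcases isEmpty_or_nonempty (Metric.sphere (0 : E n) 1) with he | ⟨⟨v₀, hv₀⟩⟩
  · refine ⟨1, one_pos, fun v => ?_⟩
    rcases eq_or_ne v 0 with rfl | hv
    · simp
    · exact (he.false ⟨‖v‖⁻¹ • v, by simp [norm_smul, hv]⟩).elim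
  obtain ⟨w, hw, hmin⟩ := (isCompact_sphere (0 : E n) 1).exists_isMinOn ⟨v₀, hv₀⟩
    (f := fun v => B v v) (by fun_prop)
  have hw0 : w ≠ 0 := by
    rintro rfl
    simp at hw
  refine ⟨B w w, hB w hw0, fun v => ?_⟩
  rcases eq_or_ne v 0 with rfl | hv
  · simp
  have h1 : B w w ≤ B (‖v‖⁻¹ • v) (‖v‖⁻¹ • v) :=
    hmin (show ‖v‖⁻¹ • v ∈ Metric.sphere (0 : E n) 1 by simp [norm_smul, hv])
  simp only [map_smul, _root_.smul_apply, smul_eq_mul] at h1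
  have hv' : 0 < ‖v‖ := norm_pos_iff.2 hv
  calc B w w * ‖v‖ ^ 2 ≤ ‖v‖⁻¹ * (‖v‖⁻¹ * B v v) * ‖v‖ ^ 2 := by gcongr
    _ = _ := by field_simp

end Barrier

section PoleBarrier

open Matrix Filter Topology Set

variable {n : ℕ} {Ω : Set (E n)} {lam Lam : ℝ} {u : E n → ℝ} {x : E n}

lemma sum_adjugate_mul_eq (A : Matrix (Fin n) (Fin n) ℝ) (v : Fin n → ℝ) :
    ∑ i, ∑ j, A.adjugate i j * (v i * v j) = v ⬝ᵥ (A.adjugate *ᵥ v) := by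
  simp only [dotProduct, mulVec, Finset.mul_sum]
  exact Finset.sum_congr rfl fun i _ => Finset.sum_congr rfl fun j _ => by ring

lemma sum_adjugate_mulVec_add {A : Matrix (Fin n) (Fin n) ℝ} (hA : A.IsHermitian)
    (z e : Fin n → ℝ) :
    ∑ i, ∑ j, A.adjugate i j * ((A *ᵥ z + e) i * (A *ᵥ z + e) j) =
      A.det * (z ⬝ᵥ (A *ᵥ z) + 2 * (z ⬝ᵥ e)) + ∑ i, ∑ j, A.adjugate i j * (e i * e j) := by
  have hT : Aᵀ = A := by
    have : A.IsSymm := by simpa using hA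
    exact this
  rw [sum_adjugate_mul_eq, sum_adjugate_mul_eq, mulVec_add, mulVec_mulVec, adjugate_mul,
    smul_mulVec, one_mulVec, add_dotProduct, dotProduct_add, dotProduct_add, dotProduct_smul,
    dotProduct_smul, dotProduct_comm (A *ᵥ z) z, dotProduct_comm e z]
  have h1 : (A *ᵥ z) ⬝ᵥ (A.adjugate *ᵥ e) = A.det * (z ⬝ᵥ e) := by
    rw [← vecMul_transpose, hT, ← dotProduct_mulVec, mulVec_mulVec, mul_adjugate, smul_mulVec,
      one_mulVec, dotProduct_smul, smul_eq_mul]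
  rw [h1]
  simp only [smul_eq_mul]
  ring

lemma pd_excess {y : E n} (hu : DifferentiableAt ℝ u y) (i : Fin n) :
    pd (excess u x) y i = fderiv ℝ u y (EuclideanSpace.single i 1) -
      fderiv ℝ u x (EuclideanSpace.single i 1) := by
  have h1 : excess u x = fun y => u y - (fderiv ℝ u x y + (u x - fderiv ℝ u x x)) :=
    funext fun y => excess_eq u x y
  rw [h1, pd, fderiv_fun_sub hu (by fun_prop), fderiv_add_const, (fderiv ℝ u x).fderiv,
    _root_.sub_apply]

lemma contDiffAt_excess {y : E n} {m : WithTop ℕ∞} (hu : ContDiffAt ℝ m u y) :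
    ContDiffAt ℝ m (excess u x) y := by
  have h1 : excess u x = fun y => u y - (fderiv ℝ u x y + (u x - fderiv ℝ u x x)) :=
    funext fun y => excess_eq u x y
  rw [h1]
  exact hu.sub (contDiffAt_affine _ _)

lemma linMA_excess {y : E n} (hu : ContDiffAt ℝ 2 u y) :
    linMA u (excess u x) y = n * (Hess u y).det := by
  have h1 : excess u x = fun y => u y - (fderiv ℝ u x y + (u x - fderiv ℝ u x x)) :=
    funext fun y => excess_eq u x y
  rw [h1, linMA_eq_sum_Hess, Hess_sub_affine hu, ← linMA_eq_sum_Hess, linMA_self hu]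

lemma IsMASolution.exists_excess_lower_bound (h : IsMASolution Ω u lam Lam) (hlam : 0 < lam)
    (hx : x ∈ Ω) : ∃ κ : ℝ, 0 < κ ∧ ∀ᶠ y in 𝓝 x, κ * ‖y - x‖ ≤ √(excess u x y) := by
  have hu3 : ContDiffAt ℝ 3 u x :=
    (h.contDiffAt x hx).of_le (WithTop.coe_le_coe.2 (le_top : (3 : ℕ∞) ≤ ⊤))
  obtain ⟨C, hC, hT⟩ := exists_taylor_bounds hu3
  set B := fderiv ℝ (fderiv ℝ u) with hB
  have hpos : ∀ v, v ≠ 0 → 0 < B x v v := by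
    intro v hv
    rw [hB, ← dotProduct_Hess_mulVec (h.contDiffAt_two hx)]
    have := (h.posDef hlam hx).dotProduct_mulVec_pos (x := (v : Fin n → ℝ))
      (fun h0 => hv (by ext i; exact congrFun h0 i))
    rwa [star_trivial] at this
  obtain ⟨μ, hμ, hco⟩ := exists_coercive hpos
  have hBc : ContinuousAt B x :=
    ((hu3.fderiv_right (m := 2) (by norm_num)).fderiv_right (m := 1) (by norm_num)).continuousAt
  have hBn : Tendsto (fun y => ‖B y - B x‖) (𝓝 x) (𝓝 0) :=
    tendsto_iff_norm_sub_tendsto_zero (E := E n →L[ℝ] E n →L[ℝ] ℝ).1 hBc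
  refine ⟨√(μ / 4), by positivity, ?_⟩
  filter_upwards [hT, hBn.eventually_lt_const
      (show (0 : ℝ) < μ / 4 by positivity),
    Metric.ball_mem_nhds x (show 0 < μ / (8 * (C + 1)) by positivity)] with y hy hBy hball
  refine Real.le_sqrt_of_sq_le ?_
  rw [mul_pow, Real.sq_sqrt (by positivity)]
  rw [mem_ball_iff_norm, lt_div_iff₀ (by positivity)] at hball
  have h1 : |(B y - B x) (y - x) (y - x)| ≤ μ / 4 * ‖y - x‖ * ‖y - x‖ :=
    ((B y - B x).le_opNorm₂ (y - x) (y - x)).trans (by gcongr)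
  rw [_root_.sub_apply, _root_.sub_apply] at h1
  have h2 := (abs_le.1 h1).1
  have h3 := (abs_le.1 hy.2).1
  have h4 := hco (y - x)
  have h5 : C * ‖y - x‖ ^ 3 ≤ μ / 8 * ‖y - x‖ ^ 2 := by
    have : C * ‖y - x‖ ≤ μ / 8 := by linarith [norm_nonneg (y - x)]
    calc C * ‖y - x‖ ^ 3 = C * ‖y - x‖ * ‖y - x‖ ^ 2 := by ring
      _ ≤ _ := by gcongr
  linarith

/-- Near its center the excess is, to leading order, a quadratic polynomial. -/
lemma IsMASolution.exists_gradient_bound (h : IsMASolution Ω u lam Lam) (hlam : 0 < lam)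
    (hx : x ∈ Ω) : ∃ C : ℝ, 0 ≤ C ∧ ∀ᶠ y in 𝓝 x,
      ∑ i, ∑ j, cofU u y i j * (pd (excess u x) y i * pd (excess u x) y j) ≤
        (Hess u y).det * (2 * excess u x y + C * √(excess u x y) ^ 3) := by
  have hu3 : ContDiffAt ℝ 3 u x :=
    (h.contDiffAt x hx).of_le (WithTop.coe_le_coe.2 (le_top : (3 : ℕ∞) ≤ ⊤))
  obtain ⟨C, hC, hT⟩ := exists_taylor_bounds hu3
  obtain ⟨κ, hκ, hlow⟩ := h.exists_excess_lower_bound hlam hx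
  set N := ∑ i, ∑ j, (|cofU u x i j| + 1) with hN
  have hN0 : 0 ≤ N := Finset.sum_nonneg fun i _ => Finset.sum_nonneg fun j _ => by positivity
  have hcof : ∀ᶠ y in 𝓝 x, ∀ i j, |cofU u y i j| ≤ |cofU u x i j| + 1 := by
    refine eventually_all.2 fun i => eventually_all.2 fun j => ?_
    exact (hu3.contDiffAt_cofU i j).continuousAt.abs.eventually_le_const (by linarith)
  refine ⟨(4 * C + N * C ^ 2 / lam) / κ ^ 3, by positivity, ?_⟩
  filter_upwards [hT, hlow, hcof, h.isOpen.mem_nhds hx,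
    Metric.ball_mem_nhds x one_pos] with y hy hκy hcy hyΩ hball
  rw [mem_ball_iff_norm] at hball
  have huy := h.contDiffAt_two hyΩ
  set q := fderiv ℝ u y - fderiv ℝ u x - fderiv ℝ (fderiv ℝ u) y (y - x) with hq
  set e : Fin n → ℝ := fun i => q (EuclideanSpace.single i 1) with he
  set z : Fin n → ℝ := (y - x).ofLp with hz
  have hξ : ∀ i, pd (excess u x) y i = (Hess u y *ᵥ z + e) i := by
    intro i
    have h1 := dotProduct_Hess_mulVec huy (EuclideanSpace.single i 1) (y - x)
    rw [fderiv_fderiv_symm huy] at h1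
    have h2 : ((EuclideanSpace.single i (1 : ℝ) : E n) : Fin n → ℝ) = Pi.single i 1 := by
      ext j
      simp [Pi.single_apply]
    rw [h2, single_one_dotProduct] at h1
    rw [pd_excess (huy.differentiableAt (by simp)), Pi.add_apply, h1, he, hq]
    simp only [_root_.sub_apply]
    ring
  simp only [hξ]
  rw [show cofU u y = (Hess u y).adjugate from rfl, sum_adjugate_mulVec_add (Hess_isHermitian huy),
    dotProduct_Hess_mulVec huy]
  have hze : z ⬝ᵥ e = q (y - x) := by
    conv_rhs => rw [euclidean_eq_sum_single (y - x)]
    simp [dotProduct, he, hz]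
  have hqz : q (y - x) ≤ C * ‖y - x‖ ^ 3 :=
    (le_abs_self _).trans ((q.le_opNorm _).trans (by
      calc ‖q‖ * ‖y - x‖ ≤ C * ‖y - x‖ ^ 2 * ‖y - x‖ := by gcongr; exact hy.1
        _ = _ := by ring))
  have hei : ∀ i, |e i| ≤ C * ‖y - x‖ ^ 2 := fun i =>
    (q.le_opNorm _).trans (by simpa using hy.1)
  have hee : ∑ i, ∑ j, (Hess u y).adjugate i j * (e i * e j) ≤ N * C ^ 2 * ‖y - x‖ ^ 3 := by
    calc ∑ i, ∑ j, (Hess u y).adjugate i j * (e i * e j) ≤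
        ∑ i, ∑ j, (|cofU u x i j| + 1) * (C ^ 2 * ‖y - x‖ ^ 3) := by
          refine Finset.sum_le_sum fun i _ => Finset.sum_le_sum fun j _ => ?_
          refine (le_abs_self _).trans ?_
          rw [abs_mul, abs_mul]
          refine mul_le_mul (hcy i j) ?_ (by positivity) (by positivity)
          calc |e i| * |e j| ≤ (C * ‖y - x‖ ^ 2) * (C * ‖y - x‖ ^ 2) :=
                mul_le_mul (hei i) (hei j) (abs_nonneg _) (by positivity)
            _ = C ^ 2 * ‖y - x‖ ^ 3 * ‖y - x‖ := by ring
            _ ≤ C ^ 2 * ‖y - x‖ ^ 3 * 1 := by gcongr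
            _ = _ := mul_one _
      _ = _ := by simp only [← Finset.sum_mul]; ring
  have hdet := h.le_det y hyΩ
  have hB := (abs_le.1 hy.2).1
  have hee2 : N * C ^ 2 * ‖y - x‖ ^ 3 ≤ (Hess u y).det * (N * C ^ 2 / lam * ‖y - x‖ ^ 3) :=
    calc N * C ^ 2 * ‖y - x‖ ^ 3 = lam * (N * C ^ 2 / lam * ‖y - x‖ ^ 3) := by field_simp
      _ ≤ _ := by gcongr
  have hcube : (4 * C + N * C ^ 2 / lam) * ‖y - x‖ ^ 3 ≤
      (4 * C + N * C ^ 2 / lam) / κ ^ 3 * √(excess u x y) ^ 3 :=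
    calc _ = (4 * C + N * C ^ 2 / lam) / κ ^ 3 * (κ * ‖y - x‖) ^ 3 := by field_simp
      _ ≤ _ := by gcongr
  have hdet0 : 0 < (Hess u y).det := hlam.trans_le hdet
  calc _ ≤ (Hess u y).det * (fderiv ℝ (fderiv ℝ u) y (y - x) (y - x) + 2 * z ⬝ᵥ e) +
        (Hess u y).det * (N * C ^ 2 / lam * ‖y - x‖ ^ 3) := by linarith
    _ = (Hess u y).det * (fderiv ℝ (fderiv ℝ u) y (y - x) (y - x) + 2 * z ⬝ᵥ e +
        N * C ^ 2 / lam * ‖y - x‖ ^ 3) := by ring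
    _ ≤ _ := by
      refine mul_le_mul_of_nonneg_left ?_ hdet0.le
      rw [hze]
      linarith

lemma hasDerivAt_neg_log_sub_sqrt (K : ℝ) {s : ℝ} (hs : 0 < s) :
    HasDerivAt (fun s => -Real.log s - 2 * K * √s) (-s⁻¹ - K * (√s)⁻¹) s := by
  have h := (Real.hasDerivAt_log hs.ne').neg.sub ((Real.hasDerivAt_sqrt hs.ne').const_mul (2 * K))
  refine h.congr_deriv ?_
  field_simp

lemma hasDerivAt_neg_inv_sub_inv_sqrt (K : ℝ) {s : ℝ} (hs : 0 < s) :
    HasDerivAt (fun s => -s⁻¹ - K * (√s)⁻¹) ((√s)⁻¹ ^ 4 + K / 2 * (√s)⁻¹ ^ 3) s := by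
  have h2 : 0 < √s := Real.sqrt_pos.2 hs
  have h := (hasDerivAt_inv hs.ne').neg.sub
    (((Real.hasDerivAt_sqrt hs.ne').inv h2.ne').const_mul K)
  refine h.congr_deriv ?_
  have h3 : s = √s ^ 2 := (Real.sq_sqrt hs.le).symm
  conv_lhs => rw [h3]
  rw [Real.sqrt_sq h2.le]
  field_simp
  ring

/-- Near any point there is a strict supersolution blowing up exactly at that point. -/
lemma IsMASolution.exists_barrier (h : IsMASolution Ω u lam Lam) (hn : 2 ≤ n) (hlam : 0 < lam)
    (hx : x ∈ Ω) : ∃ b : E n → ℝ, Tendsto b (𝓝[≠] x) atTop ∧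
      ∀ᶠ y in 𝓝[≠] x, ContDiffAt ℝ 2 b y ∧ linMA u b y < 0 := by
  obtain ⟨C, hC, hgrad⟩ := h.exists_gradient_bound hlam hx
  obtain ⟨κ, hκ, hlow⟩ := h.exists_excess_lower_bound hlam hx
  set K := C + 1 with hK
  have hexc : ContinuousAt (excess u x) x := (contDiffAt_excess (h.contDiffAt_two hx)).continuousAt
  have hpos : ∀ᶠ y in 𝓝[≠] x, 0 < excess u x y := by
    filter_upwards [hlow.filter_mono nhdsWithin_le_nhds, self_mem_nhdsWithin] with y hy hne
    have h1 : 0 < ‖y - x‖ := norm_pos_iff.2 (sub_ne_zero.2 hne)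
    exact Real.sqrt_pos.1 (lt_of_lt_of_le (by positivity) hy)
  have hlim : Tendsto (excess u x) (𝓝[≠] x) (𝓝[>] 0) := by
    refine tendsto_nhdsWithin_iff.2 ⟨?_, hpos⟩
    have := hexc.tendsto
    rw [excess_self] at this
    exact this.mono_left nhdsWithin_le_nhds
  have hsmall : ∀ᶠ y in 𝓝[≠] x, C * K * √(excess u x y) < 2 := by
    have h1 : Tendsto (fun y => C * K * √(excess u x y)) (𝓝 x) (𝓝 (C * K * √(excess u x x))) :=
      (hexc.tendsto.sqrt).const_mul _
    rw [excess_self, Real.sqrt_zero, mul_zero] at h1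
    exact (h1.eventually_lt_const two_pos).filter_mono nhdsWithin_le_nhds
  refine ⟨fun y => -Real.log (excess u x y) - 2 * K * √(excess u x y), ?_, ?_⟩
  · have h1 : Tendsto (fun s => -Real.log s - 2 * K * √s) (𝓝[>] 0) atTop := by
      have h2 : Tendsto (fun s => 2 * K * √s) (𝓝[>] 0) (𝓝 (2 * K * √0)) :=
        ((Real.continuous_sqrt.tendsto 0).const_mul _).mono_left nhdsWithin_le_nhds
      simp only [sub_eq_add_neg]
      exact (tendsto_neg_atBot_atTop.comp Real.tendsto_log_nhdsGT_zero).atTop_add h2.neg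
    exact h1.comp hlim
  · filter_upwards [hpos, hsmall, hgrad.filter_mono nhdsWithin_le_nhds,
      (h.isOpen.mem_nhds hx : _ ∈ 𝓝 x) |> mem_nhdsWithin_of_mem_nhds] with y hy hys hyg hyΩ
    have huy := h.contDiffAt_two hyΩ
    have hey : ContDiffAt ℝ 2 (excess u x) y := contDiffAt_excess huy
    set F : ℝ → ℝ := fun s => -Real.log s - 2 * K * √s with hF
    have hF2 : ContDiffAt ℝ 2 F (excess u x y) :=
      (Real.contDiffAt_log.2 hy.ne').neg.sub (contDiffAt_const.mul (Real.contDiffAt_sqrt hy.ne'))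
    refine ⟨hF2.comp y hey, ?_⟩
    have hF' : deriv F =ᶠ[𝓝 (excess u x y)] fun s => -s⁻¹ - K * (√s)⁻¹ := by
      filter_upwards [lt_mem_nhds hy] with s hs
      exact (hasDerivAt_neg_log_sub_sqrt K hs).deriv
    change linMA u (fun y => F (excess u x y)) y < 0
    rw [linMA_comp hey hF2, linMA_excess huy, hF'.deriv_eq, hF'.self_of_nhds,
      (hasDerivAt_neg_inv_sub_inv_sqrt K hy).deriv]
    beta_reduce
    set σ := √(excess u x y) with hσ
    have hσ0 : 0 < σ := Real.sqrt_pos.2 hy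
    have hσ2 : excess u x y = σ ^ 2 := (Real.sq_sqrt hy.le).symm
    rw [hσ2] at hyg ⊢
    have hdet : 0 < (Hess u y).det := hlam.trans_le (h.le_det y hyΩ)
    have hn' : (2 : ℝ) ≤ n := by exact_mod_cast hn
    calc _ ≤ (-(σ ^ 2)⁻¹ - K * σ⁻¹) * (2 * (Hess u y).det) +
          (σ⁻¹ ^ 4 + K / 2 * σ⁻¹ ^ 3) * ((Hess u y).det * (2 * σ ^ 2 + C * σ ^ 3)) := by
          refine add_le_add ?_ (mul_le_mul_of_nonneg_left hyg (by positivity))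
          refine mul_le_mul_of_nonpos_left
            (mul_le_mul_of_nonneg_right hn' hdet.le) ?_
          have : 0 ≤ (σ ^ 2)⁻¹ := by positivity
          have : 0 ≤ K * σ⁻¹ := by positivity
          linarith
      _ = (Hess u y).det * σ⁻¹ * ((C - K) + C * K * σ / 2) := by
          field_simp
          ring
      _ < 0 := by
          refine mul_neg_of_pos_of_neg (by positivity) ?_
          rw [hK] at hys ⊢
          linarith

end PoleBarrier

section GreenIntegral

open Matrix Filter Topology Set

variable {n : ℕ} {Ω V : Set (E n)} {lam Lam : ℝ} {u g : E n → ℝ} {x : E n}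

/-- A smooth convex ramp: zero up to `ε / 2`, of slope one from `ε` on. -/
lemma exists_smooth_ramp {ε : ℝ} (hε : 0 < ε) : ∃ f : ℝ → ℝ, ContDiff ℝ (⊤ : ℕ∞) f ∧
    (∀ s ≤ ε / 2, f s = 0) ∧ (∃ c, 0 ≤ c ∧ c ≤ ε ∧ ∀ s, ε ≤ s → f s = s - c) ∧
    (∀ s, 0 ≤ deriv f s) ∧ (∀ s ≤ ε / 2, deriv f s = 0) ∧ (∀ s, ε ≤ s → deriv f s = 1) ∧
    (∀ s, 0 ≤ deriv (deriv f) s) ∧ (∀ s < ε / 2, deriv (deriv f) s = 0) ∧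
    ∀ s, ε < s → deriv (deriv f) s = 0 := by
  set T : ℝ → ℝ := fun s => Real.smoothTransition (2 * s / ε - 1) with hT
  have hTs : ContDiff ℝ (⊤ : ℕ∞) T := Real.smoothTransition.contDiff.comp (by fun_prop)
  have hT0 : ∀ s ≤ ε / 2, T s = 0 := fun s hs => by
    refine Real.smoothTransition.zero_of_nonpos ?_
    rw [sub_nonpos, div_le_one hε]
    linarith
  have hT1 : ∀ s, ε ≤ s → T s = 1 := fun s hs => by
    refine Real.smoothTransition.one_of_one_le ?_
    rw [le_sub_iff_add_le, le_div_iff₀ hε]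
    linarith
  have hTn : ∀ s, 0 ≤ T s := fun s => Real.smoothTransition.nonneg _
  have hTl : ∀ s, T s ≤ 1 := fun s => Real.smoothTransition.le_one _
  have hTm : Monotone T := fun a b hab => Real.smoothTransition.monotone (by gcongr)
  have hTi : ∀ a b, IntervalIntegrable T volume a b := fun a b =>
    hTs.continuous.intervalIntegrable a b
  have hd : deriv (fun s => ∫ τ in (0 : ℝ)..s, T τ) = T :=
    funext fun s => hTs.continuous.deriv_integral T 0 s
  refine ⟨fun s => ∫ τ in (0 : ℝ)..s, T τ, ?_, ?_, ⟨ε - ∫ τ in (0 : ℝ)..ε, T τ, ?_, ?_, ?_⟩,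
    ?_⟩
  · rw [contDiff_infty_iff_deriv, hd]
    exact ⟨fun s => (hTs.continuous.integral_hasStrictDerivAt 0 s).hasDerivAt.differentiableAt, hTs⟩
  · intro s hs
    have : ∫ τ in (0 : ℝ)..s, T τ = ∫ τ in (0 : ℝ)..s, (0 : ℝ) := by
      refine intervalIntegral.integral_congr fun τ hτ => hT0 τ ?_
      rcases le_total 0 s with h | h
      · rw [uIcc_of_le h] at hτ
        exact hτ.2.trans hs
      · rw [uIcc_of_ge h] at hτ
        exact hτ.2.trans (by positivity)
    simpa using this
  · have := intervalIntegral.integral_mono hε.le (hTi 0 ε) (intervalIntegrable_const (c := (1 : ℝ))) hTl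
    simp at this
    linarith
  · linarith [intervalIntegral.integral_nonneg (μ := volume) hε.le fun τ _ => hTn τ]
  · intro s hs
    have h1 : ∫ τ in ε..s, T τ = ∫ τ in ε..s, (1 : ℝ) := by
      refine intervalIntegral.integral_congr fun τ hτ => hT1 τ ?_
      rw [uIcc_of_le hs] at hτ
      exact hτ.1
    change ∫ τ in (0 : ℝ)..s, T τ = _
    rw [← intervalIntegral.integral_add_adjacent_intervals (hTi 0 ε) (hTi ε s), h1]
    simp
    ring
  · rw [hd]
    refine ⟨hTn, hT0, hT1, fun s => hTm.deriv_nonneg, fun s hs => ?_, fun s hs => ?_⟩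
    · have : T =ᶠ[𝓝 s] fun _ => 0 := by
        filter_upwards [gt_mem_nhds hs] with τ hτ using hT0 τ hτ.le
      rw [this.deriv_eq, deriv_const]
    · have : T =ᶠ[𝓝 s] fun _ => 1 := by
        filter_upwards [lt_mem_nhds hs] with τ hτ using hT1 τ hτ.le
      rw [this.deriv_eq, deriv_const]

/-- A local minimum of a `C²` function is a point where the linearized operator is nonnegative. -/
lemma IsMASolution.linMA_nonneg_of_isLocalMin (h : IsMASolution Ω u lam Lam) (hlam : 0 < lam)
    {w : E n → ℝ} {z : E n} (hz : z ∈ Ω) (hw : ContDiffAt ℝ 2 w z) (hmin : IsLocalMin w z) :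
    0 ≤ linMA u w z := by
  rw [linMA_eq_sum_Hess]
  exact adjugate_sum_nonneg (h.posDef hlam hz) (hmin.Hess_posSemidef hw)

/-- Positive supersolutions in a punctured neighborhood are bounded away from zero. -/
lemma IsMASolution.exists_pos_le_near (h : IsMASolution Ω u lam Lam) (hn : 2 ≤ n) (hlam : 0 < lam)
    (hV : IsOpen V) (hVΩ : V ⊆ Ω) (hx : x ∈ V) (hpos : ∀ y ∈ V \ {x}, 0 < g y)
    (hg : ∀ y ∈ V \ {x}, ContDiffAt ℝ 2 g y) (hL : ∀ y ∈ V \ {x}, linMA u g y ≤ 0) :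
    ∃ m : ℝ, 0 < m ∧ ∀ᶠ y in 𝓝[≠] x, m ≤ g y := by
  obtain ⟨b, hb, hbL⟩ := h.exists_barrier hn hlam (hVΩ hx)
  obtain ⟨ρ', hρ', hball⟩ := Metric.eventually_nhds_iff_ball.1
    ((eventually_nhdsWithin_iff.1 hbL).and (hV.mem_nhds hx))
  set ρ := ρ' / 2 with hρd
  have hρ : 0 < ρ := by positivity
  have hin : ∀ y, ‖y - x‖ ≤ ρ → 0 < ‖y - x‖ →
      y ∈ V \ {x} ∧ ContDiffAt ℝ 2 b y ∧ linMA u b y < 0 := by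
    intro y hy hy0
    have hyx : y ≠ x := sub_ne_zero.1 (norm_pos_iff.1 hy0)
    have := hball y (mem_ball_iff_norm.2 (by linarith))
    exact ⟨⟨this.2, hyx⟩, this.1 hyx⟩
  have hinS : ∀ y ∈ Metric.sphere x ρ, y ∈ V \ {x} ∧ ContDiffAt ℝ 2 b y ∧ linMA u b y < 0 := by
    intro y hy
    rw [mem_sphere_iff_norm] at hy
    exact hin y hy.le (by rw [hy]; exact hρ)
  obtain ⟨m, hm, hmS⟩ := (isCompact_sphere x ρ).exists_forall_le' (f := g)
    (fun y hy => (hg y (hinS y hy).1).continuousAt.continuousWithinAt) (a := 0)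
    fun y hy => hpos y (hinS y hy).1
  obtain ⟨B, hB⟩ := (isCompact_sphere x ρ).bddBelow_image (f := b)
    fun y hy => (hinS y hy).2.1.continuousAt.continuousWithinAt
  refine ⟨m, hm, ?_⟩
  rw [eventually_nhdsWithin_iff]
  filter_upwards [Metric.ball_mem_nhds x hρ] with y hyρ hyx
  rw [mem_ball_iff_norm] at hyρ
  have hy0 : 0 < ‖y - x‖ := norm_pos_iff.2 (sub_ne_zero.2 hyx)
  have key : ∀ ε : ℝ, 0 < ε → m ≤ g y + ε * (b y - B) := by
    intro ε hε
    obtain ⟨σ, hσ, hσb⟩ := Metric.eventually_nhds_iff_ball.1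
      (eventually_nhdsWithin_iff.1 (hb.eventually_ge_atTop (B + m / ε)))
    set τ := min (σ / 2) ‖y - x‖ with hτ
    have hτ0 : 0 < τ := lt_min (by positivity) hy0
    set A := Metric.closedBall x ρ \ Metric.ball x τ with hA
    have hAc : IsCompact A := (isCompact_closedBall x ρ).diff Metric.isOpen_ball
    have hAin : ∀ z ∈ A, ‖z - x‖ ≤ ρ ∧ τ ≤ ‖z - x‖ := by
      intro z hz
      rw [hA, Set.mem_sdiff, mem_closedBall_iff_norm, mem_ball_iff_norm, not_lt] at hz
      exact hz
    have hAin' : ∀ z ∈ A, z ∈ V \ {x} ∧ ContDiffAt ℝ 2 b z ∧ linMA u b z < 0 := fun z hz =>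
      hin z (hAin z hz).1 (hτ0.trans_le (hAin z hz).2)
    have hyA : y ∈ A := by
      rw [hA, Set.mem_sdiff, mem_closedBall_iff_norm, mem_ball_iff_norm, not_lt]
      exact ⟨hyρ.le, min_le_right _ _⟩
    set w : E n → ℝ := fun z => g z + ε * (b z + -B) with hw
    have hwc : ∀ z ∈ A, ContDiffAt ℝ 2 w z := fun z hz =>
      (hg z (hAin' z hz).1).add (contDiffAt_const.mul ((hAin' z hz).2.1.add contDiffAt_const))
    obtain ⟨z, hz, hzmin⟩ := hAc.exists_isMinOn ⟨y, hyA⟩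
      fun z hz => (hwc z hz).continuousAt.continuousWithinAt
    have hwy : w z ≤ w y := hzmin hyA
    by_contra! hlt
    have hwz : w z < m := by
      rw [hw] at hwy ⊢
      beta_reduce at hwy ⊢
      linarith
    have hz1 : ‖z - x‖ < ρ := by
      refine lt_of_le_of_ne (hAin z hz).1 fun heq => ?_
      have hzS : z ∈ Metric.sphere x ρ := mem_sphere_iff_norm.2 heq
      have h1 := hmS z hzS
      have h2 : 0 ≤ ε * (b z + -B) :=
        mul_nonneg hε.le (by linarith [hB (mem_image_of_mem b hzS)])
      rw [hw] at hwz
      beta_reduce at hwz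
      linarith
    have hz2 : τ < ‖z - x‖ := by
      refine lt_of_lt_of_le (lt_of_le_of_lt (min_le_left _ _) (by linarith : σ / 2 < σ)) ?_
      by_contra! hzσ
      have h1 := hσb z (mem_ball_iff_norm.2 hzσ) (hAin' z hz).1.2
      have h2 : m ≤ ε * (b z + -B) := by
        calc m = ε * (m / ε) := by field_simp
          _ ≤ _ := mul_le_mul_of_nonneg_left (by linarith) hε.le
      have h3 := hpos z (hAin' z hz).1
      rw [hw] at hwz
      beta_reduce at hwz
      linarith
    have hAz : A ∈ 𝓝 z := by
      have h1 : Continuous fun z : E n => ‖z - x‖ := by fun_prop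
      filter_upwards [h1.continuousAt.eventually_lt_const hz1,
        h1.continuousAt.eventually_const_lt hz2] with z' h2 h3
      rw [hA, Set.mem_sdiff, mem_closedBall_iff_norm, mem_ball_iff_norm, not_lt]
      exact ⟨h2.le, h3.le⟩
    have hbz := (hAin' z hz).2
    have h1 := h.linMA_nonneg_of_isLocalMin hlam (hVΩ (hAin' z hz).1.1) (hwc z hz)
      (hzmin.isLocalMin hAz)
    rw [hw, linMA_add (hg z (hAin' z hz).1)
      (contDiffAt_const.mul (hbz.1.add contDiffAt_const)), linMA_const_mul
      (hbz.1.add contDiffAt_const), linMA_add hbz.1 contDiffAt_const, linMA_const] at h1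
    have h2 := hL z (hAin' z hz).1
    have h3 := mul_neg_of_pos_of_neg hε hbz.2
    linarith
  refine le_of_forall_pos_le_add fun δ hδ => (key (δ / (|b y - B| + 1)) (by positivity)).trans ?_
  have : δ / (|b y - B| + 1) * (b y - B) ≤ δ := by
    rw [div_mul_eq_mul_div, div_le_iff₀ (by positivity)]
    exact mul_le_mul_of_nonneg_left ((le_abs_self _).trans (by linarith)) hδ.le
  linarith

end GreenIntegral

section GreenVolume

open Matrix Filter Topology Set

variable {n : ℕ} {Ω V : Set (E n)} {lam Lam : ℝ} {u g : E n → ℝ} {x : E n}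

lemma IsMASolution.neg (h : IsMASolution Ω u lam Lam) (hn : n ≠ 0) (hlam : 0 < lam)
    (hx : x ∈ Ω) : u x < 0 := by
  obtain ⟨d, hd, hball⟩ := Metric.isOpen_iff.1 h.isOpen x hx
  obtain ⟨c, hc, hdepth⟩ := exists_depth (Lam := Lam) hn hlam hd
  linarith [hdepth Ω u h x hball]

lemma integrableOn_linMA (hu : ∀ y ∈ Ω, ContDiffAt ℝ 3 u y) (hVΩ : V ⊆ Ω) {φ : E n → ℝ}
    (hφ : ContDiff ℝ 3 φ) (hc : HasCompactSupport φ) (hφV : tsupport φ ⊆ V) :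
    IntegrableOn (linMA u φ) V := by
  have hzero : ∀ y, y ∉ tsupport φ → linMA u φ y = 0 := by
    intro y hy
    rw [linMA_congr (g := fun _ => (0 : ℝ)) (notMem_tsupport_iff_eventuallyEq.1 hy), linMA_const]
  have hcont : ContinuousOn (linMA u φ) (tsupport φ) := by
    intro y hy
    refine ContinuousAt.continuousWithinAt ?_
    unfold linMA
    refine tendsto_finsetSum _ fun i _ => tendsto_finsetSum _ fun j _ => ?_
    refine ((hu y (hVΩ (hφV hy))).contDiffAt_cofU i j).continuousAt.mul
      (hφ.contDiffAt.contDiffAt_pd2 i j).continuousAt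
  have h1 : IntegrableOn (linMA u φ) (tsupport φ) := hcont.integrableOn_compact hc.isCompact
  have h2 : Function.support (linMA u φ) ⊆ tsupport φ := fun y hy => by
    by_contra hcon
    exact hy (hzero y hcon)
  exact ((integrableOn_iff_integrable_of_support_subset h2).1 h1).integrableOn

/-- A test function for the Green identity, built from the Green's function itself. -/
lemma IsMASolution.exists_test_function (h : IsMASolution Ω u lam Lam) (hn : 2 ≤ n)
    (hlam : 0 < lam) (hV : IsOpen V) (hVc : IsCompact (closure V)) (hVΩ : closure V ⊆ Ω)
    (hx : x ∈ V) {M : ℝ} (hM : ∀ y ∈ closure V, -M ≤ u y) (hpos : ∀ y ∈ V \ {x}, 0 < g y)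
    (hg : ∀ y ∈ V \ {x}, ContDiffAt ℝ (⊤ : ℕ∞) g y) (hL : ∀ y ∈ V \ {x}, linMA u g y = 0)
    (hgc : ContinuousOn g (closure V \ {x})) (hg0 : ∀ y ∈ frontier V, g y = 0)
    {G : ℝ} (hG : 0 < G) :
    ∃ (φ : E n → ℝ) (ε : ℝ), ContDiff ℝ (⊤ : ℕ∞) φ ∧ HasCompactSupport φ ∧ tsupport φ ⊆ V ∧
      φ x < 0 ∧ -(M + 1) ≤ φ x ∧ ε ≤ G / 2 ∧
      (∀ y ∈ V \ {x}, 0 ≤ (g y - ε) * linMA u φ y) ∧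
      ∀ y ∈ V \ {x}, G ≤ g y → n * lam ≤ linMA u φ y := by
  classical
  have hVΩ' : V ⊆ Ω := subset_closure.trans hVΩ
  have htop : ((2 : ℕ∞) : WithTop ℕ∞) ≤ ((⊤ : ℕ∞) : WithTop ℕ∞) := WithTop.coe_le_coe.2 le_top
  have hg2 : ∀ y ∈ V \ {x}, ContDiffAt ℝ 2 g y := fun y hy => (hg y hy).of_le htop
  obtain ⟨m, hm, hnear⟩ := h.exists_pos_le_near hn hlam hV hVΩ' hx hpos hg2
    fun y hy => (hL y hy).le
  obtain ⟨a, ha, hau⟩ := hVc.exists_forall_le' (f := fun y => -u y)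
    (fun y hy => ((h.contDiffAt_two (hVΩ hy)).continuousAt.neg).continuousWithinAt) (a := 0)
    fun y hy => neg_pos.2 (h.neg (by lia) hlam (hVΩ hy))
  have hM0 : 0 < M := by linarith [hM x (subset_closure hx), hau x (subset_closure hx)]
  set μ := min G m with hμ
  have hμ0 : 0 < μ := lt_min hG hm
  set k := (M + 1) / μ with hk
  have hk0 : 0 < k := by positivity
  have hkμ : k * μ = M + 1 := by rw [hk]; field_simp
  have hkbig : ∀ y ∈ closure V, ∀ s, μ ≤ s → 1 ≤ u y + k * s := by
    intro y hy s hs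
    linarith [hM y hy, mul_le_mul_of_nonneg_left hs hk0.le]
  set ε := min (μ / 2) (a / (2 * k)) with hε
  have hε0 : 0 < ε := by positivity
  have hεμ : ε ≤ μ / 2 := min_le_left _ _
  have hkε : k * ε ≤ a / 2 := by
    calc k * ε ≤ k * (a / (2 * k)) := mul_le_mul_of_nonneg_left (min_le_right _ _) hk0.le
      _ = a / 2 := by field_simp
  have hsmall : ∀ y ∈ closure V, ∀ s ≤ ε, u y + k * s < 0 := by
    intro y hy s hs
    linarith [hau y hy, mul_le_mul_of_nonneg_left hs hk0.le]
  obtain ⟨f, hf, hf0, ⟨c', hc'0, hc'ε, hfc⟩, -, -, -, hf2, -, hf20⟩ := exists_smooth_ramp hε0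
  obtain ⟨H, hH, hH0, ⟨c, hc0, hc1, hHc⟩, hH1, hH10, hH11, hH2, hH20, -⟩ :=
    exists_smooth_ramp one_pos
  set ψ : E n → ℝ := fun y => -k * f (g y) + H (u y + k * g y) with hψ
  set φ : E n → ℝ := fun y => if y = x then u x + (k * c' - c) else if y ∈ V then ψ y else 0
    with hφ
  have hopen : IsOpen (V \ {x}) := hV.sdiff isClosed_singleton
  have hφψ : ∀ y ∈ V \ {x}, φ =ᶠ[𝓝 y] ψ := by
    intro y hy
    filter_upwards [hopen.mem_nhds hy] with z hz
    rw [hφ]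
    beta_reduce
    rw [if_neg (show z ≠ x from hz.2), if_pos hz.1]
  have hφx : φ =ᶠ[𝓝 x] fun y => u y + (k * c' - c) := by
    filter_upwards [eventually_nhdsWithin_iff.1 hnear, hV.mem_nhds hx] with y hy hyV
    rw [hφ]
    beta_reduce
    by_cases hyx : y = x
    · rw [if_pos hyx, hyx]
    · have h1 : μ ≤ g y := (min_le_right _ _).trans (hy hyx)
      rw [if_neg hyx, if_pos hyV, hψ]
      beta_reduce
      rw [hfc _ (by linarith), hHc _ (hkbig y (subset_closure hyV) _ h1)]
      ring
  set K : Set (E n) := {y | y = x ∨ (y ∈ closure V ∧ ε / 2 ≤ g y)} with hK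
  have hKclosed : IsClosed K := by
    rw [← isOpen_compl_iff, isOpen_iff_mem_nhds]
    intro y hy
    have hyx : y ≠ x := fun h0 => hy (Or.inl h0)
    by_cases hyV : y ∈ closure V
    · have hlt : g y < ε / 2 := by
        by_contra! hcon
        exact hy (Or.inr ⟨hyV, hcon⟩)
      have h1 := eventually_nhdsWithin_iff.1 ((hgc y ⟨hyV, hyx⟩).eventually_lt_const hlt)
      filter_upwards [h1, isOpen_ne.mem_nhds hyx] with z hz hzx
      rintro (h0 | h0)
      · exact hzx h0
      · exact absurd (hz ⟨h0.1, hzx⟩) (not_lt.2 h0.2)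
    · filter_upwards [isOpen_ne.mem_nhds hyx, isClosed_closure.isOpen_compl.mem_nhds hyV]
        with z hzx hzV
      rintro (h0 | h0)
      · exact hzx h0
      · exact hzV h0.1
  have hKV : K ⊆ V := by
    rintro y (rfl | ⟨hy, hyg⟩)
    · exact hx
    · by_contra hyV
      rw [hg0 y (by rw [hV.frontier_eq]; exact ⟨hy, hyV⟩)] at hyg
      linarith
  have hKc : IsCompact K := hVc.of_isClosed_subset hKclosed (hKV.trans subset_closure)
  have hzero : ∀ y, y ∉ K → φ y = 0 := by
    intro y hy
    have hyx : y ≠ x := fun h0 => hy (Or.inl h0)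
    rw [hφ]
    beta_reduce
    rw [if_neg hyx]
    split_ifs with hyV
    · have hlt : g y < ε / 2 := by
        by_contra! hcon
        exact hy (Or.inr ⟨subset_closure hyV, hcon⟩)
      rw [hψ]
      beta_reduce
      rw [hf0 _ hlt.le, hH0 _ ((hsmall y (subset_closure hyV) _ (by linarith)).le.trans
        (by norm_num))]
      ring
    · rfl
  have hsupp : tsupport φ ⊆ K := closure_minimal
    (fun y hy => by by_contra hcon; exact hy (hzero y hcon)) hKclosed
  have hφs : ContDiff ℝ (⊤ : ℕ∞) φ := by
    rw [contDiff_iff_contDiffAt]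
    intro y
    by_cases hyK : y ∈ K
    · by_cases hyx : y = x
      · rw [hyx]
        exact ((h.contDiffAt x (hVΩ' hx)).add contDiffAt_const).congr_of_eventuallyEq hφx
      · have hy : y ∈ V \ {x} := ⟨hKV hyK, hyx⟩
        refine ContDiffAt.congr_of_eventuallyEq ?_ (hφψ y hy)
        exact (contDiffAt_const.mul (hf.contDiffAt.comp y (hg y hy))).add
          (hH.contDiffAt.comp y ((h.contDiffAt y (hVΩ' hy.1)).add
            (contDiffAt_const.mul (hg y hy))))
    · have h1 : φ =ᶠ[𝓝 y] fun _ => 0 := by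
        filter_upwards [hKclosed.isOpen_compl.mem_nhds hyK] with z hz using hzero z hz
      exact contDiffAt_const.congr_of_eventuallyEq h1
  have hform : ∀ y ∈ V \ {x}, ∃ Q₁ Q₂ : ℝ, 0 ≤ Q₁ ∧ 0 ≤ Q₂ ∧
      linMA u φ y = -k * (deriv (deriv f) (g y) * Q₁) +
        (deriv H (u y + k * g y) * (n * (Hess u y).det) +
          deriv (deriv H) (u y + k * g y) * Q₂) := by
    intro y hy
    have hy2 := hg2 y hy
    have huy := h.contDiffAt_two (hVΩ' hy.1)
    have hkg : ContDiffAt ℝ 2 (fun z => k * g z) y := contDiffAt_const.mul hy2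
    have hw : ContDiffAt ℝ 2 (fun z => u z + k * g z) y := huy.add hkg
    have hf2' : ContDiffAt ℝ 2 f (g y) := hf.contDiffAt.of_le htop
    have hH2' : ContDiffAt ℝ 2 H (u y + k * g y) := hH.contDiffAt.of_le htop
    have hfg : ContDiffAt ℝ 2 (fun z => f (g z)) y := hf2'.comp y hy2
    have hHw : ContDiffAt ℝ 2 (fun z => H (u z + k * g z)) y :=
      ContDiffAt.comp (g := H) y hH2' hw
    have hpd := h.posDef hlam (hVΩ' hy.1)
    refine ⟨_, _, adjugate_sum_vec_nonneg hpd (pd g y),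
      adjugate_sum_vec_nonneg hpd (pd (fun z => u z + k * g z) y), ?_⟩
    rw [linMA_congr (hφψ y hy), hψ, linMA_add (contDiffAt_const.mul hfg) hHw,
      linMA_const_mul hfg, linMA_comp hy2 hf2',
      linMA_comp hw hH2', linMA_add huy hkg, linMA_const_mul hy2, hL y hy, linMA_self huy]
    simp only [mul_zero, add_zero, zero_add]
    rfl
  have hn0 : (0 : ℝ) ≤ n := Nat.cast_nonneg n
  refine ⟨φ, ε, hφs, hKc.of_isClosed_subset (isClosed_tsupport φ) hsupp, hsupp.trans hKV, ?_, ?_, ?_,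
    fun y hy => ?_, fun y hy hGy => ?_⟩
  · rw [hφx.self_of_nhds]
    have h1 : k * c' ≤ k * ε := mul_le_mul_of_nonneg_left hc'ε hk0.le
    linarith [hau x (subset_closure hx)]
  · rw [hφx.self_of_nhds]
    have h1 : 0 ≤ k * c' := by positivity
    linarith [hM x (subset_closure hx)]
  · exact hεμ.trans (by linarith [min_le_left G m])
  · obtain ⟨Q₁, Q₂, hQ₁, hQ₂, hform⟩ := hform y hy
    have hyc := subset_closure hy.1
    have hdet := h.le_det y (hVΩ' hy.1)
    rcases le_or_gt (g y) ε with hle | hlt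
    · have hneg := hsmall y hyc _ hle
      rw [hform, hH10 _ (by linarith), hH20 _ (by linarith)]
      refine mul_nonneg_of_nonpos_of_nonpos (by linarith) ?_
      have := mul_nonneg hk0.le (mul_nonneg (hf2 (g y)) hQ₁)
      linarith
    · rw [hform, hf20 _ hlt]
      refine mul_nonneg (by linarith) ?_
      have h1 := mul_nonneg (hH1 (u y + k * g y)) (mul_nonneg hn0 (hlam.le.trans hdet))
      have h2 := mul_nonneg (hH2 (u y + k * g y)) hQ₂
      linarith
  · obtain ⟨Q₁, Q₂, hQ₁, hQ₂, hform⟩ := hform y hy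
    have hμg : μ ≤ g y := (min_le_left _ _).trans hGy
    rw [hform, hf20 _ (by linarith), hH11 _ (hkbig y (subset_closure hy.1) _ hμg)]
    have h1 := mul_nonneg (hH2 (u y + k * g y)) hQ₂
    have h2 := mul_le_mul_of_nonneg_left (h.le_det y (hVΩ' hy.1)) hn0
    linarith

/-- Weak-type bound for the Green's function. -/
lemma IsMASolution.volume_superlevel_le (h : IsMASolution Ω u lam Lam) (hn : 2 ≤ n)
    (hlam : 0 < lam) (hV : IsOpen V) (hVc : IsCompact (closure V)) (hVΩ : closure V ⊆ Ω)
    (hx : x ∈ V) {M : ℝ} (hM : ∀ y ∈ closure V, -M ≤ u y) (hg : IsGreen u V x g)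
    {G : ℝ} (hG : 0 < G) {A : Set (E n)} (hA : MeasurableSet A) (hAV : A ⊆ V \ {x})
    (hAG : ∀ y ∈ A, G ≤ g y) : G / 2 * (n * lam) * volume.real A ≤ M + 1 := by
  obtain ⟨hpos, hgs, hL, hgc, hg0, hinteg⟩ := hg
  have hopen : IsOpen (V \ {x}) := hV.sdiff isClosed_singleton
  obtain ⟨φ, ε, hφ, hφc, hφV, hφx, hφx', hε, hnn, hlow⟩ := h.exists_test_function hn hlam hV hVc
    hVΩ hx hM hpos (fun y hy => hgs.contDiffAt (hopen.mem_nhds hy)) hL hgc hg0 hG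
  have h3 : ((3 : ℕ∞) : WithTop ℕ∞) ≤ ((⊤ : ℕ∞) : WithTop ℕ∞) := WithTop.coe_le_coe.2 le_top
  have hu3 : ∀ y ∈ Ω, ContDiffAt ℝ 3 u y := fun y hy => (h.contDiffAt y hy).of_le h3
  have hVΩ' : V ⊆ Ω := subset_closure.trans hVΩ
  have hφ3 : ContDiff ℝ 3 φ := hφ.of_le h3
  have hI1 : ∫ y in V, g y * linMA u φ y = -φ x := hinteg φ hφ hφc hφV
  have hI0 : ∫ y in V, linMA u φ y = 0 :=
    integral_linMA_eq_zero hu3 hVΩ' (hφ3.of_le (by norm_num)) hφc hφV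
  have hi0 : IntegrableOn (linMA u φ) V := integrableOn_linMA hu3 hVΩ' hφ3 hφc hφV
  have hi1 : IntegrableOn (fun y => g y * linMA u φ y) V := by
    by_contra hcon
    rw [integral_undef hcon] at hI1
    linarith
  have hi : IntegrableOn (fun y => (g y - ε) * linMA u φ y) V := by
    simp only [sub_mul]
    exact hi1.sub (hi0.const_mul ε)
  have hI : ∫ y in V, (g y - ε) * linMA u φ y = -φ x := by
    simp only [sub_mul]
    rw [integral_sub hi1 (hi0.const_mul ε), integral_const_mul, hI0, hI1]
    ring
  have : Nontrivial (Fin n) := Fin.nontrivial_iff_two_le.2 hn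
  have hae : ∀ᵐ y ∂volume.restrict V, 0 ≤ (g y - ε) * linMA u φ y := by
    rw [ae_restrict_iff' hV.measurableSet]
    filter_upwards [compl_mem_ae_iff.2 (measure_singleton (μ := (volume : Measure (E n))) x)]
      with y hyx hyV using hnn y ⟨hyV, hyx⟩
  have hAfin : volume A ≠ ⊤ :=
    ((measure_mono (hAV.trans (sdiff_subset.trans subset_closure))).trans_lt
      hVc.measure_lt_top).ne
  calc G / 2 * (n * lam) * volume.real A = ∫ _ in A, G / 2 * (n * lam) := by
        rw [setIntegral_const, smul_eq_mul, mul_comm]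
    _ ≤ ∫ y in A, (g y - ε) * linMA u φ y := by
        refine setIntegral_mono_on (integrableOn_const hAfin)
          (hi.mono_set (hAV.trans sdiff_subset)) hA fun y hy => ?_
        have h1 := hAG y hy
        exact mul_le_mul (by linarith) (hlow y (hAV hy) h1) (by positivity) (by linarith)
    _ ≤ ∫ y in V, (g y - ε) * linMA u φ y :=
        setIntegral_mono_set hi hae (hAV.trans sdiff_subset).eventuallyLE
    _ ≤ M + 1 := by rw [hI]; linarith

end GreenVolume

section GreenBound

open Matrix Filter Topology Set

variable {n : ℕ} {Ω V : Set (E n)} {lam Lam : ℝ} {u g : E n → ℝ} {x : E n}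

lemma mem_MASection_iff {t : ℝ} {y : E n} :
    y ∈ MASection Ω u x t ↔ y ∈ closure Ω ∧ excess u x y < t := by
  rw [excess, sub_lt_iff_lt_add']
  rfl

lemma IsMASolution.isOpen_MASection (h : IsMASolution Ω u lam Lam) {t : ℝ}
    (ht : ∀ z ∈ frontier Ω, t ≤ excess u x z) :
    MASection Ω u x t ⊆ Ω ∧ IsOpen (MASection Ω u x t) ∧
      ∀ y ∈ frontier (MASection Ω u x t), excess u x y = t := by
  have h1 : MASection Ω u x t =
      {y ∈ closure Ω | u y < fderiv ℝ u x y + (u x - fderiv ℝ u x x + t)} := by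
    ext y
    rw [mem_MASection_iff, excess_eq]
    refine and_congr_right fun _ => ?_
    rw [sub_lt_iff_lt_add, ← sub_pos, ← sub_pos (b := u y)]
    ring_nf
  obtain ⟨h2, h3, -, -, h4, -⟩ := h.sublevel (p := fderiv ℝ u x)
    (a := u x - fderiv ℝ u x x + t) (fun y hy => by
      have := ht y hy
      rw [excess_eq, h.eq_zero y hy] at this
      linarith) h1
  refine ⟨h2, h3, fun y hy => ?_⟩
  rw [excess_eq, h4 y hy]
  ring

/-- A weak-type bound for solutions of the linearized equation implies a pointwise bound. -/
lemma exists_pointwise_bound (hn : n ≠ 0) (hΩ : Bornology.IsBounded Ω) (hlam : 0 < lam)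
    (hLam : 0 < Lam) {D : ℝ} (hD0 : 0 < D) (hD : ∀ x ∈ closure Ω, ∀ y ∈ closure Ω, ‖y - x‖ ≤ D)
    {d ρ : ℝ} (hd : 0 < d) (hρ : 0 < ρ) (hρD : ρ ≤ D) (W : ℝ) :
    ∃ C : ℝ, 0 < C ∧ ∀ u, IsMASolution Ω u lam Lam → ∀ x₁,
      (∀ y ∈ Metric.closedBall x₁ ρ, Metric.ball y d ⊆ Ω) → ∀ g : E n → ℝ,
      (∀ y ∈ Metric.closedBall x₁ ρ, 0 < g y ∧ ContDiffAt ℝ 2 g y ∧ linMA u g y = 0) →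
      (∀ G, 0 < G → G * volume.real {y ∈ Metric.closedBall x₁ ρ | G ≤ g y} ≤ W) → g x₁ ≤ C := by
  obtain ⟨c, hc, β, hsec⟩ := exists_section_subset_ball hn hΩ hlam hLam.le hD0 hD hd
  obtain ⟨κ, hκ, hvol⟩ := exists_pow_le_volume_sq (n := n) hlam hLam
  set γ := β * n + 1 with hγ
  set θ : ℝ := 1 / (2 * (γ + 1)) with hθ
  have hθ0 : 0 < θ := by positivity
  have hθ1 : θ * (2 * (γ + 1)) = 1 := by rw [hθ]; field_simp
  have hγ0 : (0 : ℝ) ≤ γ := Nat.cast_nonneg γ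
  have hθγ : γ * θ ≤ 1 / 2 := by linarith
  have hθle : θ ≤ 1 / 2 := by linarith [mul_nonneg hθ0.le hγ0]
  have hbern : 1 / 2 ≤ (1 - θ) ^ γ := by
    have := one_add_mul_le_pow (a := -θ) (by linarith) γ
    rw [← sub_eq_add_neg] at this
    linarith
  set P := κ * (c ^ n * θ ^ (β * n)) with hP
  have hP0 : 0 < P := by positivity
  set Z := 4 * W ^ 2 * ρ / (P * ρ ^ γ) with hZ
  refine ⟨√Z + 1, by positivity, fun u h x₁ hball g hg hW => ?_⟩
  suffices hmain : g x₁ ^ 2 ≤ Z by linarith [Real.le_sqrt_of_sq_le hmain]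
  have hx₁ : x₁ ∈ Metric.closedBall x₁ ρ := Metric.mem_closedBall_self hρ.le
  have hgc : ContinuousOn g (Metric.closedBall x₁ ρ) := fun y hy =>
    (hg y hy).2.1.continuousAt.continuousWithinAt
  obtain ⟨z, hz, hmax⟩ := (isCompact_closedBall x₁ ρ).exists_isMaxOn ⟨x₁, hx₁⟩
    (f := fun y => g y ^ 2 * (ρ - ‖y - x₁‖) ^ γ) ((hgc.pow 2).mul (by fun_prop))
  have hmax' : ∀ y ∈ Metric.closedBall x₁ ρ,
      g y ^ 2 * (ρ - ‖y - x₁‖) ^ γ ≤ g z ^ 2 * (ρ - ‖z - x₁‖) ^ γ := fun y hy => hmax hy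
  set δ := ρ - ‖z - x₁‖ with hδ
  have hmax₁ : g x₁ ^ 2 * ρ ^ γ ≤ g z ^ 2 * δ ^ γ := by simpa using hmax' x₁ hx₁
  have hδ' : 0 ≤ δ := sub_nonneg.2 (mem_closedBall_iff_norm.1 hz)
  have hδρ : δ ≤ ρ := by linarith [norm_nonneg (z - x₁)]
  have hgx₁ := (hg x₁ hx₁).1
  have hδ0 : 0 < δ := by
    refine lt_of_le_of_ne hδ' fun h0 => ?_
    rw [← h0, zero_pow (by lia), mul_zero] at hmax₁
    have : 0 < g x₁ ^ 2 * ρ ^ γ := by positivity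
    linarith
  have hgz := (hg z hz).1
  set s := θ * δ with hs
  have hs0 : 0 < s := by positivity
  have hsδ : s ≤ δ / 2 := by linarith [mul_le_mul_of_nonneg_right hθle hδ0.le]
  have hsub : Metric.closedBall z s ⊆ Metric.closedBall x₁ ρ := by
    refine Metric.closedBall_subset_closedBall' ?_
    rw [dist_eq_norm]
    linarith
  have hgle : ∀ y ∈ Metric.closedBall z s, g y ≤ 3 / 2 * g z := by
    intro y hy
    have hy' := hsub hy
    have hgy := (hg y hy').1
    rw [mem_closedBall_iff_norm] at hy
    have h1 : (1 - θ) * δ ≤ ρ - ‖y - x₁‖ := by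
      have := norm_sub_le_norm_sub_add_norm_sub y z x₁
      linarith
    have h2 : g y ^ 2 * ((1 - θ) * δ) ^ γ ≤ g z ^ 2 * δ ^ γ :=
      (mul_le_mul_of_nonneg_left (pow_le_pow_left₀
        (mul_nonneg (by linarith) hδ0.le) h1 γ) (sq_nonneg _)).trans (hmax' y hy')
    rw [mul_pow, ← mul_assoc] at h2
    have h3 := le_of_mul_le_mul_right h2 (pow_pos hδ0 γ)
    have h4 := mul_le_mul_of_nonneg_left hbern (sq_nonneg (g y))
    refine (pow_le_pow_iff_left₀ hgy.le (by positivity) two_ne_zero).1 ?_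
    linarith [sq_nonneg (g z)]
  obtain ⟨hsecb, hfr⟩ := hsec u h z (hball z hz) s hs0 (by linarith)
  set t := c * s ^ β with ht
  have ht0 : 0 < t := by positivity
  have hSsub : MASection Ω u z t ⊆ Metric.closedBall z s := fun y hy =>
    mem_closedBall_iff_norm.2 (hsecb y (mem_MASection_iff.1 hy).1 (mem_MASection_iff.1 hy).2)
  have hScl : closure (MASection Ω u z t) ⊆ Metric.closedBall z s :=
    closure_minimal hSsub Metric.isClosed_closedBall
  have hv2 : ∀ y ∈ Metric.closedBall z s, ContDiffAt ℝ 2 (fun y => -2 / g z * g y) y :=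
    fun y hy => contDiffAt_const.mul (hg y (hsub hy)).2.1
  have hvol' := hvol Ω u h z (hball z hz (Metric.mem_ball_self hd)) t ht0 hfr
    (fun y => -2 / g z * g y + 3) (fun y hy => (hv2 y (hSsub hy)).add contDiffAt_const)
    (fun y hy => ((hv2 y (hScl hy)).add contDiffAt_const).continuousAt.continuousWithinAt)
    (fun y hy => by
      have : -2 / g z * g y + 3 = 2 / g z * (3 / 2 * g z - g y) := by field_simp; ring
      rw [this]
      exact mul_nonneg (by positivity) (sub_nonneg.2 (hgle y (hScl hy))))
    (by
      have : -2 / g z * g z + 3 = 1 := by field_simp; norm_num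
      exact this.le)
    (fun y hy => by
      rw [linMA_add (hv2 y (hSsub hy)) contDiffAt_const,
        linMA_const_mul (hg y (hsub (hSsub hy))).2.1, linMA_const, (hg y (hsub (hSsub hy))).2.2]
      simp)
  have hvle : volume.real {y ∈ MASection Ω u z t | -2 / g z * g y + 3 < 2} ≤
      volume.real {y ∈ Metric.closedBall x₁ ρ | g z / 2 ≤ g y} := by
    refine measureReal_mono ?_ ?_
    · rintro y ⟨hy, hlt⟩
      refine ⟨hsub (hSsub hy), ?_⟩
      have : -2 / g z * g y + 3 - 2 = 2 / g z * (g z / 2 - g y) := by field_simp; ring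
      have h1 : 2 / g z * (g z / 2 - g y) < 0 := by linarith
      have h2 : 0 < 2 / g z := by positivity
      linarith [neg_of_mul_neg_right h1 h2.le]
    · exact ((measure_mono inter_subset_left).trans_lt
        (isCompact_closedBall x₁ ρ).measure_lt_top).ne
  have hWz := hW (g z / 2) (by positivity)
  have hgv : g z * volume.real {y ∈ MASection Ω u z t | -2 / g z * g y + 3 < 2} ≤ 2 * W := by
    linarith [mul_le_mul_of_nonneg_left hvle hgz.le]
  have hkey : g z ^ 2 * (P * δ ^ (β * n)) ≤ 4 * W ^ 2 := by
    calc g z ^ 2 * (P * δ ^ (β * n)) = g z ^ 2 * (κ * t ^ n) := by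
          rw [hP, ht, hs, mul_pow c, ← pow_mul, mul_pow θ]
          ring
      _ ≤ g z ^ 2 * volume.real {y ∈ MASection Ω u z t | -2 / g z * g y + 3 < 2} ^ 2 :=
          mul_le_mul_of_nonneg_left hvol' (sq_nonneg _)
      _ = (g z * volume.real {y ∈ MASection Ω u z t | -2 / g z * g y + 3 < 2}) ^ 2 := by ring
      _ ≤ (2 * W) ^ 2 := pow_le_pow_left₀ (by positivity) hgv 2
      _ = 4 * W ^ 2 := by ring
  rw [hZ, le_div_iff₀ (by positivity)]
  calc g x₁ ^ 2 * (P * ρ ^ γ) = P * (g x₁ ^ 2 * ρ ^ γ) := by ring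
    _ ≤ P * (g z ^ 2 * δ ^ γ) := mul_le_mul_of_nonneg_left hmax₁ hP0.le
    _ = g z ^ 2 * (P * δ ^ (β * n)) * δ := by rw [hγ, pow_succ]; ring
    _ ≤ 4 * W ^ 2 * ρ := mul_le_mul hkey hδρ hδ0.le (by positivity)

lemma ball_subset_of_le_infDist_frontier {s : Set (E n)} {d : ℝ} (hs : IsOpen s)
    (hx : x ∈ s) (hd : d ≤ Metric.infDist x (frontier s)) : Metric.ball x d ⊆ s := by
  rcases le_or_gt d 0 with hd0 | hd0
  · rw [Metric.ball_eq_empty.2 hd0]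
    exact empty_subset s
  refine (convex_ball x d).isPreconnected.subset_of_closure_inter_subset hs
    ⟨x, Metric.mem_ball_self hd0, hx⟩ fun z ⟨hzs, hz⟩ => ?_
  by_contra hcon
  have := Metric.infDist_le_dist_of_mem (x := x) (hs.frontier_eq ▸ ⟨hzs, hcon⟩ : z ∈ frontier s)
  rw [Metric.mem_ball, dist_comm] at hz
  linarith

end GreenBound

/-- Boundedness of the Green's function near the boundary. -/
theorem green_bounded_near_boundary (n : ℕ) (hn : 2 ≤ n)
    (lam Lam : ℝ) (hlam : 0 < lam) (hlL : lam ≤ Lam)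
    (Ω V : Set (E n)) (hV : IsOpen V) (hVΩ : CptIn V Ω) :
    ∃ r > 0, ∃ C > 0, ∀ u : E n → ℝ,
      MASetup Ω u → DetBounds Ω u lam Lam →
      ∀ x₀ ∈ V,
        sInf ((fun y => Metric.infDist y (frontier Ω)) '' V) ≤ Metric.infDist x₀ (frontier V) →
        CptIn (MASection Ω u x₀ (2 * r)) V ∧
        ∀ g : E n → ℝ, IsGreen u V x₀ g →
          ∀ x ∈ frontier (MASection Ω u x₀ r), g x ≤ C := by
  by_cases hex : (∃ u, MASetup Ω u ∧ DetBounds Ω u lam Lam) ∧ V.Nonempty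
  swap
  · exact ⟨1, one_pos, 1, one_pos, fun u hu hd x hx => absurd ⟨⟨u, hu, hd⟩, ⟨x, hx⟩⟩ hex⟩
  obtain ⟨⟨u', hu', hd'⟩, hVne⟩ := hex
  have h' := hu'.isMASolution hd'
  have hn0 : n ≠ 0 := by lia
  have hLam : 0 < Lam := hlam.trans_le hlL
  have hΩb := h'.isBounded
  obtain ⟨hVc, hVΩ⟩ := hVΩ
  obtain ⟨D, hD0, hD⟩ : ∃ D : ℝ, 0 < D ∧ ∀ x ∈ closure Ω, ∀ y ∈ closure Ω, ‖y - x‖ ≤ D := by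
    refine ⟨Metric.diam (closure Ω) + 1, by linarith [Metric.diam_nonneg (s := closure Ω)],
      fun x hx y hy => ?_⟩
    rw [← dist_eq_norm]
    linarith [Metric.dist_le_diam_of_mem hΩb.closure hy hx]
  set d := sInf ((fun y => Metric.infDist y (frontier Ω)) '' V) with hd
  have hd0 : 0 < d := by
    obtain ⟨a, ha, hle⟩ := hVc.exists_forall_le' (f := fun y => Metric.infDist y (frontier Ω))
      (Metric.continuous_infDist_pt _).continuousOn (a := 0) fun y hy =>
        (isClosed_frontier.notMem_iff_infDist_pos (h'.frontier_nonempty hn0)).1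
          (fun hyf => (h'.isOpen.frontier_eq ▸ hyf).2 (hVΩ hy))
    refine ha.trans_le (le_csInf (hVne.image _) ?_)
    rintro _ ⟨y, hy, rfl⟩
    exact hle y (subset_closure hy)
  have hVball : ∀ y ∈ V, Metric.ball y d ⊆ Ω := fun y hy =>
    ball_subset_of_le_infDist_frontier h'.isOpen (hVΩ (subset_closure hy))
      (csInf_le ⟨0, by rintro _ ⟨z, -, rfl⟩; exact Metric.infDist_nonneg⟩ ⟨y, hy, rfl⟩)
  obtain ⟨M, hM0, hM⟩ := exists_lower_bound (lam := lam) hn0 hΩb hLam.le hD0 hD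
  obtain ⟨c, hc, β, hsec⟩ := exists_section_subset_ball hn0 hΩb hlam hLam.le hD0 hD hd0
  set s := min (d / 4) D with hs
  have hs0 : 0 < s := lt_min (by positivity) hD0
  set r := c * s ^ β / 2 with hr
  have hr0 : 0 < r := by positivity
  have h2r : 2 * r = c * s ^ β := by rw [hr]; ring
  set ρ := min (min (r * d / (8 * M)) (d / 4)) D with hρ
  have hρ0 : 0 < ρ := lt_min (lt_min (by positivity) (by positivity)) hD0
  obtain ⟨C, hC, hbound⟩ := exists_pointwise_bound hn0 hΩb hlam hLam hD0 hD hd0 hρ0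
    (min_le_right _ _) (2 * (M + 1) / (n * lam))
  refine ⟨r, hr0, C, hC, fun u hu hdet x₀ hx₀ hdist => ?_⟩
  have h := hu.isMASolution hdet
  obtain ⟨hsecb, hfr⟩ := hsec u h x₀ (hVball x₀ hx₀) s hs0 (min_le_right _ _)
  rw [← h2r] at hfr hsecb
  have hballV : Metric.ball x₀ d ⊆ V := ball_subset_of_le_infDist_frontier hV hx₀ hdist
  have hcl : ∀ t ≤ 2 * r, closure (MASection Ω u x₀ t) ⊆ Metric.closedBall x₀ (d / 4) := by
    refine fun t ht => closure_minimal (fun y hy => ?_) Metric.isClosed_closedBall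
    rw [mem_MASection_iff] at hy
    exact mem_closedBall_iff_norm.2 ((hsecb y hy.1 (hy.2.trans_le ht)).trans (min_le_left _ _))
  have hcV : Metric.closedBall x₀ (d / 2) ⊆ V :=
    (Metric.closedBall_subset_ball (by linarith)).trans hballV
  refine ⟨⟨(isCompact_closedBall x₀ (d / 4)).of_isClosed_subset isClosed_closure (hcl _ le_rfl),
    (hcl _ le_rfl).trans ((Metric.closedBall_subset_closedBall (by linarith)).trans hcV)⟩,
    fun g hg x hx => ?_⟩
  have hxb := hcl r (by linarith) (frontier_subset_closure hx)
  have hxV : x ∈ V := hcV (Metric.closedBall_subset_closedBall (by linarith) hxb)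
  have hVΩ' : V ⊆ Ω := subset_closure.trans hVΩ
  have hxe := (h.isOpen_MASection fun z hz => by linarith [hfr z hz]).2.2 x hx
  rw [mem_closedBall_iff_norm] at hxb
  have hfar : r * d / (4 * M) ≤ ‖x - x₀‖ := by
    have h1 := h.excess_nonneg (hVΩ' hxV) (subset_closure (hVΩ' hx₀))
    have h2 := h.norm_fderiv_le hn0 (hM u h) hM0 hd0 (hVball x hxV)
    have h3 := h.norm_fderiv_le hn0 (hM u h) hM0 hd0 (hVball x₀ hx₀)
    have h4 : r ≤ (fderiv ℝ u x - fderiv ℝ u x₀) (x - x₀) := by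
      rw [excess] at h1 hxe
      rw [← neg_sub x x₀, map_neg] at h1
      rw [_root_.sub_apply]
      linarith
    have h5 : (fderiv ℝ u x - fderiv ℝ u x₀) (x - x₀) ≤ (2 * M / d + 2 * M / d) * ‖x - x₀‖ :=
      (le_abs_self _).trans ((ContinuousLinearMap.le_opNorm _ _).trans
        (mul_le_mul_of_nonneg_right ((norm_sub_le _ _).trans (add_le_add h2 h3))
          (norm_nonneg _)))
    rw [div_le_iff₀ (by positivity)]
    calc r * d ≤ (2 * M / d + 2 * M / d) * ‖x - x₀‖ * d :=
          mul_le_mul_of_nonneg_right (h4.trans h5) hd0.le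
      _ = ‖x - x₀‖ * (4 * M) := by field_simp; ring
  have hρd : ρ ≤ d / 4 := (min_le_left _ _).trans (min_le_right _ _)
  have hρlt : ρ < ‖x - x₀‖ := by
    have h1 : ρ ≤ r * d / (8 * M) := (min_le_left _ _).trans (min_le_left _ _)
    have h2 : r * d / (8 * M) = r * d / (4 * M) / 2 := by field_simp; norm_num
    have h3 : 0 < r * d / (4 * M) := by positivity
    linarith
  have hin : Metric.closedBall x ρ ⊆ V \ {x₀} := by
    intro y hy
    rw [mem_closedBall_iff_norm] at hy
    refine ⟨hcV (mem_closedBall_iff_norm.2 ?_), ?_⟩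
    · linarith [norm_sub_le_norm_sub_add_norm_sub y x x₀]
    · rintro rfl
      rw [norm_sub_rev] at hy
      linarith
  have hopen : IsOpen (V \ {x₀}) := hV.sdiff isClosed_singleton
  have hgs : ∀ y ∈ Metric.closedBall x ρ, ContDiffAt ℝ 2 g y := fun y hy =>
    (hg.2.1.contDiffAt (hopen.mem_nhds (hin hy))).of_le
      (WithTop.coe_le_coe.2 (le_top : (2 : ℕ∞) ≤ ⊤))
  refine hbound u h x (fun y hy => hVball y (hin hy).1) g
    (fun y hy => ⟨hg.1 y (hin hy), hgs y hy, hg.2.2.1 y (hin hy)⟩) fun G hG => ?_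
  have hgc : ContinuousOn g (Metric.closedBall x ρ) := fun y hy =>
    (hgs y hy).continuousAt.continuousWithinAt
  have hA := (hgc.preimage_isClosed_of_isClosed Metric.isClosed_closedBall
    (isClosed_Ici (a := G))).measurableSet
  have hvol := h.volume_superlevel_le hn hlam hV hVc hVΩ hx₀
    (fun y hy => hM u h y (subset_closure (hVΩ hy))) hg hG hA
    (Set.inter_subset_left.trans hin) fun y hy => hy.2
  have hn' : (0 : ℝ) < n := by exact_mod_cast hn0.bot_lt
  rw [le_div_iff₀ (by positivity)]
  change G * volume.real (Metric.closedBall x ρ ∩ g ⁻¹' Set.Ici G) * (n * lam) ≤ _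
  linarith
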